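/- arXiv:1904.06176 — 2 statements merged into one kernel-verified Lean document; each statement's English description precedes it below -/
import Mathlib

section
/- Let n ≥ 3 and N ≥ 2n, and fix μ ∈ {−1, 1}. There exists ε₀ > 0, depending only on n and N, with the following property: let 0 < ε ≤ ε₀ and let f : [0,T) × ℝⁿ_x × ℝⁿ_v → ℝ be a smooth solution of the Vlasov–Yukawa system ∂_t f + v·∇ₓ f + μ ∇ₓφ·∇ᵥ f = 0 with potential φ(t,x) = ∫_{ℝⁿ} G₁(x−y) ρ(f)(t,y) dy, such that f(t,·,·) is compactly supported in (x,v) for each t, the function t ↦ 𝓔_N[f(t)] is continuous, and 𝓔_N[f(0)] ≤ ε. Then 𝓔_N[f(t)] ≤ 2ε for all t ∈ [0,T). -/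
noncomputable section

open MeasureTheory Real

/-- `E n` is the Euclidean space `ℝⁿ`. -/
abbrev E (n : ℕ) : Type := EuclideanSpace ℝ (Fin n)

/-- Index set for the commuting vector fields: spatial translations `∂_{xⁱ}`,
uniform motions `t∂_{xⁱ} + ∂_{vⁱ}` (macroscopically `t∂_{xⁱ}`),
rotations `Ωˣᵢⱼ + Ωᵛᵢⱼ` for `i < j` (macroscopically `Ωˣᵢⱼ`),
and the scaling `Sˣ + Sᵛ` (macroscopically `Sˣ`). -/
abbrev VFIdx (n : ℕ) : Type := Fin n ⊕ Fin n ⊕ {p : Fin n × Fin n // p.1 < p.2} ⊕ Unit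

variable {n : ℕ}

/-- Partial derivative of `g : ℝⁿ → ℝ` at `x` in the `i`-th coordinate direction. -/
def pd (i : Fin n) (g : E n → ℝ) (x : E n) : ℝ :=
  fderiv ℝ g x (EuclideanSpace.single i 1)

/-- Iterated coordinate partial derivatives `∂ₓ^α`. -/
def pdList (ds : List (Fin n)) (g : E n → ℝ) : E n → ℝ :=
  ds.foldr (fun i h => pd i h) g

/-- The action of a microscopic vector field of the family `γ`
on a function `f(t,x,v)`. -/
def microApply (Z : VFIdx n) (f : ℝ → E n → E n → ℝ) : ℝ → E n → E n → ℝ :=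
  fun t x v =>
    match Z with
    | Sum.inl i => pd i (fun y => f t y v) x
    | Sum.inr (Sum.inl i) => t * pd i (fun y => f t y v) x + pd i (fun w => f t x w) v
    | Sum.inr (Sum.inr (Sum.inl p)) =>
        x p.1.1 * pd p.1.2 (fun y => f t y v) x - x p.1.2 * pd p.1.1 (fun y => f t y v) x
          + v p.1.1 * pd p.1.2 (fun w => f t x w) v - v p.1.2 * pd p.1.1 (fun w => f t x w) v
    | Sum.inr (Sum.inr (Sum.inr _)) =>
        (∑ i, x i * pd i (fun y => f t y v) x) + ∑ i, v i * pd i (fun w => f t x w) v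

/-- The action of a macroscopic vector field of the family `Γ`
on a function `φ(t,x)`. -/
def macroApply (Z : VFIdx n) (φ : ℝ → E n → ℝ) : ℝ → E n → ℝ :=
  fun t x =>
    match Z with
    | Sum.inl i => pd i (φ t) x
    | Sum.inr (Sum.inl i) => t * pd i (φ t) x
    | Sum.inr (Sum.inr (Sum.inl p)) =>
        x p.1.1 * pd p.1.2 (φ t) x - x p.1.2 * pd p.1.1 (φ t) x
    | Sum.inr (Sum.inr (Sum.inr _)) => ∑ i, x i * pd i (φ t) x

/-- Composition `Z^α = Z^{α₁} ⋯ Z^{α_k}` of microscopic vector fields. -/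
def microList (L : List (VFIdx n)) (f : ℝ → E n → E n → ℝ) : ℝ → E n → E n → ℝ :=
  L.foldr microApply f

/-- Composition `Z^α = Z^{α₁} ⋯ Z^{α_k}` of macroscopic vector fields. -/
def macroList (L : List (VFIdx n)) (φ : ℝ → E n → ℝ) : ℝ → E n → ℝ :=
  L.foldr macroApply φ

/-- Velocity average `ρ(f)(t,x) = ∫ f(t,x,v) dv`. -/
def rho (f : ℝ → E n → E n → ℝ) (t : ℝ) (x : E n) : ℝ := ∫ v : E n, f t x v

/-- The spatial Laplacian. -/
def lap (g : E n → ℝ) (x : E n) : ℝ := ∑ i, pd i (fun y => pd i g y) x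

/-- The free transport operator `T(f) = ∂_t f + v·∇ₓ f`. -/
def Tfree (f : ℝ → E n → E n → ℝ) : ℝ → E n → E n → ℝ :=
  fun t x v => deriv (fun s => f s x v) t + ∑ i, v i * pd i (fun y => f t y v) x

/-- The perturbed transport operator `T_φ(f) = ∂_t f + v·∇ₓ f + μ ∇ₓφ·∇ᵥ f`. -/
def Tphi (μ : ℝ) (φ : ℝ → E n → ℝ) (f : ℝ → E n → E n → ℝ) : ℝ → E n → E n → ℝ :=
  fun t x v => Tfree f t x v + μ * ∑ i, pd i (φ t) x * pd i (fun w => f t x w) v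

/-- The energy `𝓔_N[f](t) = Σ_{|α| ≤ N} ‖Z^α f‖_{L¹(ℝⁿ_x × ℝⁿ_v)}`. -/
def energy (n N : ℕ) (f : ℝ → E n → E n → ℝ) (t : ℝ) : ℝ :=
  ∑ m ∈ Finset.range (N + 1), ∑ α : Fin m → VFIdx n,
    ∫ x : E n, ∫ v : E n, |microList (List.ofFn α) f t x v|

/-- Smoothness of a function of `(t,x,v)`. -/
def SmoothTXV (n : ℕ) (f : ℝ → E n → E n → ℝ) : Prop :=
  ContDiff ℝ (⊤ : ℕ∞) (fun p : ℝ × E n × E n => f p.1 p.2.1 p.2.2)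

/-- Smoothness of a function of `(t,x)`. -/
def SmoothTX (n : ℕ) (φ : ℝ → E n → ℝ) : Prop :=
  ContDiff ℝ (⊤ : ℕ∞) (fun p : ℝ × E n => φ p.1 p.2)

/-- The modified Bessel function of the second kind `K_ν(r)`. -/
def Kfun (ν r : ℝ) : ℝ :=
  ∫ l in Set.Ioi (0 : ℝ), Real.exp (-(r * Real.cosh l)) * Real.cosh (ν * l)

/-- The Yukawa Green's function `G₁(x) = c |x|^{1-n/2} K_{n/2-1}(|x|)`. -/
def Gyukawa (n : ℕ) (c : ℝ) (x : E n) : ℝ :=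
  c * ‖x‖ ^ ((1 : ℝ) - (n : ℝ) / 2) * Kfun ((n : ℝ) / 2 - 1) ‖x‖

/-- Convolution of two scalar functions on `ℝⁿ`. -/
def conv (g h : E n → ℝ) (x : E n) : ℝ := ∫ y : E n, g (x - y) * h y

/-- `k`-fold convolution with `g` (the `0`-fold one being the identity). -/
def convIter (g : E n → ℝ) : ℕ → (E n → ℝ) → E n → ℝ
  | 0, h => h
  | m + 1, h => conv g (convIter g m h)

open scoped ContDiff

/-- Smooth and compactly supported. -/
def Cc {V : Type*} [NormedAddCommGroup V] [NormedSpace ℝ V] (g : V → ℝ) : Prop :=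
  ContDiff ℝ ∞ g ∧ HasCompactSupport g

/-- the standard basis vector -/
def eb (i : Fin n) : E n := EuclideanSpace.single i 1

def U0 (Z : VFIdx n) : E n :=
  match Z with
  | Sum.inl i => eb i
  | _ => 0

def V0 (Z : VFIdx n) : E n :=
  match Z with
  | Sum.inr (Sum.inl i) => eb i
  | _ => 0

def kap (Z : VFIdx n) : ℝ :=
  match Z with
  | Sum.inr (Sum.inr (Sum.inr _)) => 1
  | _ => 0

def rotL (i j : Fin n) : E n →L[ℝ] E n :=
  (EuclideanSpace.proj i : E n →L[ℝ] ℝ).smulRight (eb j)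
    - (EuclideanSpace.proj j : E n →L[ℝ] ℝ).smulRight (eb i)

def YA (Z : VFIdx n) : E n →L[ℝ] E n :=
  match Z with
  | Sum.inl _ => 0
  | Sum.inr (Sum.inl _) => 0
  | Sum.inr (Sum.inr (Sum.inl p)) => rotL p.1.1 p.1.2
  | Sum.inr (Sum.inr (Sum.inr _)) => ContinuousLinearMap.id ℝ (E n)

/-- macroscopic vector field -/
def Yv (Z : VFIdx n) (t : ℝ) (x : E n) : E n := U0 Z + t • V0 Z + YA Z x

/-- microscopic vector field -/
def XV (Z : VFIdx n) (t : ℝ) (p : E n × E n) : E n × E n := (Yv Z t p.1, V0 Z + YA Z p.2)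

def ZZ (Z : VFIdx n) (t : ℝ) (g : E n × E n → ℝ) (p : E n × E n) : ℝ := fderiv ℝ g p (XV Z t p)

def GG (Z : VFIdx n) (t : ℝ) (u : E n → ℝ) (x : E n) : ℝ := fderiv ℝ u x (Yv Z t x)

def ZL (L : List (VFIdx n)) (t : ℝ) (g : E n × E n → ℝ) : E n × E n → ℝ :=
  L.foldr (fun Z h => ZZ Z t h) g

def GM (L : List (VFIdx n)) (t : ℝ) (u : E n → ℝ) : E n → ℝ :=
  L.foldr (fun Z h => GG Z t h) u

lemma Yv_contDiff (Z : VFIdx n) (t : ℝ) : ContDiff ℝ ∞ (Yv Z t) := by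
  unfold Yv; fun_prop

lemma XV_contDiff (Z : VFIdx n) (t : ℝ) : ContDiff ℝ ∞ (XV Z t) := by
  unfold XV Yv; fun_prop

lemma contDiff_fderiv_field {V W : Type*} [NormedAddCommGroup V] [NormedSpace ℝ V]
    [NormedAddCommGroup W] [NormedSpace ℝ W] {g : V → W}
    (hg : ContDiff ℝ ∞ g) {X : V → V} (hX : ContDiff ℝ ∞ X) :
    ContDiff ℝ ∞ (fun p => fderiv ℝ g p (X p)) :=
  ContDiff.clm_apply (hg.fderiv_right (m := ∞) (by norm_num)) hX

lemma ZZ_contDiff {Z : VFIdx n} {t : ℝ} {g : E n × E n → ℝ} (hg : ContDiff ℝ ∞ g) :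
    ContDiff ℝ ∞ (ZZ Z t g) := contDiff_fderiv_field hg (XV_contDiff Z t)

lemma GG_contDiff {Z : VFIdx n} {t : ℝ} {u : E n → ℝ} (hu : ContDiff ℝ ∞ u) :
    ContDiff ℝ ∞ (GG Z t u) := contDiff_fderiv_field hu (Yv_contDiff Z t)

lemma hcs_fderiv_field {V : Type*} [NormedAddCommGroup V] [NormedSpace ℝ V] {g : V → ℝ}
    (hg : HasCompactSupport g) (X : V → V) :
    HasCompactSupport (fun p => fderiv ℝ g p (X p)) := by
  refine (hg.fderiv (𝕜 := ℝ)).mono ?_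
  intro p hp
  simp only [Function.mem_support] at hp ⊢
  intro h; apply hp; rw [h]; simp

lemma Cc.field {V : Type*} [NormedAddCommGroup V] [NormedSpace ℝ V] {g : V → ℝ}
    (hg : Cc g) {X : V → V} (hX : ContDiff ℝ ∞ X) : Cc (fun p => fderiv ℝ g p (X p)) :=
  ⟨contDiff_fderiv_field hg.1 hX, hcs_fderiv_field hg.2 X⟩

lemma Cc.ZZ {Z : VFIdx n} {t : ℝ} {g : E n × E n → ℝ} (hg : Cc g) : Cc (ZZ Z t g) :=
  hg.field (XV_contDiff Z t)

lemma Cc.GG {Z : VFIdx n} {t : ℝ} {g : E n → ℝ} (hg : Cc g) : Cc (GG Z t g) :=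
  hg.field (Yv_contDiff Z t)

lemma Cc.ZL {L : List (VFIdx n)} {t : ℝ} {g : E n × E n → ℝ} (hg : Cc g) : Cc (ZL L t g) := by
  induction L with
  | nil => exact hg
  | cons Z L ih => exact ih.ZZ

lemma GM_contDiff {L : List (VFIdx n)} {t : ℝ} {u : E n → ℝ} (hu : ContDiff ℝ ∞ u) :
    ContDiff ℝ ∞ (GM L t u) := by
  induction L with
  | nil => exact hu
  | cons Z L ih => exact GG_contDiff ih

lemma ZL_contDiff {L : List (VFIdx n)} {t : ℝ} {g : E n × E n → ℝ} (hg : ContDiff ℝ ∞ g) :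
    ContDiff ℝ ∞ (ZL L t g) := by
  induction L with
  | nil => exact hg
  | cons Z L ih => exact ZZ_contDiff ih

lemma ZL_append (L M : List (VFIdx n)) (t : ℝ) (g : E n × E n → ℝ) :
    ZL (L ++ M) t g = ZL L t (ZL M t g) := by
  simp [ZL, List.foldr_append]

/-- commutator of two derivations -/
lemma comm_fields {V : Type*} [NormedAddCommGroup V] [NormedSpace ℝ V] {g : V → ℝ}
    (hg : ContDiff ℝ ∞ g) {X Y : V → V} (hX : Differentiable ℝ X) (hY : Differentiable ℝ Y)
    (p : V) :
    fderiv ℝ (fun q => fderiv ℝ g q (Y q)) p (X p) =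
      fderiv ℝ (fun q => fderiv ℝ g q (X q)) p (Y p)
        + fderiv ℝ g p (fderiv ℝ Y p (X p) - fderiv ℝ X p (Y p)) := by
  have hd : Differentiable ℝ (fderiv ℝ g) :=
    (hg.fderiv_right (m := ∞) (by norm_num)).differentiable (by norm_num)
  have hs : IsSymmSndFDerivAt ℝ g p := hg.contDiffAt.isSymmSndFDerivAt (by simp; exact WithTop.coe_le_coe.2 (le_top : (2 : ℕ∞) ≤ ⊤))
  rw [fderiv_clm_apply (hd p) (hY p), fderiv_clm_apply (hd p) (hX p)]
  have := hs (X p) (Y p)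
  simp [map_sub] at this ⊢
  rw [this]; ring

lemma pd_fst {g : E n × E n → ℝ} (hg : ContDiff ℝ ∞ g) (i : Fin n) (x v : E n) :
    pd i (fun y => g (y, v)) x = fderiv ℝ g (x, v) (eb i, 0) := by
  have h1 : HasFDerivAt (fun y : E n => (y, v)) (ContinuousLinearMap.inl ℝ (E n) (E n)) x :=
    hasFDerivAt_prodMk_left x v
  have h2 := ((hg.differentiable (by norm_num)) (x, v)).hasFDerivAt.comp x h1
  have h3 : fderiv ℝ (fun y => g (y, v)) x = _ := h2.fderiv
  unfold pd
  rw [h3]; simp [eb]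

lemma pd_snd {g : E n × E n → ℝ} (hg : ContDiff ℝ ∞ g) (i : Fin n) (x v : E n) :
    pd i (fun y => g (x, y)) v = fderiv ℝ g (x, v) (0, eb i) := by
  have h1 : HasFDerivAt (fun y : E n => (x, y)) (ContinuousLinearMap.inr ℝ (E n) (E n)) v :=
    hasFDerivAt_prodMk_right x v
  have h2 := ((hg.differentiable (by norm_num)) (x, v)).hasFDerivAt.comp v h1
  have h3 : fderiv ℝ (fun y => g (x, y)) v = _ := h2.fderiv
  unfold pd
  rw [h3]; simp [eb]

lemma sum_eb (x : E n) : x = ∑ i, x i • eb i := by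
  ext j; simp [eb, Pi.single_apply]

lemma rotL_apply (i j : Fin n) (x : E n) : rotL i j x = x i • eb j - x j • eb i := by
  simp [rotL]

lemma fderiv_sum_fst (ℓ : E n × E n →L[ℝ] ℝ) (x : E n) :
    ℓ (x, 0) = ∑ i, x i * ℓ (eb i, 0) := by
  have : (x, (0 : E n)) = ∑ i, x i • (eb i, (0 : E n)) := by
    ext j
    · simp [Prod.fst_sum, eb, Pi.single_apply]
    · simp [Prod.snd_sum]
  rw [this, map_sum]; exact Finset.sum_congr rfl fun i _ => by rw [map_smul, smul_eq_mul]

lemma fderiv_sum_snd (ℓ : E n × E n →L[ℝ] ℝ) (x : E n) :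
    ℓ (0, x) = ∑ i, x i * ℓ (0, eb i) := by
  have : ((0 : E n), x) = ∑ i, x i • ((0 : E n), eb i) := by
    ext j
    · simp [Prod.fst_sum]
    · simp [Prod.snd_sum, eb, Pi.single_apply]
  rw [this, map_sum]; exact Finset.sum_congr rfl fun i _ => by rw [map_smul, smul_eq_mul]

lemma microApply_eq {Z : VFIdx n} {f : ℝ → E n → E n → ℝ} {t : ℝ}
    (hf : ContDiff ℝ ∞ (fun p : E n × E n => f t p.1 p.2)) (x v : E n) :
    microApply Z f t x v = ZZ Z t (fun p => f t p.1 p.2) (x, v) := by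
  have hx : ∀ i, pd i (fun y => f t y v) x
      = fderiv ℝ (fun p : E n × E n => f t p.1 p.2) (x, v) (eb i, 0) := fun i => pd_fst hf i x v
  have hv : ∀ i, pd i (fun y => f t x y) v
      = fderiv ℝ (fun p : E n × E n => f t p.1 p.2) (x, v) (0, eb i) := fun i => pd_snd hf i x v
  have split : ∀ (ℓ : E n × E n →L[ℝ] ℝ) (a b : E n), ℓ (a, b) = ℓ (a, 0) + ℓ (0, b) := by
    intro ℓ a b; rw [← map_add]; simp
  have hsm1 : ∀ (ℓ : E n × E n →L[ℝ] ℝ) (c : ℝ) (a : E n), ℓ (c • a, 0) = c * ℓ (a, 0) := by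
    intro ℓ c a
    have : (c • a, (0 : E n)) = c • (a, (0 : E n)) := by simp
    rw [this, map_smul, smul_eq_mul]
  have hsm2 : ∀ (ℓ : E n × E n →L[ℝ] ℝ) (c : ℝ) (a : E n), ℓ (0, c • a) = c * ℓ (0, a) := by
    intro ℓ c a
    have : ((0 : E n), c • a) = c • ((0 : E n), a) := by simp
    rw [this, map_smul, smul_eq_mul]
  have hsub1 : ∀ (ℓ : E n × E n →L[ℝ] ℝ) (a b : E n), ℓ (a - b, 0) = ℓ (a, 0) - ℓ (b, 0) := by
    intro ℓ a b; rw [← map_sub]; simp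
  have hsub2 : ∀ (ℓ : E n × E n →L[ℝ] ℝ) (a b : E n), ℓ (0, a - b) = ℓ (0, a) - ℓ (0, b) := by
    intro ℓ a b; rw [← map_sub]; simp
  unfold ZZ
  set ℓ := fderiv ℝ (fun p : E n × E n => f t p.1 p.2) (x, v)
  rcases Z with i | i | p | u
  · simp [microApply, XV, Yv, U0, V0, YA, hx]
  · simp only [microApply, XV, Yv, U0, V0, YA, hx, hv]
    conv_rhs => rw [split]
    simp [hsm1]
  · simp only [microApply, XV, Yv, U0, V0, YA, hx, hv, rotL_apply]
    conv_rhs => rw [split]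
    simp [hsm1, hsm2, hsub1, hsub2]; ring
  · simp only [microApply, XV, Yv, U0, V0, YA, hx, hv]
    conv_rhs => rw [split]
    simp [fderiv_sum_fst ℓ x, fderiv_sum_snd ℓ v]

/-- The space-time vector field. -/
def XS (Z : VFIdx n) (q : ℝ × E n × E n) : ℝ × E n × E n := (0, XV Z q.1 q.2)

def TS (q : ℝ × E n × E n) : ℝ × E n × E n := (1, q.2.2, 0)

lemma XS_contDiff (Z : VFIdx n) : ContDiff ℝ ∞ (XS Z) := by
  unfold XS XV Yv; fun_prop

lemma TS_contDiff : ContDiff ℝ ∞ (TS : ℝ × E n × E n → _) := by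
  unfold TS; fun_prop

lemma slice_fderiv {F : ℝ × E n × E n → ℝ} (hF : ContDiff ℝ ∞ F) (t : ℝ) (p w : E n × E n) :
    fderiv ℝ (fun p => F (t, p)) p w = fderiv ℝ F (t, p) (0, w) := by
  have h1 : HasFDerivAt (fun y : E n × E n => (t, y)) (ContinuousLinearMap.inr ℝ ℝ (E n × E n)) p :=
    hasFDerivAt_prodMk_right t p
  have h2 := ((hF.differentiable (by norm_num)) (t, p)).hasFDerivAt.comp p h1
  have h3 : fderiv ℝ (fun p => F (t, p)) p = _ := h2.fderiv
  rw [h3]; simp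

lemma slice_deriv {F : ℝ × E n × E n → ℝ} (hF : ContDiff ℝ ∞ F) (t : ℝ) (p : E n × E n) :
    HasDerivAt (fun s => F (s, p)) (fderiv ℝ F (t, p) (1, 0)) t := by
  have h1 : HasDerivAt (fun s : ℝ => (s, p)) ((1 : ℝ), (0 : E n × E n)) t :=
    (hasDerivAt_id t).prodMk (hasDerivAt_const t p)
  exact ((hF.differentiable (by norm_num)) (t, p)).hasFDerivAt.comp_hasDerivAt t h1

lemma slice_contDiff {F : ℝ × E n × E n → ℝ} (hF : ContDiff ℝ ∞ F) (t : ℝ) :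
    ContDiff ℝ ∞ (fun p => F (t, p)) := by fun_prop

lemma TS_comm {F : ℝ × E n × E n → ℝ} (hF : ContDiff ℝ ∞ F) (Z : VFIdx n) (q : ℝ × E n × E n) :
    fderiv ℝ (fun q => fderiv ℝ F q (XS Z q)) q (TS q)
      = fderiv ℝ (fun q => fderiv ℝ F q (TS q)) q (XS Z q) := by
  rw [comm_fields hF (X := TS) (Y := XS Z) (TS_contDiff.differentiable (by norm_num))
    ((XS_contDiff Z).differentiable (by norm_num))]
  have hT : HasFDerivAt (TS : ℝ × E n × E n → _)
      ((0 : ℝ × E n × E n →L[ℝ] ℝ).prod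
        (((ContinuousLinearMap.snd ℝ (E n) (E n)).comp (ContinuousLinearMap.snd ℝ ℝ (E n × E n))).prod 0)) q := by
    refine (hasFDerivAt_const _ _).prodMk (HasFDerivAt.prodMk ?_ (hasFDerivAt_const _ _))
    exact ((ContinuousLinearMap.snd ℝ (E n) (E n)).comp
      (ContinuousLinearMap.snd ℝ ℝ (E n × E n))).hasFDerivAt
  let c1 : ℝ × E n × E n →L[ℝ] E n :=
    (ContinuousLinearMap.fst ℝ ℝ (E n × E n)).smulRight (V0 Z)
      + (YA Z).comp ((ContinuousLinearMap.fst ℝ (E n) (E n)).comp (ContinuousLinearMap.snd ℝ ℝ (E n × E n)))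
  let c2 : ℝ × E n × E n →L[ℝ] E n :=
    (YA Z).comp ((ContinuousLinearMap.snd ℝ (E n) (E n)).comp (ContinuousLinearMap.snd ℝ ℝ (E n × E n)))
  have hX : HasFDerivAt (XS Z) ((0 : ℝ × E n × E n →L[ℝ] ℝ).prod (c1.prod c2)) q := by
    refine (hasFDerivAt_const _ _).prodMk (HasFDerivAt.prodMk ?_ ?_)
    · have := c1.hasFDerivAt (x := q) |>.const_add (U0 Z)
      refine this.congr_of_eventuallyEq (Filter.Eventually.of_forall fun y => ?_)
      simp [Yv, c1, add_assoc]
    · have := c2.hasFDerivAt (x := q) |>.const_add (V0 Z)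
      exact this
  rw [hT.fderiv, hX.fderiv]
  simp [TS, XS, XV, c1, c2]

/-- iterated space-time fields -/
def SL (L : List (VFIdx n)) (F : ℝ × E n × E n → ℝ) : ℝ × E n × E n → ℝ :=
  L.foldr (fun Z h q => fderiv ℝ h q (XS Z q)) F

lemma SL_contDiff {L : List (VFIdx n)} {F : ℝ × E n × E n → ℝ} (hF : ContDiff ℝ ∞ F) :
    ContDiff ℝ ∞ (SL L F) := by
  induction L with
  | nil => exact hF
  | cons Z L ih => exact contDiff_fderiv_field ih (XS_contDiff Z)

lemma SL_slice {L : List (VFIdx n)} {F : ℝ × E n × E n → ℝ} (hF : ContDiff ℝ ∞ F) (t : ℝ) :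
    (fun p => SL L F (t, p)) = ZL L t (fun p => F (t, p)) := by
  induction L with
  | nil => rfl
  | cons Z L ih =>
    change _ = ZZ Z t (ZL L t _)
    rw [← ih]
    funext p
    unfold ZZ
    rw [slice_fderiv (SL_contDiff hF)]
    rfl

lemma SL_T {L : List (VFIdx n)} {F : ℝ × E n × E n → ℝ} (hF : ContDiff ℝ ∞ F) :
    (fun q => fderiv ℝ (SL L F) q (TS q)) = SL L (fun q => fderiv ℝ F q (TS q)) := by
  induction L with
  | nil => rfl
  | cons Z L ih =>
    funext q
    change fderiv ℝ (fun q => fderiv ℝ (SL L F) q (XS Z q)) q (TS q)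
      = fderiv ℝ (SL L (fun q => fderiv ℝ F q (TS q))) q (XS Z q)
    rw [TS_comm (SL_contDiff hF), ih]

lemma microList_eq {L : List (VFIdx n)} {f : ℝ → E n → E n → ℝ}
    (hf : SmoothTXV n f) (t : ℝ) (x v : E n) :
    microList L f t x v = SL L (fun q => f q.1 q.2.1 q.2.2) (t, x, v) := by
  induction L generalizing t x v with
  | nil => rfl
  | cons Z L ih =>
    change microApply Z (microList L f) t x v = _
    have hsm : ContDiff ℝ ∞ (SL L (fun q : ℝ × E n × E n => f q.1 q.2.1 q.2.2)) := SL_contDiff hf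
    have e : (fun p : E n × E n => microList L f t p.1 p.2)
        = fun p => SL L (fun q : ℝ × E n × E n => f q.1 q.2.1 q.2.2) (t, p) := by
      funext p; exact ih t p.1 p.2
    rw [microApply_eq (by rw [e]; exact slice_contDiff hsm t), e]
    unfold ZZ
    rw [slice_fderiv hsm]; rfl


/-- The nonlinearity `∇ₓu · ∇ᵥg`. -/
def dB (u : E n → ℝ) (g : E n × E n → ℝ) (p : E n × E n) : ℝ :=
  ∑ i, fderiv ℝ u p.1 (eb i) * fderiv ℝ g p (0, eb i)

lemma dB_contDiff {u : E n → ℝ} {g : E n × E n → ℝ} (hu : ContDiff ℝ ∞ u) (hg : ContDiff ℝ ∞ g) :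
    ContDiff ℝ ∞ (dB u g) := by
  unfold dB
  refine ContDiff.sum fun i _ => ?_
  refine ContDiff.mul ?_ (contDiff_fderiv_field hg contDiff_const)
  exact (contDiff_fderiv_field hu contDiff_const).comp contDiff_fst

lemma Cc.dB {u : E n → ℝ} {g : E n × E n → ℝ} (hu : ContDiff ℝ ∞ u) (hg : Cc g) :
    Cc (dB u g) := by
  refine ⟨dB_contDiff hu hg.1, ?_⟩
  refine (hg.2.fderiv (𝕜 := ℝ)).mono ?_
  intro p hp
  simp only [Function.mem_support] at hp ⊢
  intro h; apply hp; simp [_root_.dB, h]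

lemma YA_skew (Z : VFIdx n) (ℓ m : E n →L[ℝ] ℝ) :
    ∑ a, (ℓ (YA Z (eb a)) * m (eb a) + ℓ (eb a) * m (YA Z (eb a)))
      = 2 * kap Z * ∑ a, ℓ (eb a) * m (eb a) := by
  rcases Z with i | i | p | u
  · simp [YA, kap]
  · simp [YA, kap]
  · simp only [YA, kap, rotL_apply, map_sub, map_smul, smul_eq_mul, sub_mul, mul_sub]
    simp only [Finset.sum_add_distrib, Finset.sum_sub_distrib]
    have : ∀ (a b : Fin n), (eb a : E n) b = if b = a then 1 else 0 := by
      intro a b; simp [eb, Pi.single_apply]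
    simp only [this, mul_ite, ite_mul, mul_one, one_mul, zero_mul, mul_zero,
      Finset.sum_ite_eq, Finset.mem_univ, if_true]
    ring
  · simp only [YA, kap, Finset.mul_sum, ContinuousLinearMap.id_apply]
    exact Finset.sum_congr rfl fun a _ => by ring

lemma fderiv_Yv (Z : VFIdx n) (t : ℝ) (x : E n) : fderiv ℝ (Yv Z t) x = YA Z := by
  have : HasFDerivAt (Yv Z t) (YA Z) x := (YA Z).hasFDerivAt.const_add (U0 Z + t • V0 Z)
  exact this.fderiv

lemma hasFDerivAt_XV (Z : VFIdx n) (t : ℝ) (p : E n × E n) :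
    HasFDerivAt (XV Z t) ((YA Z).prodMap (YA Z)) p := by
  have := ((YA Z).prodMap (YA Z)).hasFDerivAt (x := p) |>.const_add (U0 Z + t • V0 Z, V0 Z)
  refine this.congr_of_eventuallyEq (Filter.Eventually.of_forall fun y => ?_)
  rfl

lemma fderiv_comp_fst {u : E n → ℝ} (hu : ContDiff ℝ ∞ u) (p w : E n × E n) :
    fderiv ℝ (fun q : E n × E n => u q.1) p w = fderiv ℝ u p.1 w.1 := by
  have h2 := ((hu.differentiable (by norm_num)) p.1).hasFDerivAt.comp p
    (hasFDerivAt_fst (𝕜 := ℝ) (E := E n) (F := E n))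
  have h3 : fderiv ℝ (fun q : E n × E n => u q.1) p = _ := h2.fderiv
  rw [h3]; simp

lemma ZZ_dB (Z : VFIdx n) (t : ℝ) {u : E n → ℝ} {g : E n × E n → ℝ}
    (hu : ContDiff ℝ ∞ u) (hg : ContDiff ℝ ∞ g) (p : E n × E n) :
    ZZ Z t (dB u g) p = dB (GG Z t u) g p + dB u (ZZ Z t g) p - 2 * kap Z * dB u g p := by
  have hui : ∀ i, ContDiff ℝ ∞ (fun x => fderiv ℝ u x (eb i)) :=
    fun i => contDiff_fderiv_field hu contDiff_const
  have hui' : ∀ i, ContDiff ℝ ∞ (fun q : E n × E n => fderiv ℝ u q.1 (eb i)) :=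
    fun i => (hui i).comp contDiff_fst
  have hgi : ∀ i, ContDiff ℝ ∞ (fun q => fderiv ℝ g q (0, eb i)) :=
    fun i => contDiff_fderiv_field hg contDiff_const
  have h1 : ∀ i, fderiv ℝ (fun q : E n × E n => fderiv ℝ u q.1 (eb i)) p (XV Z t p)
      = fderiv ℝ (GG Z t u) p.1 (eb i) - fderiv ℝ u p.1 (YA Z (eb i)) := by
    intro i
    rw [fderiv_comp_fst (hui i)]
    have := comm_fields hu (X := Yv Z t) (Y := fun _ => eb i)
      ((Yv_contDiff Z t).differentiable (by norm_num)) (by fun_prop) p.1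
    simp only [XV]
    rw [this, fderiv_Yv]
    simp [← sub_eq_add_neg]
    rfl
  have h2 : ∀ i, fderiv ℝ (fun q : E n × E n => fderiv ℝ g q (0, eb i)) p (XV Z t p)
      = fderiv ℝ (ZZ Z t g) p (0, eb i) - fderiv ℝ g p (0, YA Z (eb i)) := by
    intro i
    have := comm_fields hg (X := XV Z t) (Y := fun _ => ((0 : E n), eb i))
      ((XV_contDiff Z t).differentiable (by norm_num)) (by fun_prop) p
    rw [this, (hasFDerivAt_XV Z t p).fderiv]
    have e : fderiv ℝ (fun _ : E n × E n => ((0 : E n), eb i)) p (XV Z t p) -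
      ((YA Z).prodMap (YA Z)) (0, eb i) = - (0, YA Z (eb i)) := by simp
    rw [e, map_neg, ← sub_eq_add_neg]; rfl
  have h3 : ZZ Z t (dB u g) p = ∑ i, (fderiv ℝ u p.1 (eb i) *
      fderiv ℝ (fun q : E n × E n => fderiv ℝ g q (0, eb i)) p (XV Z t p)
      + fderiv ℝ g p (0, eb i) *
      fderiv ℝ (fun q : E n × E n => fderiv ℝ u q.1 (eb i)) p (XV Z t p)) := by
    have : HasFDerivAt (dB u g) (∑ i, (fderiv ℝ u p.1 (eb i) •
      fderiv ℝ (fun q : E n × E n => fderiv ℝ g q (0, eb i)) p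
      + fderiv ℝ g p (0, eb i) •
      fderiv ℝ (fun q : E n × E n => fderiv ℝ u q.1 (eb i)) p)) p := by
      unfold dB
      refine HasFDerivAt.fun_sum fun i _ => ?_
      exact HasFDerivAt.mul (((hui' i).differentiable (by norm_num)) p).hasFDerivAt
        (((hgi i).differentiable (by norm_num)) p).hasFDerivAt
    unfold ZZ
    rw [this.fderiv]; simp
  have h4 := YA_skew Z (fderiv ℝ u p.1) ((fderiv ℝ g p).comp (ContinuousLinearMap.inr ℝ (E n) (E n)))
  simp only [ContinuousLinearMap.comp_apply, ContinuousLinearMap.inr_apply] at h4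
  rw [h3]
  unfold dB
  rw [← h4, ← Finset.sum_add_distrib, ← Finset.sum_sub_distrib]
  refine Finset.sum_congr rfl fun i _ => ?_
  rw [h1, h2]; ring

lemma ZZ_listsum {ι : Type*} (Z : VFIdx n) (t : ℝ) (a : ι → ℝ) (F : ι → E n × E n → ℝ)
    (hF : ∀ c, Differentiable ℝ (F c)) (l : List ι) :
    Differentiable ℝ (fun p => (l.map (fun c => a c * F c p)).sum) ∧
    ∀ p, ZZ Z t (fun p => (l.map (fun c => a c * F c p)).sum) p
      = (l.map (fun c => a c * ZZ Z t (F c) p)).sum := by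
  induction l with
  | nil => simp [ZZ]
  | cons c l ih =>
    simp only [List.map_cons, List.sum_cons]
    have hc : Differentiable ℝ (fun p => a c * F c p) := (hF c).const_mul _
    refine ⟨hc.add ih.1, fun p => ?_⟩
    rw [← ih.2 p]
    unfold ZZ
    rw [fderiv_fun_add (hc p) (ih.1 p), fderiv_const_mul (hF c p)]
    simp

lemma list_sum_flatMap3 {ι κ : Type*} (l : List ι) (f1 f2 f3 : ι → κ) (w : κ → ℝ) :
    ((l.flatMap (fun c => [f1 c, f2 c, f3 c])).map w).sum
      = (l.map (fun c => w (f1 c) + w (f2 c) + w (f3 c))).sum := by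
  induction l with
  | nil => simp
  | cons c l ih =>
    simp only [List.flatMap_cons, List.map_append, List.sum_append, ih, List.map_cons,
      List.sum_cons, List.map_nil, List.sum_nil]
    ring

lemma ZL_dB (L : List (VFIdx n)) :
    ∃ cs : List (ℝ × List (VFIdx n) × List (VFIdx n)),
      (∀ c ∈ cs, c.2.1.length + c.2.2.length ≤ L.length ∧ c.2.2.length < L.length) ∧
      ∀ (t : ℝ) (u : E n → ℝ) (g : E n × E n → ℝ), ContDiff ℝ ∞ u → ContDiff ℝ ∞ g → ∀ p,
        ZL L t (dB u g) p = dB u (ZL L t g) p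
          + (cs.map (fun c => c.1 * dB (GM c.2.1 t u) (ZL c.2.2 t g) p)).sum := by
  induction L with
  | nil => exact ⟨[], by simp, by intro t u g _ _ p; simp [ZL]⟩
  | cons Z L ih =>
    obtain ⟨cs, hcs, H⟩ := ih
    refine ⟨(1, [Z], L) :: (-2 * kap Z, [], L) :: cs.flatMap (fun c =>
      [(c.1, Z :: c.2.1, c.2.2), (c.1, c.2.1, Z :: c.2.2), (-2 * kap Z * c.1, c.2.1, c.2.2)]), ?_, ?_⟩
    · intro c hc
      simp only [List.mem_cons, List.mem_flatMap, List.not_mem_nil, or_false] at hc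
      rcases hc with rfl | rfl | ⟨d, hd, rfl | rfl | rfl⟩
      · simp; omega
      · simp
      all_goals
        have := hcs d hd
        simp only [List.length_cons]
        omega
    · intro t u g hu hg p
      have e : ZL L t (dB u g) = fun p => dB u (ZL L t g) p
          + (cs.map (fun c => c.1 * dB (GM c.2.1 t u) (ZL c.2.2 t g) p)).sum := by
        funext p; exact H t u g hu hg p
      have hd : ∀ c : ℝ × List (VFIdx n) × List (VFIdx n),
          Differentiable ℝ (dB (GM c.2.1 t u) (ZL c.2.2 t g)) := fun c =>
        (dB_contDiff (GM_contDiff hu) (ZL_contDiff hg)).differentiable (by norm_num)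
      have hl := ZZ_listsum Z t (fun c : ℝ × List (VFIdx n) × List (VFIdx n) => c.1) _ hd cs
      change ZZ Z t (ZL L t (dB u g)) p = dB u (ZZ Z t (ZL L t g)) p + _
      have e2 : ZZ Z t (ZL L t (dB u g)) p = ZZ Z t (dB u (ZL L t g)) p +
          ZZ Z t (fun p => (cs.map (fun c => c.1 * dB (GM c.2.1 t u) (ZL c.2.2 t g) p)).sum) p := by
        rw [e]; unfold ZZ
        rw [fderiv_fun_add _ (hl.1 p)]
        · rfl
        · exact ((dB_contDiff hu (ZL_contDiff hg)).differentiable (by norm_num)) p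
      rw [e2, hl.2 p, ZZ_dB Z t hu (ZL_contDiff hg)]
      simp only [List.map_cons, List.sum_cons]
      rw [list_sum_flatMap3]
      have e3 : ∀ c : ℝ × List (VFIdx n) × List (VFIdx n),
          c.1 * ZZ Z t (dB (GM c.2.1 t u) (ZL c.2.2 t g)) p =
          c.1 * dB (GM (Z :: c.2.1) t u) (ZL c.2.2 t g) p
          + c.1 * dB (GM c.2.1 t u) (ZL (Z :: c.2.2) t g) p
          + -2 * kap Z * c.1 * dB (GM c.2.1 t u) (ZL c.2.2 t g) p := by
        intro c
        rw [ZZ_dB Z t (GM_contDiff hu) (ZL_contDiff hg)]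
        change _ = c.1 * dB (GG Z t (GM c.2.1 t u)) (ZL c.2.2 t g) p
          + c.1 * dB (GM c.2.1 t u) (ZZ Z t (ZL c.2.2 t g)) p + _
        ring
      simp only [e3]
      change _ = dB u (ZZ Z t (ZL L t g)) p + (1 * dB (GG Z t u) (ZL L t g) p
        + (-2 * kap Z * dB u (ZL L t g) p + _))
      ring


section general
variable {V : Type*} [NormedAddCommGroup V] [NormedSpace ℝ V]

lemma Cc.continuous {g : V → ℝ} (hg : Cc g) : Continuous g := hg.1.continuous

lemma Cc.differentiable {g : V → ℝ} (hg : Cc g) : Differentiable ℝ g :=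
  hg.1.differentiable (by norm_num)

lemma Cc.integrable [MeasurableSpace V] [BorelSpace V] {μ : Measure V}
    [IsFiniteMeasureOnCompacts μ] {g : V → ℝ} (hg : Cc g) : Integrable g μ :=
  hg.1.continuous.integrable_of_hasCompactSupport hg.2

lemma Cc.bdd {g : V → ℝ} (hg : Cc g) : ∃ M, 0 ≤ M ∧ ∀ p, |g p| ≤ M := by
  obtain ⟨C, hC⟩ := hg.2.exists_bound_of_continuous hg.1.continuous
  exact ⟨max C 0, le_max_right _ _, fun p => (hC p).trans (le_max_left _ _)⟩

lemma Cc.bdd_fderiv {g : V → ℝ} (hg : Cc g) : ∃ M, 0 ≤ M ∧ ∀ p, ‖fderiv ℝ g p‖ ≤ M := by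
  obtain ⟨C, hC⟩ := (hg.2.fderiv (𝕜 := ℝ)).exists_bound_of_continuous
    (hg.1.continuous_fderiv (by norm_num))
  exact ⟨max C 0, le_max_right _ _, fun p => (hC p).trans (le_max_left _ _)⟩

lemma Cc.mul_left {g a : V → ℝ} (hg : Cc g) (ha : ContDiff ℝ ∞ a) : Cc (fun p => a p * g p) :=
  ⟨ha.mul hg.1, hg.2.mul_left⟩

lemma Cc.add {g h : V → ℝ} (hg : Cc g) (hh : Cc h) : Cc (fun p => g p + h p) :=
  ⟨hg.1.add hh.1, hg.2.add hh.2⟩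

lemma Cc.dir {g : V → ℝ} (hg : Cc g) (e : V) : Cc (fun p => fderiv ℝ g p e) :=
  hg.field contDiff_const

lemma ibp [FiniteDimensional ℝ V] [MeasurableSpace V] [BorelSpace V] {μ : Measure V}
    [μ.IsAddHaarMeasure] {a b : V → ℝ} (ha : ContDiff ℝ ∞ a) (hb : Cc b) (e : V) :
    ∫ p, a p * fderiv ℝ b p e ∂μ = - ∫ p, fderiv ℝ a p e * b p ∂μ := by
  refine integral_mul_fderiv_eq_neg_fderiv_mul_of_integrable ?_ ?_ ?_ ?_ ?_
  · exact (hb.mul_left (contDiff_fderiv_field ha contDiff_const)).integrable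
  · exact ((hb.dir e).mul_left ha).integrable
  · exact (hb.mul_left ha).integrable
  · exact fun x _ => (ha.differentiable (by norm_num)) x
  · exact fun x _ => hb.differentiable x

end general

lemma Cc.slice {g : E n × E n → ℝ} (hg : Cc g) (x : E n) : Cc (fun v => g (x, v)) := by
  refine ⟨hg.1.comp (by fun_prop), ?_⟩
  have : Topology.IsClosedEmbedding (fun v : E n => (x, v)) := by
    refine Topology.IsClosedEmbedding.of_continuous_injective_isClosedMap (by fun_prop) ?_ ?_
    · intro a b h; simpa using h
    · intro s hs
      have : (fun v : E n => (x, v)) '' s = {x} ×ˢ s := by ext ⟨a, b⟩; simp; tauto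
      rw [this]; exact isClosed_singleton.prod hs
  exact hg.2.comp_isClosedEmbedding this

lemma slice_snd_fderiv {g : E n × E n → ℝ} (hg : ContDiff ℝ ∞ g) (x v w : E n) :
    fderiv ℝ (fun y => g (x, y)) v w = fderiv ℝ g (x, v) (0, w) := by
  have h1 : HasFDerivAt (fun y : E n => (x, y)) (ContinuousLinearMap.inr ℝ (E n) (E n)) v :=
    hasFDerivAt_prodMk_right x v
  have h2 := ((hg.differentiable (by norm_num)) (x, v)).hasFDerivAt.comp v h1
  have h3 : fderiv ℝ (fun y => g (x, y)) v = _ := h2.fderiv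
  rw [h3]; simp

/-- velocity average -/
def rh (g : E n × E n → ℝ) (x : E n) : ℝ := ∫ v, g (x, v)

lemma rh_hasFDerivAt {g : E n × E n → ℝ} (hg : Cc g) (x : E n) :
    HasFDerivAt (rh g) (∫ v, (fderiv ℝ g (x, v)).comp (ContinuousLinearMap.inl ℝ (E n) (E n))) x := by
  obtain ⟨M, hM0, hM⟩ := hg.bdd_fderiv
  set K : Set (E n) := Prod.snd '' (tsupport g) with hK
  have hKc : IsCompact K := hg.2.isCompact.image continuous_snd
  have cont : Continuous fun q : E n × E n =>
      (fderiv ℝ g q).comp (ContinuousLinearMap.inl ℝ (E n) (E n)) :=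
    (hg.1.continuous_fderiv (by norm_num)).clm_comp continuous_const
  refine hasFDerivAt_integral_of_dominated_of_fderiv_le
    (F' := fun x v => (fderiv ℝ g (x, v)).comp (ContinuousLinearMap.inl ℝ (E n) (E n)))
    (bound := K.indicator fun _ => M * ‖ContinuousLinearMap.inl ℝ (E n) (E n)‖)
    (s := Set.univ) Filter.univ_mem ?_ ?_ ?_ ?_ ?_ ?_
  · exact Filter.Eventually.of_forall fun y => (hg.slice y).continuous.aestronglyMeasurable
  · exact (hg.slice x).integrable
  · exact (cont.comp (by fun_prop : Continuous fun v : E n => (x, v))).aestronglyMeasurable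
  · refine Filter.Eventually.of_forall fun v y _ => ?_
    by_cases hv : v ∈ K
    · rw [Set.indicator_of_mem hv]
      refine (ContinuousLinearMap.opNorm_comp_le _ _).trans ?_
      gcongr; exact hM _
    · rw [Set.indicator_of_notMem hv]
      have : fderiv ℝ g (y, v) = 0 := by
        by_contra h
        apply hv
        refine ⟨(y, v), ?_, rfl⟩
        exact support_fderiv_subset ℝ h
      simp [this]
  · rw [integrable_indicator_iff hKc.measurableSet]
    exact integrableOn_const hKc.measure_lt_top.ne
  · refine Filter.Eventually.of_forall fun v y _ => ?_
    exact (hg.differentiable (y, v)).hasFDerivAt.comp y (hasFDerivAt_prodMk_left y v)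

lemma rh_fderiv {g : E n × E n → ℝ} (hg : Cc g) (x w : E n) :
    fderiv ℝ (rh g) x w = rh (fun p => fderiv ℝ g p (w, 0)) x := by
  rw [(rh_hasFDerivAt hg x).fderiv, ContinuousLinearMap.integral_apply]
  · simp [rh]
  · have cont : Continuous fun q : E n × E n =>
      (fderiv ℝ g q).comp (ContinuousLinearMap.inl ℝ (E n) (E n)) :=
      (hg.1.continuous_fderiv (by norm_num)).clm_comp continuous_const
    have cont2 := cont.comp (by fun_prop : Continuous fun v : E n => (x, v))
    refine cont2.integrable_of_hasCompactSupport ?_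
    refine HasCompactSupport.intro (hg.2.isCompact.image continuous_snd) ?_
    intro v hv
    have : fderiv ℝ g (x, v) = 0 := by
      by_contra h
      exact hv ⟨(x, v), support_fderiv_subset ℝ h, rfl⟩
    simp [this]

lemma contDiff_of_fderiv_closed {T : (E n × E n → ℝ) → E n → ℝ}
    (hd : ∀ g, Cc g → Differentiable ℝ (T g))
    (he : ∀ g, Cc g → ∀ w, ∃ g', Cc g' ∧ (fun x => fderiv ℝ (T g) x w) = T g') 
    {g : E n × E n → ℝ} (hg : Cc g) : ContDiff ℝ ∞ (T g) := by
  rw [contDiff_infty]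
  intro m
  induction m generalizing g with
  | zero => exact contDiff_zero.2 (hd g hg).continuous
  | succ m ih =>
    have : ((m + 1 : ℕ) : WithTop ℕ∞) = (m : WithTop ℕ∞) + 1 := by push_cast; rfl
    rw [this, contDiff_succ_iff_fderiv_apply]
    refine ⟨hd g hg, by simp, fun w => ?_⟩
    obtain ⟨g', hg', e⟩ := he g hg w
    rw [e]; exact ih hg'

lemma Cc.rh {g : E n × E n → ℝ} (hg : Cc g) : Cc (rh g) := by
  constructor
  · refine contDiff_of_fderiv_closed (T := _root_.rh)
      (fun g hg x => (rh_hasFDerivAt hg x).differentiableAt) ?_ hg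
    intro g hg w
    exact ⟨_, hg.dir (w, 0), funext fun x => rh_fderiv hg x w⟩
  · refine HasCompactSupport.intro (hg.2.isCompact.image continuous_fst) ?_
    intro x hx
    have : ∀ v, g (x, v) = 0 := by
      intro v
      by_contra h
      exact hx ⟨(x, v), subset_tsupport g h, rfl⟩
    simp [_root_.rh, this]

lemma coord_contDiff (i : Fin n) : ContDiff ℝ ∞ (fun z : E n => z i) := by fun_prop

lemma fderiv_coord (i : Fin n) (z w : E n) : fderiv ℝ (fun z : E n => z i) z w = w i := by
  have : HasFDerivAt (fun z : E n => z i) (EuclideanSpace.proj i : E n →L[ℝ] ℝ) z :=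
    (EuclideanSpace.proj i : E n →L[ℝ] ℝ).hasFDerivAt
  rw [this.fderiv]; simp

lemma ibp_coord {a b : E n → ℝ} (ha : ContDiff ℝ ∞ a) (hb : Cc b) (i : Fin n) (e : E n) :
    ∫ z, a z * z i * fderiv ℝ b z e = - ∫ z, (fderiv ℝ a z e * z i + a z * e i) * b z := by
  rw [ibp (ha.mul (coord_contDiff i)) hb e]
  congr 1
  refine integral_congr_ae (Filter.Eventually.of_forall fun z => ?_)
  simp only
  rw [fderiv_fun_mul ((ha.differentiable (by norm_num)) z)
    (((coord_contDiff i).differentiable (by norm_num)) z)]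
  simp only [ContinuousLinearMap.add_apply, ContinuousLinearMap.smul_apply, smul_eq_mul, fderiv_coord]
  ring

lemma ibp_rot {a b : E n → ℝ} (ha : ContDiff ℝ ∞ a) (hb : Cc b) {i j : Fin n} (hij : i ≠ j)
    (har : ∀ z, fderiv ℝ a z (rotL i j z) = 0) :
    ∫ z, a z * fderiv ℝ b z (rotL i j z) = 0 := by
  have h1 := ibp_coord ha hb i (eb j)
  have h2 := ibp_coord ha hb j (eb i)
  have i1 : ∀ k l : Fin n, Integrable (fun z : E n => a z * z k * fderiv ℝ b z (eb l)) := fun k l =>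
    ((hb.dir _).mul_left (ha.mul (coord_contDiff k))).integrable
  have i2 : ∀ k l : Fin n, Integrable
      (fun z : E n => (fderiv ℝ a z (eb l) * z k + a z * (eb l : E n) k) * b z) := fun k l =>
    (hb.mul_left (((contDiff_fderiv_field ha contDiff_const).mul (coord_contDiff k)).add
      (ha.mul contDiff_const))).integrable
  have e : (fun z => a z * fderiv ℝ b z (rotL i j z)) =
      fun z => a z * z i * fderiv ℝ b z (eb j) - a z * z j * fderiv ℝ b z (eb i) := by
    funext z; rw [rotL_apply]; simp; ring
  rw [e, integral_sub (i1 i j) (i1 j i), h1, h2, neg_sub_neg, ← integral_sub (i2 _ _) (i2 _ _)]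
  rw [← integral_zero (E n) ℝ (μ := volume)]
  refine integral_congr_ae (Filter.Eventually.of_forall fun z => ?_)
  have := har z
  rw [rotL_apply] at this
  simp only [map_sub, map_smul, smul_eq_mul] at this
  have e1 : (eb i : E n) j = 0 := by simp [eb, hij.symm]
  have e2 : (eb j : E n) i = 0 := by simp [eb, hij]
  simp only [e1, e2]
  linear_combination (-(b z)) * this

lemma int_YA (Z : VFIdx n) {b : E n → ℝ} (hb : Cc b) :
    ∫ z, fderiv ℝ b z (YA Z z) = - (n * kap Z) * ∫ z, b z := by
  rcases Z with i | i | p | u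
  · simp [YA, kap]
  · simp [YA, kap]
  · have := ibp_rot (a := fun _ => (1 : ℝ)) contDiff_const hb (i := p.1.1) (j := p.1.2)
      (ne_of_lt p.2) (by simp)
    simpa [YA, kap] using this
  · have e : ∀ z : E n, fderiv ℝ b z z = ∑ i, (1 : ℝ) * z i * fderiv ℝ b z (eb i) := by
      intro z
      conv_lhs => rw [sum_eb z]
      rw [map_sum, ← sum_eb z]
      simp
    simp only [YA, kap, ContinuousLinearMap.id_apply, e]
    rw [integral_finsetSum]
    · have : ∀ i : Fin n, ∫ z : E n, (1 : ℝ) * z i * fderiv ℝ b z (eb i) = - ∫ z, b z := by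
        intro i
        rw [ibp_coord (a := fun _ => (1 : ℝ)) contDiff_const hb i (eb i)]
        simp [eb]
      simp only [this]
      simp
    · intro i _
      exact ((hb.dir _).mul_left (contDiff_const.mul (coord_contDiff i))).integrable

lemma GG_rh (Z : VFIdx n) (t : ℝ) {g : E n × E n → ℝ} (hg : Cc g) (x : E n) :
    GG Z t (rh g) x = rh (ZZ Z t g) x + n * kap Z * rh g x := by
  unfold GG
  rw [rh_fderiv hg]
  have e : ∀ v, ZZ Z t g (x, v) = fderiv ℝ g (x, v) (Yv Z t x, 0) +
      fderiv ℝ (fun y => g (x, y)) v (V0 Z) + fderiv ℝ (fun y => g (x, y)) v (YA Z v) := by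
    intro v
    rw [slice_snd_fderiv hg.1, slice_snd_fderiv hg.1, ← map_add, ← map_add]
    simp [ZZ, XV]
  have hs := hg.slice x
  unfold rh
  simp only [e]
  have i1 : Integrable (fun v => fderiv ℝ g (x, v) (Yv Z t x, 0)) :=
    ((hg.dir (Yv Z t x, 0)).slice x).integrable
  have i2 : Integrable (fun v => fderiv ℝ (fun y => g (x, y)) v (V0 Z)) := (hs.dir _).integrable
  have i3 : Integrable (fun v => fderiv ℝ (fun y => g (x, y)) v (YA Z v)) :=
    (hs.field (YA Z).contDiff).integrable
  have z2 : ∫ v, fderiv ℝ (fun y => g (x, y)) v (V0 Z) = 0 := by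
    have := ibp (μ := volume) (a := fun _ => (1 : ℝ)) contDiff_const hs (V0 Z)
    simpa using this
  have i12 : Integrable (fun v => fderiv ℝ g (x, v) (Yv Z t x, 0) +
      fderiv ℝ (fun y => g (x, y)) v (V0 Z)) := i1.add i2
  rw [integral_add i12 i3, integral_add i1 i2, int_YA Z hs, z2]
  ring


/-- the measure on the parameter space of the averages -/
def mm (n : ℕ) : Measure (ℝ × E n) := (volume.restrict (Set.Ioi (0 : ℝ))).prod volume

instance : SFinite (mm n) := by unfold mm; infer_instance

/-- weighted averages -/
def Aw (w : ℝ × E n → ℝ) (ρ : E n → ℝ) (x : E n) : ℝ := ∫ q, w q * ρ (x - q.1 • q.2) ∂(mm n)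

lemma Aw_arg_cont (x : E n) : Continuous (fun q : ℝ × E n => x - q.1 • q.2) := by fun_prop

lemma Aw_int {w : ℝ × E n → ℝ} (hw : Integrable w (mm n)) {h : E n → ℝ} (hc : Continuous h)
    {M : ℝ} (hM : ∀ p, |h p| ≤ M) (x : E n) :
    Integrable (fun q : ℝ × E n => w q * h (x - q.1 • q.2)) (mm n) := by
  have := hw.bdd_mul (f := fun q : ℝ × E n => h (x - q.1 • q.2)) (c := M)
    (hc.comp (Aw_arg_cont x)).aestronglyMeasurable (Filter.Eventually.of_forall fun q => hM _)
  simpa only [mul_comm] using this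

lemma Aw_hasFDerivAt {w : ℝ × E n → ℝ} (hw : Integrable w (mm n)) {ρ : E n → ℝ} (hρ : Cc ρ)
    (x : E n) : HasFDerivAt (Aw w ρ) (∫ q, w q • fderiv ℝ ρ (x - q.1 • q.2) ∂(mm n)) x := by
  obtain ⟨M, hM0, hM⟩ := hρ.bdd_fderiv
  obtain ⟨M', _, hM'⟩ := hρ.bdd
  have cont : Continuous (fderiv ℝ ρ) := hρ.1.continuous_fderiv (by norm_num)
  refine hasFDerivAt_integral_of_dominated_of_fderiv_le
    (F' := fun x q => w q • fderiv ℝ ρ (x - q.1 • q.2))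
    (bound := fun q => ‖w q‖ * M)
    (s := Set.univ) Filter.univ_mem ?_ ?_ ?_ ?_ ?_ ?_
  · exact Filter.Eventually.of_forall fun y => (Aw_int hw hρ.continuous hM' y).1
  · exact Aw_int hw hρ.continuous hM' x
  · exact hw.1.smul (cont.comp (Aw_arg_cont x)).aestronglyMeasurable
  · refine Filter.Eventually.of_forall fun v y _ => ?_
    rw [norm_smul]
    gcongr; exact hM _
  · exact hw.norm.mul_const M
  · refine Filter.Eventually.of_forall fun q y _ => ?_
    have h1 : HasFDerivAt (fun y : E n => y - q.1 • q.2) (ContinuousLinearMap.id ℝ (E n)) y :=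
      (hasFDerivAt_id y).sub_const _
    have := (hρ.differentiable (y - q.1 • q.2)).hasFDerivAt.comp y h1
    simpa using this.const_mul (w q)

lemma Aw_fderiv {w : ℝ × E n → ℝ} (hw : Integrable w (mm n)) {ρ : E n → ℝ} (hρ : Cc ρ)
    (x e : E n) : fderiv ℝ (Aw w ρ) x e = Aw w (fun y => fderiv ℝ ρ y e) x := by
  rw [(Aw_hasFDerivAt hw hρ x).fderiv, ContinuousLinearMap.integral_apply]
  · simp [Aw]
  · obtain ⟨M, hM0, hM⟩ := hρ.bdd_fderiv
    have cont : Continuous (fderiv ℝ ρ) := hρ.1.continuous_fderiv (by norm_num)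
    refine Integrable.mono' (hw.norm.mul_const M)
      (hw.1.smul (cont.comp (Aw_arg_cont x)).aestronglyMeasurable) ?_
    refine Filter.Eventually.of_forall fun v => ?_
    rw [norm_smul]
    gcongr; exact hM _

lemma Aw_contDiff {w : ℝ × E n → ℝ} (hw : Integrable w (mm n)) {ρ : E n → ℝ} (hρ : Cc ρ) :
    ContDiff ℝ ∞ (Aw w ρ) := by
  rw [contDiff_infty]
  intro m
  induction m generalizing ρ with
  | zero =>
    have hd : Differentiable ℝ (Aw w ρ) := fun x => (Aw_hasFDerivAt hw hρ x).differentiableAt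
    exact contDiff_zero.2 hd.continuous
  | succ m ih =>
    have : ((m + 1 : ℕ) : WithTop ℕ∞) = (m : WithTop ℕ∞) + 1 := by push_cast; rfl
    rw [this, contDiff_succ_iff_fderiv_apply]
    refine ⟨fun x => (Aw_hasFDerivAt hw hρ x).differentiableAt, by simp, fun e => ?_⟩
    have : (fun x => fderiv ℝ (Aw w ρ) x e) = Aw w (fun y => fderiv ℝ ρ y e) :=
      funext fun x => Aw_fderiv hw hρ x e
    rw [this]; exact ih (hρ.dir e)

lemma Aw_sup {w : ℝ × E n → ℝ} (hw : Integrable w (mm n)) {ρ : E n → ℝ} 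
    {M : ℝ} (hM : ∀ p, |ρ p| ≤ M) (x : E n) : |Aw w ρ x| ≤ (∫ q, |w q| ∂(mm n)) * M := by
  unfold Aw
  rw [← integral_mul_const, ← Real.norm_eq_abs]
  refine norm_integral_le_of_norm_le (hw.norm.mul_const M) (Filter.Eventually.of_forall fun q => ?_)
  rw [norm_mul]
  exact mul_le_mul_of_nonneg_left (hM _) (norm_nonneg _)

lemma Aw_joint {w : ℝ × E n → ℝ} (hw : Integrable w (mm n)) {ρ : E n → ℝ} (hρ : Cc ρ) :
    Integrable (fun z : E n × (ℝ × E n) => w z.2 * ρ (z.1 - z.2.1 • z.2.2))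
      (volume.prod (mm n)) := by
  have meas : AEStronglyMeasurable (fun z : E n × (ℝ × E n) => w z.2 * ρ (z.1 - z.2.1 • z.2.2))
      ((volume : Measure (E n)).prod (mm n)) := by
    refine AEStronglyMeasurable.mul hw.1.comp_snd ?_
    have : Continuous fun z : E n × (ℝ × E n) => ρ (z.1 - z.2.1 • z.2.2) :=
      hρ.continuous.comp (by fun_prop)
    exact this.aestronglyMeasurable
  rw [integrable_prod_iff' meas]
  constructor
  · refine Filter.Eventually.of_forall fun q => ?_
    exact ((hρ.integrable (μ := volume)).comp_sub_right (q.1 • q.2)).const_mul (w q)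
  · have : (fun q : ℝ × E n => ∫ x, ‖w q * ρ (x - q.1 • q.2)‖) =
      fun q => ‖w q‖ * ∫ x, ‖ρ x‖ := by
      funext q
      simp only [norm_mul]
      rw [integral_const_mul, integral_sub_right_eq_self (fun x => ‖ρ x‖)]
    simp only [this]
    exact hw.norm.mul_const _

lemma Aw_integrable {w : ℝ × E n → ℝ} (hw : Integrable w (mm n)) {ρ : E n → ℝ} (hρ : Cc ρ) :
    Integrable (Aw w ρ) := (Aw_joint hw hρ).integral_prod_left

lemma Aw_L1 {w : ℝ × E n → ℝ} (hw : Integrable w (mm n)) {ρ : E n → ℝ} (hρ : Cc ρ) :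
    ∫ x, |Aw w ρ x| ≤ (∫ q, |w q| ∂(mm n)) * ∫ x, |ρ x| := by
  have hj := (Aw_joint hw hρ).norm
  calc ∫ x, |Aw w ρ x| ≤ ∫ x, ∫ q, ‖w q * ρ (x - q.1 • q.2)‖ ∂(mm n) := by
        refine integral_mono (Aw_integrable hw hρ).norm hj.integral_prod_left fun x => ?_
        exact norm_integral_le_integral_norm (fun q : ℝ × E n => w q * ρ (x - q.1 • q.2))
    _ = ∫ q, (∫ x, ‖w q * ρ (x - q.1 • q.2)‖) ∂(mm n) := integral_integral_swap hj
    _ = ∫ q, ‖w q‖ * (∫ x, ‖ρ x‖) ∂(mm n) := by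
        refine integral_congr_ae (Filter.Eventually.of_forall fun q => ?_)
        simp only [norm_mul]
        rw [integral_const_mul, integral_sub_right_eq_self (fun x => ‖ρ x‖)]
    _ = _ := by rw [integral_mul_const]; rfl

lemma Aw_add {w : ℝ × E n → ℝ} (hw : Integrable w (mm n)) {ρ σ : E n → ℝ} (hρ : Cc ρ) (hσ : Cc σ)
    (x : E n) : Aw w (fun y => ρ y + σ y) x = Aw w ρ x + Aw w σ x := by
  obtain ⟨M, _, hM⟩ := hρ.bdd
  obtain ⟨M', _, hM'⟩ := hσ.bdd
  unfold Aw
  rw [← integral_add (Aw_int hw hρ.continuous hM x) (Aw_int hw hσ.continuous hM' x)]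
  simp only [mul_add]

lemma Aw_smul {w : ℝ × E n → ℝ} {ρ : E n → ℝ} (c : ℝ)
    (x : E n) : Aw w (fun y => c * ρ y) x = c * Aw w ρ x := by
  unfold Aw
  rw [← integral_const_mul]
  congr 1; funext q; ring

/-- Gaussian -/
def gs (z : E n) : ℝ := rexp (-(‖z‖ ^ 2 / 4))

lemma gs_contDiff : ContDiff ℝ ∞ (gs : E n → ℝ) := by
  unfold gs
  exact ((contDiff_norm_sq ℝ).div_const 4).neg.exp

lemma gs_fderiv (z w : E n) : fderiv ℝ gs z w = - (inner ℝ z w / 2) * gs z := by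
  have h : HasFDerivAt (fun z : E n => ‖z‖ ^ 2) (2 • (innerSL ℝ z)) z := by
    have := (hasFDerivAt_id (𝕜 := ℝ) z).norm_sq
    simpa using this
  have h2 : HasFDerivAt (gs : E n → ℝ) _ z := ((h.mul_const (1/4)).neg.exp).congr_of_eventuallyEq
    (Filter.Eventually.of_forall fun y => by simp [gs, div_eq_mul_inv])
  rw [h2.fderiv]
  simp [gs]
  ring_nf

lemma gs_integrable : Integrable (gs : E n → ℝ) := by
  have := (GaussianFourier.integrable_cexp_neg_mul_sq_norm_add (b := (1/4 : ℂ)) (V := E n)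
    (by norm_num) 0 0).norm
  refine this.congr (Filter.Eventually.of_forall fun z => ?_)
  simp only [gs, Complex.norm_exp]
  congr 1
  norm_cast
  simp
  norm_cast
  ring

lemma gs8_integrable : Integrable (fun z : E n => rexp (-(‖z‖ ^ 2 / 8))) := by
  have := (GaussianFourier.integrable_cexp_neg_mul_sq_norm_add (b := (1/8 : ℂ)) (V := E n)
    (by norm_num) 0 0).norm
  refine this.congr (Filter.Eventually.of_forall fun z => ?_)
  simp only [Complex.norm_exp]
  congr 1
  norm_cast
  simp
  norm_cast
  ring

lemma gsz_integrable (i : Fin n) : Integrable (fun z : E n => z i / 2 * gs z) := by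
  refine Integrable.mono' gs8_integrable
    (Continuous.aestronglyMeasurable ((by fun_prop : Continuous fun z : E n => z i / 2).mul
      gs_contDiff.continuous)) (Filter.Eventually.of_forall fun z => ?_)
  have h1 : |z i| ≤ ‖z‖ := EuclideanSpace.norm_eq z ▸ by
    rw [← Real.sqrt_sq_eq_abs]
    apply Real.sqrt_le_sqrt
    have := Finset.single_le_sum (f := fun i => ‖z i‖ ^ 2) (fun i _ => by positivity)
      (Finset.mem_univ i)
    simpa using this
  have e : gs z = rexp (-(‖z‖ ^ 2 / 8)) * rexp (-(‖z‖ ^ 2 / 8)) := by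
    rw [← Real.exp_add, gs]; congr 1; ring
  have h2 : 1 + ‖z‖ ^ 2 / 8 ≤ rexp (‖z‖ ^ 2 / 8) := by
    have := Real.add_one_le_exp (‖z‖ ^ 2 / 8); linarith
  have h3 : ‖z‖ / 2 ≤ rexp (‖z‖ ^ 2 / 8) := by nlinarith [sq_nonneg (‖z‖ - 2)]
  have h4 : ‖z‖ / 2 * rexp (-(‖z‖ ^ 2 / 8)) ≤ 1 := by
    calc _ ≤ rexp (‖z‖ ^ 2 / 8) * rexp (-(‖z‖ ^ 2 / 8)) := by gcongr
      _ = 1 := by rw [← Real.exp_add]; simp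
  rw [e, Real.norm_eq_abs, abs_mul, abs_of_pos (a := rexp _ * _) (by positivity), abs_div, abs_two]
  calc |z i| / 2 * (rexp (-(‖z‖ ^ 2 / 8)) * rexp (-(‖z‖ ^ 2 / 8)))
      ≤ ‖z‖ / 2 * (rexp (-(‖z‖ ^ 2 / 8)) * rexp (-(‖z‖ ^ 2 / 8))) := by gcongr
    _ = (‖z‖ / 2 * rexp (-(‖z‖ ^ 2 / 8))) * rexp (-(‖z‖ ^ 2 / 8)) := by ring
    _ ≤ 1 * rexp (-(‖z‖ ^ 2 / 8)) := by gcongr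
    _ = _ := one_mul _

lemma rw_integrable (m : ℕ) : Integrable (fun r : ℝ => r ^ m * rexp (-r ^ 2)) := by
  have := integrable_rpow_mul_exp_neg_mul_sq (b := 1) one_pos (s := (m : ℝ))
    (by have : (0 : ℝ) ≤ m := by positivity
        linarith)
  simpa using this

/-- the weights -/
def wk (k : ℕ) (q : ℝ × E n) : ℝ := q.1 ^ (2 * k + 1) * rexp (-q.1 ^ 2) * gs q.2

def wg (k : ℕ) (i : Fin n) (q : ℝ × E n) : ℝ :=
  q.1 ^ (2 * k) * rexp (-q.1 ^ 2) * (q.2 i / 2 * gs q.2)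

lemma wk_integrable (k : ℕ) : Integrable (wk k : ℝ × E n → ℝ) (mm n) :=
  Integrable.mul_prod (rw_integrable (2 * k + 1)).integrableOn gs_integrable

lemma wg_integrable (k : ℕ) (i : Fin n) : Integrable (wg k i : ℝ × E n → ℝ) (mm n) :=
  Integrable.mul_prod (rw_integrable (2 * k)).integrableOn (gsz_integrable i)


lemma Cc.affine {ρ : E n → ℝ} (hρ : Cc ρ) (x : E n) {r : ℝ} (hr : 0 < r) :
    Cc (fun z => ρ (x - r • z)) := by
  refine ⟨hρ.1.comp (by fun_prop), ?_⟩
  have : (fun z => ρ (x - r • z)) = ρ ∘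
      ((Homeomorph.smulOfNeZero (-r) (neg_ne_zero.2 hr.ne')).trans (Homeomorph.addLeft x)) := by
    funext z; simp [sub_eq_add_neg]
  rw [this]
  exact hρ.2.comp_isClosedEmbedding (Homeomorph.isClosedEmbedding _)

lemma fderiv_affine {ρ : E n → ℝ} (hρ : Cc ρ) (x : E n) (r : ℝ) (z w : E n) :
    fderiv ℝ (fun z => ρ (x - r • z)) z w = - r * fderiv ℝ ρ (x - r • z) w := by
  have h1 : HasFDerivAt (fun z : E n => x - r • z) (-(r • ContinuousLinearMap.id ℝ (E n))) z :=
    ((hasFDerivAt_id z).const_smul r).const_sub x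
  have h2 := (hρ.differentiable (x - r • z)).hasFDerivAt.comp z h1
  have h3 : fderiv ℝ (fun z => ρ (x - r • z)) z = _ := h2.fderiv
  rw [h3]; simp

/-- gradient without loss -/
lemma Aw_wk_fderiv (k : ℕ) {ρ : E n → ℝ} (hρ : Cc ρ) (x : E n) (i : Fin n) :
    fderiv ℝ (Aw (wk k) ρ) x (eb i) = - Aw (wg k i) ρ x := by
  rw [Aw_fderiv (wk_integrable k) hρ]
  obtain ⟨M, _, hM⟩ := hρ.bdd
  obtain ⟨M', _, hM'⟩ := (hρ.dir (eb i)).bdd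
  have i1 := Aw_int (wk_integrable k) (hρ.dir (eb i)).continuous hM' x
  have i2 := Aw_int (wg_integrable k i) hρ.continuous hM x
  unfold Aw
  rw [← integral_neg]
  unfold mm at *
  have i2' : Integrable (fun q : ℝ × E n => -(wg k i q * ρ (x - q.1 • q.2)))
    ((volume.restrict (Set.Ioi (0 : ℝ))).prod volume) := i2.neg
  rw [integral_prod _ i1, integral_prod _ i2']
  refine setIntegral_congr_fun (measurableSet_Ioi (a := (0 : ℝ))) fun r hr => ?_
  have hr' : 0 < r := hr
  have := ibp (μ := volume) (a := gs) gs_contDiff (hρ.affine x hr') (eb i)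
  simp only [fderiv_affine hρ, gs_fderiv] at this
  have e1 : ∀ z : E n, inner ℝ z (eb i) = z i := fun z => by
    simp [eb, EuclideanSpace.inner_single_right]
  simp only [e1] at this
  have e2 : ∀ z : E n, wk k (r, z) * fderiv ℝ ρ (x - r • z) (eb i) =
      (-(r ^ (2 * k) * rexp (-r ^ 2))) * (gs z * (-r * fderiv ℝ ρ (x - r • z) (eb i))) := by
    intro z; simp only [wk]; ring
  have e3 : ∀ z : E n, - (wg k i (r, z) * ρ (x - r • z)) =
      (r ^ (2 * k) * rexp (-r ^ 2)) * (-(z i / 2) * gs z * ρ (x - r • z)) := by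
    intro z; simp only [wg]; ring
  simp only [e2, e3, integral_const_mul, this]
  ring

lemma scal_inner (k : ℕ) {ρ : E n → ℝ} (hρ : Cc ρ) (x z : E n) :
    ∫ r in Set.Ioi (0 : ℝ), (((2 * k + 2) * (r ^ (2 * k + 1) * rexp (-r ^ 2)) -
      2 * (r ^ (2 * (k + 1) + 1) * rexp (-r ^ 2))) * ρ (x - r • z) -
      r ^ (2 * k + 1) * rexp (-r ^ 2) * fderiv ℝ ρ (x - r • z) (r • z)) = 0 := by
  obtain ⟨M, _, hM⟩ := hρ.bdd
  obtain ⟨M', _, hM'⟩ := (hρ.dir z).bdd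
  have ca : Continuous (fun r : ℝ => x - r • z) := by fun_prop
  have I1 : ∀ m : ℕ, Integrable (fun r : ℝ => ρ (x - r • z) * (r ^ m * rexp (-r ^ 2))) := fun m =>
    (rw_integrable m).bdd_mul (c := M) (hρ.continuous.comp ca).aestronglyMeasurable
      (Filter.Eventually.of_forall fun r => hM _)
  have I2 : ∀ m : ℕ, Integrable
      (fun r : ℝ => fderiv ℝ ρ (x - r • z) z * (r ^ m * rexp (-r ^ 2))) := fun m =>
    (rw_integrable m).bdd_mul (c := M') ((hρ.dir z).continuous.comp ca).aestronglyMeasurable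
      (Filter.Eventually.of_forall fun r => hM' _)
  set F : ℝ → ℝ := fun r => ρ (x - r • z) * (r ^ (2 * k + 2) * rexp (-r ^ 2)) with hF
  set F' : ℝ → ℝ := fun r => (((2 * k + 2) * (r ^ (2 * k + 1) * rexp (-r ^ 2)) -
      2 * (r ^ (2 * (k + 1) + 1) * rexp (-r ^ 2))) * ρ (x - r • z) -
      r ^ (2 * k + 1) * rexp (-r ^ 2) * fderiv ℝ ρ (x - r • z) (r • z)) with hF'
  have hintg : Integrable F' := by
    have := (((I1 (2 * k + 1)).const_mul (2 * (k : ℝ) + 2)).sub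
      ((I1 (2 * (k + 1) + 1)).const_mul 2)).sub (I2 (2 * k + 2))
    refine this.congr (Filter.Eventually.of_forall fun r => ?_)
    simp only [hF', Pi.sub_apply, map_smul, smul_eq_mul]
    ring
  have hder : ∀ r, HasDerivAt F (F' r) r := by
    intro r
    have d1 : HasDerivAt (fun r : ℝ => x - r • z) (-z) r := by
      have := ((hasDerivAt_id r).smul_const z).const_sub x
      simpa using this
    have d2 : HasDerivAt (fun r : ℝ => ρ (x - r • z)) (fderiv ℝ ρ (x - r • z) (-z)) r :=
      (hρ.differentiable (x - r • z)).hasFDerivAt.comp_hasDerivAt r d1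
    have d3 : HasDerivAt (fun r : ℝ => r ^ (2 * k + 2) * rexp (-r ^ 2)) _ r :=
      (hasDerivAt_pow (2 * k + 2) r).mul ((hasDerivAt_pow 2 r).neg.exp)
    refine HasDerivAt.congr_deriv (d2.mul d3) ?_
    have e0 : F' r = (((2 * k + 2) * (r ^ (2 * k + 1) * rexp (-r ^ 2)) -
      2 * (r ^ (2 * (k + 1) + 1) * rexp (-r ^ 2))) * ρ (x - r • z) -
      r ^ (2 * k + 1) * rexp (-r ^ 2) * (r * fderiv ℝ ρ (x - r • z) z)) := by simp [hF']
    rw [e0, map_neg]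
    rw [show 2 * (k + 1) + 1 = 2 * k + 3 by ring, show 2 * k + 2 - 1 = 2 * k + 1 by omega]
    simp only [Pi.neg_apply, pow_one, show 2 - 1 = 1 by norm_num]
    push_cast
    ring
  have h0 := tendsto_zero_of_hasDerivAt_of_integrableOn_Ioi (a := 0) (fun r _ => hder r)
    hintg.integrableOn (I1 (2 * k + 2)).integrableOn
  rw [integral_Ioi_of_hasDerivAt_of_tendsto' (fun r _ => hder r) hintg.integrableOn h0]
  simp [hF]

lemma wk_YA (k : ℕ) (Z : VFIdx n) {ρ : E n → ℝ} (hρ : Cc ρ) (x : E n)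
    (hi : Integrable (fun q : ℝ × E n => wk k q * fderiv ℝ ρ (x - q.1 • q.2) (q.1 • YA Z q.2)) (mm n)) :
    ∫ q, wk k q * fderiv ℝ ρ (x - q.1 • q.2) (q.1 • YA Z q.2) ∂(mm n) =
      kap Z * ((2 * k + 2) * Aw (wk k) ρ x - 2 * Aw (wk (k + 1)) ρ x) := by
  rcases Z with i | i | p | u
  · simp [YA, kap]
  · simp [YA, kap]
  · simp only [YA, kap, zero_mul] at hi ⊢
    unfold mm at *
    rw [integral_prod _ hi]
    refine setIntegral_eq_zero_of_forall_eq_zero fun r hr => ?_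
    have hr' : 0 < r := hr
    have := ibp_rot (a := gs) gs_contDiff (hρ.affine x hr') (i := p.1.1) (j := p.1.2)
      (ne_of_lt p.2) (by
        intro z
        rw [gs_fderiv, rotL_apply]
        simp [eb, EuclideanSpace.inner_single_right, inner_sub_right, inner_smul_right]
        left; ring)
    simp only [fderiv_affine hρ] at this
    have e2 : ∀ z : E n, wk k (r, z) * fderiv ℝ ρ (x - r • z) (r • (rotL p.1.1 p.1.2) z) =
      (-(r ^ (2 * k + 1) * rexp (-r ^ 2))) *
        (gs z * (-r * fderiv ℝ ρ (x - r • z) (rotL p.1.1 p.1.2 z))) := by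
      intro z; simp only [wk, map_smul, smul_eq_mul]; ring
    simp only [e2, integral_const_mul, this, mul_zero]
  · simp only [YA, kap, one_mul, ContinuousLinearMap.id_apply] at hi ⊢
    obtain ⟨M, _, hM⟩ := hρ.bdd
    have i1 := Aw_int (wk_integrable k) hρ.continuous hM x
    have i2 := Aw_int (wk_integrable (k + 1)) hρ.continuous hM x
    unfold Aw
    rw [← integral_const_mul, ← integral_const_mul, ← integral_sub (i1.const_mul _) (i2.const_mul _)]
    symm
    have i12 : Integrable (fun q : ℝ × E n => (2 * (k : ℝ) + 2) * (wk k q * ρ (x - q.1 • q.2)) -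
        2 * (wk (k + 1) q * ρ (x - q.1 • q.2))) (mm n) := (i1.const_mul _).sub (i2.const_mul _)
    rw [← sub_eq_zero, ← integral_sub i12 hi]
    have i3 : Integrable (fun q : ℝ × E n => (2 * (k : ℝ) + 2) * (wk k q * ρ (x - q.1 • q.2)) -
        2 * (wk (k + 1) q * ρ (x - q.1 • q.2)) -
        wk k q * fderiv ℝ ρ (x - q.1 • q.2) (q.1 • q.2)) (mm n) := i12.sub hi
    unfold mm at *
    rw [integral_prod_symm _ i3]
    refine integral_eq_zero_of_ae (Filter.Eventually.of_forall fun z => ?_)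
    have := scal_inner k hρ x z
    have e : ∀ r : ℝ, (2 * (k : ℝ) + 2) * (wk k (r, z) * ρ (x - r • z)) -
        2 * (wk (k + 1) (r, z) * ρ (x - r • z)) - wk k (r, z) * fderiv ℝ ρ (x - r • z) (r • z) =
        gs z * ((((2 * k + 2) * (r ^ (2 * k + 1) * rexp (-r ^ 2)) -
      2 * (r ^ (2 * (k + 1) + 1) * rexp (-r ^ 2))) * ρ (x - r • z) -
      r ^ (2 * k + 1) * rexp (-r ^ 2) * fderiv ℝ ρ (x - r • z) (r • z))) := by
      intro r; simp only [wk]; ring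
    simp only [e, integral_const_mul, this, mul_zero, Pi.zero_apply]

lemma GG_Aw (k : ℕ) (Z : VFIdx n) (t : ℝ) {ρ : E n → ℝ} (hρ : Cc ρ) (x : E n) :
    GG Z t (Aw (wk k) ρ) x = Aw (wk k) (GG Z t ρ) x +
      kap Z * ((2 * k + 2) * Aw (wk k) ρ x - 2 * Aw (wk (k + 1)) ρ x) := by
  obtain ⟨M, _, hM⟩ := (hρ.dir (Yv Z t x)).bdd
  obtain ⟨M', _, hM'⟩ := (Cc.GG (Z := Z) (t := t) hρ).bdd
  have i1 := Aw_int (wk_integrable k) (hρ.dir (Yv Z t x)).continuous hM x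
  have i2 := Aw_int (wk_integrable k) (Cc.GG (Z := Z) (t := t) hρ).continuous hM' x
  have e : ∀ q : ℝ × E n, wk k q * fderiv ℝ ρ (x - q.1 • q.2) (q.1 • YA Z q.2) =
      wk k q * fderiv ℝ ρ (x - q.1 • q.2) (Yv Z t x) - wk k q * GG Z t ρ (x - q.1 • q.2) := by
    intro q
    rw [← mul_sub, GG, ← map_sub]
    congr 2
    simp [Yv]
  have i3 : Integrable (fun q : ℝ × E n => wk k q *
      fderiv ℝ ρ (x - q.1 • q.2) (q.1 • YA Z q.2)) (mm n) := by
    simp only [e]; exact i1.sub i2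
  rw [← wk_YA k Z hρ x i3]
  simp only [e]
  rw [integral_sub i1 i2, GG, Aw_fderiv (wk_integrable k) hρ]
  simp only [Aw]
  ring


lemma fderiv_listsum {ι : Type*} (a : ι → ℝ) (F : ι → E n → ℝ)
    (hF : ∀ c, Differentiable ℝ (F c)) (l : List ι) :
    Differentiable ℝ (fun p => (l.map (fun c => a c * F c p)).sum) ∧
    ∀ p w, fderiv ℝ (fun p => (l.map (fun c => a c * F c p)).sum) p w
      = (l.map (fun c => a c * fderiv ℝ (F c) p w)).sum := by
  induction l with
  | nil => simp
  | cons c l ih =>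
    simp only [List.map_cons, List.sum_cons]
    have hc : Differentiable ℝ (fun p => a c * F c p) := (hF c).const_mul _
    refine ⟨hc.add ih.1, fun p w => ?_⟩
    rw [← ih.2 p w]
    rw [fderiv_fun_add (hc p) (ih.1 p), fderiv_const_mul (hF c p)]
    simp

/-- the potential -/
def pot (c0 : ℝ) (g : E n × E n → ℝ) (x : E n) : ℝ := c0 * Aw (wk 0) (rh g) x

lemma pot_contDiff (c0 : ℝ) {g : E n × E n → ℝ} (hg : Cc g) : ContDiff ℝ ∞ (pot c0 g) :=
  contDiff_const.mul (Aw_contDiff (wk_integrable 0) hg.rh)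

lemma GM_pot (c0 : ℝ) (γ : List (VFIdx n)) :
    ∃ cs : List (ℝ × ℕ × List (VFIdx n)),
      (∀ c ∈ cs, c.2.2.length ≤ γ.length) ∧
      ∀ (t : ℝ) (g : E n × E n → ℝ), Cc g → ∀ x,
        GM γ t (pot c0 g) x =
          (cs.map (fun c => c.1 * Aw (wk c.2.1) (rh (ZL c.2.2 t g)) x)).sum := by
  induction γ with
  | nil => exact ⟨[(c0, 0, [])], by simp, by intro t g _ p; simp [ZL, GM, pot]⟩
  | cons Z γ ih =>
    obtain ⟨cs, hcs, H⟩ := ih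
    refine ⟨cs.flatMap (fun c => [(c.1, c.2.1, Z :: c.2.2),
      (c.1 * (kap Z * (n + 2 * c.2.1 + 2)), c.2.1, c.2.2),
      (-2 * kap Z * c.1, c.2.1 + 1, c.2.2)]), ?_, ?_⟩
    · intro c hc
      simp only [List.mem_cons, List.mem_flatMap, List.not_mem_nil, or_false] at hc
      rcases hc with ⟨d, hd, rfl | rfl | rfl⟩
      all_goals
        have := hcs d hd
        simp only [List.length_cons]
        omega
    · intro t g hg x
      have e : GM γ t (pot c0 g) = fun x =>
          (cs.map (fun c => c.1 * Aw (wk c.2.1) (rh (ZL c.2.2 t g)) x)).sum := by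
        funext p; exact H t g hg p
      have hd : ∀ c : ℝ × ℕ × List (VFIdx n),
          Differentiable ℝ (Aw (wk c.2.1) (rh (ZL c.2.2 t g))) := fun c =>
        (Aw_contDiff (wk_integrable _) hg.ZL.rh).differentiable (by norm_num)
      have hl := fderiv_listsum (fun c : ℝ × ℕ × List (VFIdx n) => c.1) _ hd cs
      change GG Z t (GM γ t (pot c0 g)) x = _
      rw [e]; unfold GG; rw [hl.2]
      rw [list_sum_flatMap3]
      congr 1
      refine List.map_congr_left fun c _ => ?_
      have h1 := GG_Aw c.2.1 Z t (hg.ZL (L := c.2.2) (t := t)).rh x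
      unfold GG at h1
      rw [h1]
      have h2 : GG Z t (rh (ZL c.2.2 t g)) = fun y => rh (ZL (Z :: c.2.2) t g) y +
          (n * kap Z) * rh (ZL c.2.2 t g) y := funext fun y => GG_rh Z t hg.ZL y
      unfold GG at h2
      have h3 : Cc (fun y => (n * kap Z) * rh (ZL c.2.2 t g) y) := hg.ZL.rh.mul_left contDiff_const
      rw [h2, Aw_add (wk_integrable _) hg.ZL.rh h3, Aw_smul]
      ring

lemma list_abs_sum_le {ι : Type*} (l : List ι) (a b : ι → ℝ) (h : ∀ c ∈ l, |a c| ≤ b c) :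
    |(l.map a).sum| ≤ (l.map b).sum := by
  induction l with
  | nil => simp
  | cons c l ih =>
    simp only [List.map_cons, List.sum_cons]
    have h1 := ih fun d hd => h d (List.mem_cons_of_mem _ hd)
    have h2 := h c List.mem_cons_self
    exact (abs_add_le _ _).trans (add_le_add h2 h1)

lemma list_sum_nonneg {ι : Type*} (l : List ι) (b : ι → ℝ) (h : ∀ c ∈ l, 0 ≤ b c) :
    0 ≤ (l.map b).sum := by
  apply List.sum_nonneg
  intro x hx
  obtain ⟨c, hc, rfl⟩ := List.mem_map.1 hx
  exact h c hc

lemma list_sum_mul {ι : Type*} (l : List ι) (b : ι → ℝ) (M : ℝ) :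
    (l.map fun c => b c * M).sum = (l.map b).sum * M := List.sum_map_mul_right ..

lemma list_integrable_L1 {X ι : Type*} [MeasurableSpace X] {m : Measure X} (l : List ι)
    (F : ι → X → ℝ) (b : ι → ℝ) (h : ∀ c ∈ l, Integrable (F c) m ∧ ∫ x, |F c x| ∂m ≤ b c) :
    Integrable (fun x => (l.map (fun c => F c x)).sum) m ∧
      ∫ x, |(l.map (fun c => F c x)).sum| ∂m ≤ (l.map b).sum := by
  induction l with
  | nil => simp
  | cons c l ih =>
    simp only [List.map_cons, List.sum_cons]
    have h1 := ih fun d hd => h d (List.mem_cons_of_mem _ hd)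
    have h2 := h c List.mem_cons_self
    have i12 := h2.1.add h1.1
    refine ⟨i12, ?_⟩
    calc _ ≤ ∫ x, (|F c x| + |(l.map (fun c => F c x)).sum|) ∂m := by
          refine integral_mono i12.norm (h2.1.norm.add h1.1.norm) fun x => ?_
          exact abs_add_le _ _
      _ = _ := integral_add h2.1.norm h1.1.norm
      _ ≤ _ := add_le_add h2.2 h1.2

lemma grad_pot_bounds (c0 : ℝ) (γ : List (VFIdx n)) (i : Fin n) :
    ∃ C : ℝ, 0 ≤ C ∧ ∀ (t : ℝ) (g : E n × E n → ℝ), Cc g → 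
      (∀ M, (∀ L : List (VFIdx n), L.length ≤ γ.length → ∀ x, |rh (ZL L t g) x| ≤ M) →
        ∀ x, |fderiv ℝ (GM γ t (pot c0 g)) x (eb i)| ≤ C * M) ∧
      (∀ M, (∀ L : List (VFIdx n), L.length ≤ γ.length → ∫ x, |rh (ZL L t g) x| ≤ M) →
        Integrable (fun x => fderiv ℝ (GM γ t (pot c0 g)) x (eb i)) ∧
        ∫ x, |fderiv ℝ (GM γ t (pot c0 g)) x (eb i)| ≤ C * M) := by
  obtain ⟨cs, hcs, H⟩ := GM_pot c0 γ
  refine ⟨(cs.map fun c => |c.1| * ∫ q, |wg c.2.1 i q| ∂(mm n)).sum, ?_, ?_⟩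
  · exact list_sum_nonneg _ _ fun c _ => by positivity
  intro t g hg
  have e : GM γ t (pot c0 g) = fun x =>
      (cs.map (fun c => c.1 * Aw (wk c.2.1) (rh (ZL c.2.2 t g)) x)).sum := by
    funext p; exact H t g hg p
  have hd : ∀ c : ℝ × ℕ × List (VFIdx n),
      Differentiable ℝ (Aw (wk c.2.1) (rh (ZL c.2.2 t g))) := fun c =>
    (Aw_contDiff (wk_integrable _) hg.ZL.rh).differentiable (by norm_num)
  have hl := fderiv_listsum (fun c : ℝ × ℕ × List (VFIdx n) => c.1) _ hd cs
  have e2 : ∀ x, fderiv ℝ (GM γ t (pot c0 g)) x (eb i) =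
      (cs.map (fun c => c.1 * - Aw (wg c.2.1 i) (rh (ZL c.2.2 t g)) x)).sum := by
    intro x
    rw [e, hl.2]
    congr 1
    refine List.map_congr_left fun c _ => ?_
    rw [Aw_wk_fderiv _ hg.ZL.rh]
  constructor
  · intro M hM x
    rw [e2, ← list_sum_mul]
    refine list_abs_sum_le _ _ _ fun c hc => ?_
    rw [abs_mul, abs_neg, mul_assoc]
    gcongr
    exact Aw_sup (wg_integrable _ _) (hM _ (hcs c hc)) x
  · intro M hM
    simp only [e2]
    rw [← list_sum_mul]
    refine list_integrable_L1 _ _ _ fun c hc => ⟨?_, ?_⟩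
    · exact ((Aw_integrable (wg_integrable _ _) hg.ZL.rh).neg).const_mul _
    · simp only [abs_mul, abs_neg]
      rw [integral_const_mul, mul_assoc]
      gcongr
      refine (Aw_L1 (wg_integrable _ _) hg.ZL.rh).trans ?_
      gcongr
      exact hM _ (hcs c hc)


/-- heat-type kernel -/
def hk (n : ℕ) (R r : ℝ) : ℝ := r * rexp (-r ^ 2) * ((r ^ n)⁻¹ * rexp (-(R ^ 2 / (4 * r ^ 2))))

lemma hk_subst (n : ℕ) {R : ℝ} (hR : 0 < R) (l : ℝ) :
    |rexp (log (R / 2) / 2 + l / 2) / 2| • hk n R (rexp (log (R / 2) / 2 + l / 2)) =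
      (1 / 2 * rexp (-((n : ℝ) / 2 - 1) * log (R / 2))) *
        (rexp (-(((n : ℝ) / 2 - 1) * l)) * rexp (-(R * cosh l))) := by
  set b := log (R / 2) / 2 + l / 2 with hb
  have e1 : rexp b ^ 2 = R / 2 * rexp l := by
    rw [← Real.exp_nat_mul]
    have : ((2 : ℕ) : ℝ) * b = log (R / 2) + l := by rw [hb]; push_cast; ring
    rw [this, Real.exp_add, Real.exp_log (by positivity)]
  have e2 : R ^ 2 / (4 * rexp b ^ 2) = R / 2 * rexp (-l) := by
    rw [e1, Real.exp_neg]; field_simp; norm_num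
  have e3 : R / 2 * rexp l + R / 2 * rexp (-l) = R * cosh l := by
    rw [Real.cosh_eq]; ring
  have e4 : rexp b * rexp b * (rexp b ^ n)⁻¹ =
      rexp (-((n : ℝ) / 2 - 1) * log (R / 2)) * rexp (-(((n : ℝ) / 2 - 1) * l)) := by
    rw [← Real.exp_nat_mul, ← Real.exp_neg, ← Real.exp_add, ← Real.exp_add, ← Real.exp_add]
    congr 1; rw [hb]; ring
  have e5 : rexp (-(R / 2 * rexp l)) * rexp (-(R / 2 * rexp (-l))) = rexp (-(R * cosh l)) := by
    rw [← Real.exp_add, ← e3]; congr 1; ring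
  rw [abs_of_pos (by positivity), smul_eq_mul, hk, e2, ← e5]
  rw [show -rexp b ^ 2 = -(R / 2 * rexp l) by rw [e1]]
  linear_combination (1 / 2 * rexp (-(R / 2 * rexp l)) * rexp (-(R / 2 * rexp (-l)))) * e4

lemma hk_integral (n : ℕ) {R : ℝ} (hR : 0 < R) (hi : IntegrableOn (hk n R) (Set.Ioi 0)) :
    ∫ r in Set.Ioi (0 : ℝ), hk n R r =
      (2 : ℝ) ^ ((n : ℝ) / 2 - 1) * (R ^ ((1 : ℝ) - (n : ℝ) / 2) * Kfun ((n : ℝ) / 2 - 1) R) := by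
  set ν := (n : ℝ) / 2 - 1 with hν
  have himg : (fun l : ℝ => rexp (log (R / 2) / 2 + l / 2)) '' Set.univ = Set.Ioi 0 := by
    ext r
    simp only [Set.image_univ, Set.mem_range, Set.mem_Ioi]
    constructor
    · rintro ⟨l, rfl⟩; positivity
    · intro h
      refine ⟨2 * (log r - log (R / 2) / 2), ?_⟩
      rw [show log (R / 2) / 2 + 2 * (log r - log (R / 2) / 2) / 2 = log r by ring, Real.exp_log h]
  have hder : ∀ l ∈ (Set.univ : Set ℝ), HasDerivWithinAt
      (fun l : ℝ => rexp (log (R / 2) / 2 + l / 2)) (rexp (log (R / 2) / 2 + l / 2) / 2)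
      Set.univ l := by
    intro l _
    have := (((hasDerivAt_id l).div_const 2).const_add (log (R / 2) / 2)).exp
    refine HasDerivAt.hasDerivWithinAt (this.congr_deriv ?_)
    simp; ring
  have hinj : Set.InjOn (fun l : ℝ => rexp (log (R / 2) / 2 + l / 2)) Set.univ := by
    intro a _ b _ h
    have := Real.exp_injective h
    linarith
  have h1 := integral_image_eq_integral_abs_deriv_smul MeasurableSet.univ hder hinj (hk n R)
  have h2 := (integrableOn_image_iff_integrableOn_abs_deriv_smul MeasurableSet.univ hder hinj
    (hk n R)).1 (by rw [himg]; exact hi)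
  rw [himg] at h1
  simp only [hk_subst n hR, Measure.restrict_univ, integrableOn_univ] at h1 h2
  rw [h1, integral_const_mul]
  set c := (1 / 2 * rexp (-((n : ℝ) / 2 - 1) * log (R / 2))) with hc
  have hc0 : c ≠ 0 := by positivity
  set H : ℝ → ℝ := fun l => rexp (-(((n : ℝ) / 2 - 1) * l)) * rexp (-(R * cosh l)) with hH
  have h3 : Integrable H := by
    have := h2.const_mul c⁻¹
    refine this.congr (Filter.Eventually.of_forall fun l => ?_)
    simp only [hH]; field_simp
  have h4 : ∫ l, H l = ∫ l, H (-l) := (integral_neg_eq_self H volume).symm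
  have h5 : ∫ l, (H l + H (-l)) = 2 * ∫ l, H l := by
    rw [integral_add h3 h3.comp_neg, ← h4]; ring
  have h6 : ∀ l, H l + H (-l) = 2 * (rexp (-(R * cosh |l|)) * cosh (ν * |l|)) := by
    intro l
    have a1 : cosh (ν * |l|) = cosh (ν * l) := by
      rcases abs_choice l with h | h <;> rw [h]
      rw [mul_neg, Real.cosh_neg]
    rw [a1, Real.cosh_abs, Real.cosh_eq (ν * l)]
    simp only [hH, Real.cosh_neg, mul_neg, neg_neg]
    ring
  simp only [h6] at h5
  rw [integral_const_mul, integral_comp_abs (f := fun l => rexp (-(R * cosh l)) * cosh (ν * l))] at h5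
  have h7 : ∫ l, H l = 2 * Kfun ν R := by
    unfold Kfun; linarith
  have h8 : rexp (-((n : ℝ) / 2 - 1) * log (R / 2)) = (2 : ℝ) ^ ν * R ^ ((1 : ℝ) - (n : ℝ) / 2) := by
    rw [Real.rpow_def_of_pos two_pos, Real.rpow_def_of_pos hR, ← Real.exp_add,
      Real.log_div hR.ne' two_ne_zero]
    congr 1; rw [hν]; ring
  change c * ∫ l, H l = _
  rw [h7, hc, h8]; ring

lemma gs_change {h : E n → ℝ} (x : E n) {r : ℝ} (hr : 0 < r) :
    ∫ z, gs z * h (x - r • z) = (r ^ n)⁻¹ * ∫ y, rexp (-(‖x - y‖ ^ 2 / (4 * r ^ 2))) * h y := by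
  set f : E n → ℝ := fun w => rexp (-(‖w‖ ^ 2 / (4 * r ^ 2))) * h (x - w) with hf
  have h1 := Measure.integral_comp_smul (volume : Measure (E n)) f r
  have e1 : ∀ z, f (r • z) = gs z * h (x - r • z) := by
    intro z
    simp only [hf, gs, norm_smul, Real.norm_eq_abs, abs_of_pos hr]
    congr 2; field_simp
  simp only [e1] at h1
  have h2 := integral_sub_left_eq_self (fun y => rexp (-(‖x - y‖ ^ 2 / (4 * r ^ 2))) * h y)
    (volume : Measure (E n)) x
  simp only [sub_sub_cancel] at h2
  rw [h1, ← h2]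
  simp [abs_of_pos (pow_pos hr n), hf]

lemma Aw0_inner {h : E n → ℝ} (x : E n) {r : ℝ} (hr : 0 < r) :
    ∫ z, wk 0 (r, z) * h (x - r • z) = ∫ y, hk n ‖x - y‖ r * h y := by
  have e1 : ∀ z : E n, wk 0 (r, z) * h (x - r • z) =
      (r * rexp (-r ^ 2)) * (gs z * h (x - r • z)) := by
    intro z; simp [wk]; ring
  have e2 : ∀ y : E n, hk n ‖x - y‖ r * h y = (r * rexp (-r ^ 2)) * ((r ^ n)⁻¹ *
      (rexp (-(‖x - y‖ ^ 2 / (4 * r ^ 2))) * h y)) := by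
    intro y; simp [hk]; ring
  simp only [e1, e2, integral_const_mul, gs_change x hr]

lemma hk_meas (x : E n) : Measurable (fun q : ℝ × E n => hk n ‖x - q.2‖ q.1) := by
  unfold hk; fun_prop

lemma hk_nonneg {R r : ℝ} (hr : 0 < r) : 0 ≤ hk n R r := by unfold hk; positivity

lemma green (hn : 1 ≤ n) (c' : ℝ) {ρ : E n → ℝ} (hρ : Cc ρ) (x : E n) :
    ∫ y, Gyukawa n c' (x - y) * ρ y = c' * ((2 : ℝ) ^ ((n : ℝ) / 2 - 1))⁻¹ * Aw (wk 0) ρ x := by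
  obtain ⟨M, _, hM⟩ := hρ.bdd
  have i1 := Aw_int (wk_integrable 0) hρ.continuous hM x
  have i2 := Aw_int (wk_integrable 0) (h := fun y => |ρ y|) hρ.continuous.abs (M := M)
    (by simpa using hM) x
  have joint : Integrable (fun q : ℝ × E n => hk n ‖x - q.2‖ q.1 * ρ q.2) (mm n) := by
    have meas : AEStronglyMeasurable (fun q : ℝ × E n => hk n ‖x - q.2‖ q.1 * ρ q.2) (mm n) :=
      ((hk_meas x).mul (hρ.continuous.measurable.comp measurable_snd)).aestronglyMeasurable
    unfold mm at *
    rw [integrable_prod_iff meas]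
    constructor
    · refine (ae_restrict_mem measurableSet_Ioi).mono fun r hr => ?_
      have hr' : 0 < r := hr
      have cont : Continuous (fun y : E n => hk n ‖x - y‖ r * ρ y) := by
        refine Continuous.mul ?_ hρ.continuous
        unfold hk; fun_prop
      exact cont.integrable_of_hasCompactSupport hρ.2.mul_left
    · have := i2.integral_prod_left
      refine this.congr ((ae_restrict_mem measurableSet_Ioi).mono fun r hr => ?_)
      have hr' : 0 < r := hr
      simp only [norm_mul, Real.norm_eq_abs]
      rw [Aw0_inner (h := fun y => |ρ y|) x hr']
      refine integral_congr_ae (Filter.Eventually.of_forall fun y => ?_)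
      simp only [abs_of_nonneg (hk_nonneg hr')]
  have h1 : Aw (wk 0) ρ x = ∫ y, ∫ r in Set.Ioi (0 : ℝ), hk n ‖x - y‖ r * ρ y := by
    unfold Aw
    unfold mm at *
    rw [integral_prod _ i1, ← integral_prod_symm _ joint, integral_prod _ joint]
    refine setIntegral_congr_fun (measurableSet_Ioi (a := (0 : ℝ))) fun r hr => ?_
    exact Aw0_inner x hr
  rw [h1, ← integral_const_mul]
  unfold mm at joint
  have hae := joint.prod_left_ae
  haveI : Nonempty (Fin n) := ⟨⟨0, hn⟩⟩
  have hne : ∀ᵐ y : E n, y ≠ x := by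
    simp [ae_iff]
  refine integral_congr_ae ?_
  filter_upwards [hae, hne] with y hy hyx
  by_cases h0 : ρ y = 0
  · simp [h0]
  have hR : 0 < ‖x - y‖ := norm_pos_iff.2 (sub_ne_zero.2 hyx.symm)
  have hi : IntegrableOn (hk n ‖x - y‖) (Set.Ioi 0) := by
    have := hy.mul_const (ρ y)⁻¹
    refine this.congr (Filter.Eventually.of_forall fun r => ?_)
    simp only; field_simp
  rw [integral_mul_const, hk_integral n hR hi, Gyukawa]
  have : (2 : ℝ) ^ ((n : ℝ) / 2 - 1) ≠ 0 := by positivity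
  field_simp


lemma Cc.comp_affine {V W : Type*} [NormedAddCommGroup V] [NormedSpace ℝ V]
    [FiniteDimensional ℝ V] [NormedAddCommGroup W] [NormedSpace ℝ W] {g : W → ℝ} (hg : Cc g)
    (q : W) (ℓ : V →L[ℝ] W) (hℓ : Function.Injective ℓ) : Cc (fun z => g (q + ℓ z)) := by
  refine ⟨hg.1.comp (by fun_prop), ?_⟩
  have h1 : Topology.IsClosedEmbedding ℓ :=
    LinearMap.isClosedEmbedding_of_injective (f := (ℓ : V →ₗ[ℝ] W))
      (LinearMap.ker_eq_bot.2 hℓ)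
  have h2 : Topology.IsClosedEmbedding (fun z => q + ℓ z) :=
    (Homeomorph.addLeft q).isClosedEmbedding.comp h1
  exact hg.2.comp_isClosedEmbedding h2

/-- the direction of the i-th Klainerman-Sobolev field -/
def dd (t : ℝ) (i : Fin n) : E n × E n := ((1 + t) • eb i, eb i)

def DL (t : ℝ) : List (Fin n) → (E n × E n → ℝ) → E n × E n → ℝ
  | [], g => g
  | i :: l, g => DL t l (fun p => fderiv ℝ g p (dd t i))

lemma DL_cc (t : ℝ) (l : List (Fin n)) {g : E n × E n → ℝ} (hg : Cc g) : Cc (DL t l g) := by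
  induction l generalizing g with
  | nil => exact hg
  | cons i l ih => exact ih (hg.dir _)

lemma DL_add (t : ℝ) (l : List (Fin n)) {g h : E n × E n → ℝ} (hg : Cc g) (hh : Cc h) :
    DL t l (fun p => g p + h p) = fun p => DL t l g p + DL t l h p := by
  induction l generalizing g h with
  | nil => rfl
  | cons i l ih =>
    simp only [DL]
    rw [← ih (hg.dir _) (hh.dir _)]
    congr 1
    funext p
    rw [fderiv_fun_add (hg.differentiable p) (hh.differentiable p)]
    simp

lemma dir_dd (t : ℝ) (i : Fin n) (g : E n × E n → ℝ) :
    (fun p => fderiv ℝ g p (dd t i)) =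
      fun p => ZZ (Sum.inl i) t g p + ZZ (Sum.inr (Sum.inl i)) t g p := by
  funext p
  simp only [ZZ]
  rw [← map_add]
  congr 1
  simp [XV, Yv, U0, V0, YA, dd, add_smul]

lemma DL_L1 (t : ℝ) (l : List (Fin n)) {g : E n × E n → ℝ} (hg : Cc g) {K : ℝ}
    (hK : ∀ M : List (VFIdx n), M.length ≤ l.length → ∫ p, |ZL M t g p| ≤ K) :
    ∫ p, |DL t l g p| ≤ 2 ^ l.length * K := by
  induction l generalizing g with
  | nil => simpa [DL, ZL] using hK [] (by simp)
  | cons i l ih =>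
    have aux : ∀ Z : VFIdx n, ∫ p, |DL t l (ZZ Z t g) p| ≤ 2 ^ l.length * K := by
      intro Z
      refine ih hg.ZZ fun M hM => ?_
      have := hK (M ++ [Z]) (by simp; omega)
      rwa [ZL_append] at this
    simp only [DL]
    rw [dir_dd, DL_add t l hg.ZZ hg.ZZ]
    have i1 : ∀ Z : VFIdx n, Integrable (DL t l (ZZ Z t g)) := fun Z => (DL_cc t l hg.ZZ).integrable
    calc _ ≤ ∫ p, (|DL t l (ZZ (Sum.inl i) t g) p| + |DL t l (ZZ (Sum.inr (Sum.inl i)) t g) p|) := by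
          refine integral_mono ((i1 _).add (i1 _)).norm ((i1 _).norm.add (i1 _).norm) fun x => ?_
          exact abs_add_le _ _
      _ = _ := integral_add (i1 _).norm (i1 _).norm
      _ ≤ _ := add_le_add (aux _) (aux _)
      _ = _ := by rw [List.length_cons, pow_succ]; ring

/-- parameter map -/
def JJ (t : ℝ) (τ : Fin n → ℝ) : E n × E n := ∑ i, τ i • dd t i

lemma JJ_update (t : ℝ) (τ : Fin n → ℝ) (i : Fin n) (s : ℝ) :
    JJ t (Function.update τ i s) = (JJ t τ - τ i • dd t i) + s • dd t i := by
  unfold JJ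
  rw [← Finset.add_sum_erase _ _ (Finset.mem_univ i), ← Finset.add_sum_erase _ _ (Finset.mem_univ i)]
  simp only [Function.update_self]
  have : ∑ x ∈ Finset.univ.erase i, Function.update τ i s x • dd t x =
      ∑ x ∈ Finset.univ.erase i, τ x • dd t x := by
    refine Finset.sum_congr rfl fun x hx => ?_
    rw [Function.update_of_ne (Finset.ne_of_mem_erase hx)]
  rw [this]; abel

lemma JJ_cont (t : ℝ) : Continuous (JJ t : (Fin n → ℝ) → E n × E n) := by
  unfold JJ; fun_prop

lemma dd_ne (t : ℝ) (i : Fin n) : dd t i ≠ 0 := by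
  intro h
  have : (dd t i).2 i = 0 := by rw [h]; rfl
  simp [dd, eb] at this

lemma ks_marginal (t : ℝ) (p : E n × E n) (l : List (Fin n)) (hl : l.Nodup)
    {g : E n × E n → ℝ} (hg : Cc g) (τ : Fin n → ℝ) :
    ‖g (p + JJ t τ)‖ₑ ≤ (∫⋯∫⁻_l.toFinset, (fun τ => ‖DL t l g (p + JJ t τ)‖ₑ) ∂fun _ => volume) τ := by
  induction l generalizing g τ with
  | nil => simp [DL]
  | cons i l ih =>
    have hi : i ∉ l.toFinset := by simpa using (List.nodup_cons.1 hl).1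
    have meas : Measurable (fun τ => ‖DL t (i :: l) g (p + JJ t τ)‖ₑ) := by
      have : Continuous fun τ => DL t (i :: l) g (p + JJ t τ) :=
        (DL_cc t (i :: l) hg).continuous.comp (continuous_const.add (JJ_cont t))
      exact this.measurable.enorm
    rw [List.toFinset_cons, lmarginal_insert _ meas hi]
    set q := p + (JJ t τ - τ i • dd t i) with hq
    obtain ⟨ℓ, hℓ⟩ : ∃ ℓ : ℝ →L[ℝ] E n × E n, ∀ s, ℓ s = s • dd t i :=
      ⟨ContinuousLinearMap.toSpanSingleton ℝ (dd t i), fun s =>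
        ContinuousLinearMap.toSpanSingleton_apply ..⟩
    have hinj : Function.Injective ℓ := by
      intro a b h
      have : a • dd t i = b • dd t i := by rw [← hℓ, ← hℓ, h]
      exact smul_left_injective ℝ (dd_ne t i) this
    have hc := hg.comp_affine q ℓ hinj
    have e1 : ∀ s, p + JJ t (Function.update τ i s) = q + ℓ s := by
      intro s; rw [JJ_update, hq, hℓ, add_assoc]
    have e2 : p + JJ t τ = q + ℓ (τ i) := by rw [← e1, Function.update_eq_self]
    have hder : ∀ s, deriv (fun s => g (q + ℓ s)) s = fderiv ℝ g (q + ℓ s) (dd t i) := by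
      intro s
      have h1 : HasDerivAt (fun s => q + ℓ s) (dd t i) s := by
        have := (ℓ.hasDerivAt (x := s)).const_add q
        rwa [hℓ, one_smul] at this
      exact ((hg.differentiable (q + ℓ s)).hasFDerivAt.comp_hasDerivAt s h1).deriv
    rw [e2]
    calc ‖g (q + ℓ (τ i))‖ₑ ≤ ∫⁻ s in Set.Iic (τ i), ‖deriv (fun s => g (q + ℓ s)) s‖ₑ :=
          HasCompactSupport.enorm_le_lintegral_Ici_deriv (hc.1.of_le (by norm_num)) hc.2 (τ i)
      _ ≤ ∫⁻ s, ‖deriv (fun s => g (q + ℓ s)) s‖ₑ := setLIntegral_le_lintegral _ _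
      _ ≤ _ := by
          refine lintegral_mono fun s => ?_
          simp only []
          rw [hder, ← e1]
          exact ih (List.nodup_cons.1 hl).2 (hg.dir (dd t i)) _

/-- all derivatives -/
def DA (t : ℝ) (g : E n × E n → ℝ) : E n × E n → ℝ := DL t (List.finRange n) g

lemma JJ_eq (t : ℝ) (τ : Fin n → ℝ) :
    JJ t τ = ((1 + t) • (WithLp.toLp 2 τ : E n), (WithLp.toLp 2 τ : E n)) := by
  have h : (WithLp.toLp 2 τ : E n) = ∑ i, τ i • eb i := sum_eb _
  unfold JJ dd
  ext j
  · rw [h, Finset.smul_sum, Prod.fst_sum]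
    simp only [Prod.smul_mk, smul_comm (1 + t)]
  · rw [h, Prod.snd_sum]
    simp only [Prod.smul_mk]

def kl (t : ℝ) : E n × E n →L[ℝ] E n × E n :=
  ((1 + t) • ContinuousLinearMap.snd ℝ (E n) (E n)).prod
    (ContinuousLinearMap.fst ℝ (E n) (E n) + ContinuousLinearMap.snd ℝ (E n) (E n))

lemma kl_apply (t : ℝ) (v z : E n) : kl t (v, z) = ((1 + t) • z, v + z) := by
  simp [kl]

lemma kl_inj {t : ℝ} (ht : 0 ≤ t) : Function.Injective (kl t : E n × E n →L[ℝ] E n × E n) := by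
  rintro ⟨v, z⟩ ⟨v', z'⟩ h
  rw [kl_apply, kl_apply, Prod.mk.injEq] at h
  have h1 : z = z' := smul_right_injective (E n) (by positivity : (1 + t) ≠ 0) h.1
  subst h1
  simpa using h.2

lemma ks {t : ℝ} (ht : 0 ≤ t) {g : E n × E n → ℝ} (hg : Cc g) (x : E n) :
    (1 + t) ^ n * ∫ v, |g (x, v)| ≤ ∫ p, |DA t g p| := by
  have hG : Cc (DA t g) := DL_cc t _ hg
  have hP := hG.comp_affine (x, (0 : E n)) (kl t) (kl_inj ht)
  have hPi : Integrable (fun q : E n × E n => |DA t g ((x, (0 : E n)) + kl t q)|)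
    (volume.prod volume) := hP.integrable.norm
  have e0 : ∀ v z : E n, (x, (0 : E n)) + kl t (v, z) = (x + (1 + t) • z, v + z) := by
    intro v z; rw [kl_apply]; simp
  have h1 : ∀ v, |g (x, v)| ≤ ∫ z, |DA t g ((x, (0 : E n)) + kl t (v, z))| := by
    intro v
    have hs := ks_marginal t (x, v) (List.finRange n) (List.nodup_finRange n) hg 0
    have hu : (List.finRange n).toFinset = Finset.univ := by ext; simp
    rw [hu, lmarginal_univ] at hs
    simp only [JJ_eq] at hs
    have hv := PiLp.volume_preserving_toLp (Fin n)
    have hm : Measurable (fun z : E n => ‖DA t g ((x, v) + ((1 + t) • z, z))‖ₑ) := by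
      have : Continuous fun z : E n => DA t g ((x, v) + ((1 + t) • z, z)) :=
        hG.continuous.comp (by fun_prop)
      exact this.measurable.enorm
    have hl := hv.lintegral_comp hm
    have hs' : ‖g (x, v)‖ₑ ≤ ∫⁻ z : E n, ‖DA t g ((x, v) + ((1 + t) • z, z))‖ₑ := by
      rw [← hl]
      have e3 : (x, v) + ((1 + t) • (WithLp.toLp 2 (0 : Fin n → ℝ) : E n),
        (WithLp.toLp 2 (0 : Fin n → ℝ) : E n)) = (x, v) := by simp
      rw [e3] at hs
      exact hs
    have hintg := (hP.slice v).integrable (μ := volume)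
    simp only [e0] at hintg ⊢
    simp only [Prod.mk_add_mk] at hs'
    rw [← ofReal_integral_norm_eq_lintegral_enorm hintg, ← ofReal_norm,
      ENNReal.ofReal_le_ofReal_iff (by positivity)] at hs'
    exact hs'
  have h2 : ∫ v, |g (x, v)| ≤ ∫ v, ∫ z, |DA t g ((x, (0 : E n)) + kl t (v, z))| :=
    integral_mono (hg.slice x).integrable.norm hPi.integral_prod_left h1
  rw [integral_integral_swap hPi] at h2
  simp only [e0] at h2
  set K : E n → ℝ := fun y => ∫ v, |DA t g (y, v)| with hK
  have h3 : ∀ z, ∫ v, |DA t g (x + (1 + t) • z, v + z)| = K (x + (1 + t) • z) := fun z =>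
    integral_add_right_eq_self (fun v => |DA t g (x + (1 + t) • z, v)|) z
  simp only [h3] at h2
  have h4 := Measure.integral_comp_smul (volume : Measure (E n)) (fun y => K (x + y)) (1 + t)
  rw [h4, integral_add_left_eq_self K x] at h2
  have h5 : ∫ p, |DA t g p| = ∫ y, K y := integral_prod _ hG.integrable.norm
  rw [h5]
  have hp : 0 < (1 + t) ^ n := by positivity
  calc _ ≤ (1 + t) ^ n * (|((1 + t) ^ Module.finrank ℝ (E n))⁻¹| • ∫ y, K y) := by gcongr
    _ = ∫ y, K y := by
      simp only [finrank_euclideanSpace, Fintype.card_fin, smul_eq_mul]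
      rw [abs_of_pos (by positivity)]
      field_simp

lemma ks_bound {t : ℝ} (ht : 0 ≤ t) {g : E n × E n → ℝ} (hg : Cc g) {K : ℝ}
    (hK : ∀ M : List (VFIdx n), M.length ≤ n → ∫ p, |ZL M t g p| ≤ K) (x : E n) :
    (1 + t) ^ n * ∫ v, |g (x, v)| ≤ 2 ^ n * K := by
  refine (ks ht hg x).trans ?_
  have := DL_L1 t (List.finRange n) hg (K := K) (by simpa using hK)
  simpa [DA] using this


lemma vder (t : ℝ) (i : Fin n) (h : E n × E n → ℝ) (p : E n × E n) :
    fderiv ℝ h p (0, eb i) = ZZ (Sum.inr (Sum.inl i)) t h p - t * ZZ (Sum.inl i) t h p := by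
  simp only [ZZ]
  rw [← smul_eq_mul, ← map_smul, ← map_sub]
  congr 1
  simp [XV, Yv, U0, V0, YA]

lemma vder_int {X : Type*} [MeasurableSpace X] {m : Measure X} {a b c : X → ℝ} {t A : ℝ}
    (ht : 0 ≤ t) (hc : ∀ p, c p = a p - t * b p) (ha : Integrable a m) (hb : Integrable b m)
    (hA : ∫ p, |a p| ∂m ≤ A) (hB : ∫ p, |b p| ∂m ≤ A) : ∫ p, |c p| ∂m ≤ (1 + t) * A := by
  have hci : Integrable c m := by
    have : c = fun p => a p - t * b p := funext hc
    rw [this]; exact ha.sub (hb.const_mul t)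
  calc ∫ p, |c p| ∂m ≤ ∫ p, (|a p| + t * |b p|) ∂m := by
        refine integral_mono hci.norm (ha.norm.add (hb.norm.const_mul t)) fun p => ?_
        simp only [Real.norm_eq_abs, hc]
        refine (abs_sub _ _).trans ?_
        rw [abs_mul, abs_of_nonneg ht]
    _ = ∫ p, |a p| ∂m + t * ∫ p, |b p| ∂m := by
        have ha' : Integrable (fun p => |a p|) m := ha.norm
        have hb' : Integrable (fun p => |b p|) m := hb.norm
        rw [integral_add ha' (hb'.const_mul t), integral_const_mul]
    _ ≤ A + t * A := by gcongr
    _ = _ := by ring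

lemma prod_bound_A {a : E n → ℝ} (ha : ContDiff ℝ ∞ a) {H : E n × E n → ℝ} (hH : Cc H) {A : ℝ}
    (hA : ∀ x, |a x| ≤ A) : ∫ p : E n × E n, |a p.1 * H p| ≤ A * ∫ p, |H p| := by
  rw [← integral_const_mul]
  refine integral_mono (hH.mul_left (ha.comp contDiff_fst)).integrable.norm
    (hH.integrable.norm.const_mul A) fun p => ?_
  change |a p.1 * H p| ≤ A * |H p|
  rw [abs_mul]
  exact mul_le_mul_of_nonneg_right (hA _) (abs_nonneg _)

lemma prod_bound_B {a : E n → ℝ} (ha : ContDiff ℝ ∞ a) (hai : Integrable a)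
    {H : E n × E n → ℝ} (hH : Cc H) {B : ℝ}
    (hB : ∀ x, ∫ v, |H (x, v)| ≤ B) : ∫ p : E n × E n, |a p.1 * H p| ≤ (∫ x, |a x|) * B := by
  have hi : Integrable (fun p : E n × E n => |a p.1 * H p|) (volume.prod volume) :=
    (hH.mul_left (ha.comp contDiff_fst)).integrable.norm
  have e : ∫ p : E n × E n, |a p.1 * H p| = ∫ x, ∫ v, |a x * H (x, v)| := integral_prod _ hi
  rw [e, ← integral_mul_const]
  refine integral_mono hi.integral_prod_left (hai.norm.mul_const B) fun x => ?_
  simp only [abs_mul, Real.norm_eq_abs]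
  rw [integral_const_mul]
  gcongr
  exact hB x

lemma rh_L1 {g : E n × E n → ℝ} (hg : Cc g) : ∫ x, |rh g x| ≤ ∫ p, |g p| := by
  have hi : Integrable (fun p : E n × E n => |g p|) (volume.prod volume) := hg.integrable.norm
  have e : ∫ p : E n × E n, |g p| = ∫ x, ∫ v, |g (x, v)| := integral_prod _ hi
  rw [e]
  refine integral_mono hg.rh.integrable.norm hi.integral_prod_left fun x => ?_
  exact norm_integral_le_integral_norm (fun v => g (x, v))

/-- the energy hypothesis -/
def EB (N : ℕ) (t K : ℝ) (g : E n × E n → ℝ) : Prop :=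
  ∀ L : List (VFIdx n), L.length ≤ N → ∫ p, |ZL L t g p| ≤ K

lemma EB.vint {N : ℕ} {t K : ℝ} {g : E n × E n → ℝ} (h : EB N t K g) (ht : 0 ≤ t) (hg : Cc g)
    (L : List (VFIdx n)) (hL : L.length + n ≤ N) (x : E n) :
    ∫ v, |ZL L t g (x, v)| ≤ 2 ^ n * K / (1 + t) ^ n := by
  have := ks_bound ht (hg.ZL (L := L) (t := t)) (K := K) (fun M hM => by
    rw [← ZL_append]; exact h _ (by simp; omega)) x
  rw [le_div_iff₀ (by positivity)]
  linarith

lemma decay_aux (hn : 3 ≤ n) {t : ℝ} (ht : 0 ≤ t) :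
    (1 + t) / (1 + t) ^ n ≤ 1 / (1 + t) ^ 2 := by
  rw [div_le_div_iff₀ (by positivity) (by positivity), one_mul]
  calc (1 + t) * (1 + t) ^ 2 = (1 + t) ^ 3 := by ring
    _ ≤ _ := pow_le_pow_right₀ (by linarith) hn

lemma term_i (N : ℕ) (hn : 3 ≤ n) (hN : 2 * n ≤ N) (c0 : ℝ) (γ β : List (VFIdx n)) (i : Fin n)
    (h1 : γ.length + β.length ≤ N) (h2 : β.length < N) :
    ∃ C : ℝ, 0 ≤ C ∧ ∀ (t K : ℝ) (g : E n × E n → ℝ), 0 ≤ t → 0 ≤ K → Cc g → EB N t K g →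
      ∫ p : E n × E n, |fderiv ℝ (GM γ t (pot c0 g)) p.1 (eb i) * fderiv ℝ (ZL β t g) p (0, eb i)|
        ≤ C * (K ^ 2 / (1 + t) ^ 2) := by
  obtain ⟨C, hC0, hC⟩ := grad_pot_bounds c0 γ i
  refine ⟨C * 2 ^ n, by positivity, fun t K g ht hK hg hE => ?_⟩
  obtain ⟨hA, hB⟩ := hC t g hg
  have hu : ContDiff ℝ ∞ (fun x => fderiv ℝ (GM γ t (pot c0 g)) x (eb i)) :=
    contDiff_fderiv_field (GM_contDiff (pot_contDiff c0 hg)) contDiff_const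
  have hH : Cc (fun p => fderiv ℝ (ZL β t g) p (0, eb i)) := hg.ZL.dir _
  have fin : C * 2 ^ n * K ^ 2 * ((1 + t) / (1 + t) ^ n) ≤ C * 2 ^ n * (K ^ 2 / (1 + t) ^ 2) := by
    calc _ ≤ C * 2 ^ n * K ^ 2 * (1 / (1 + t) ^ 2) := 
        mul_le_mul_of_nonneg_left (decay_aux hn ht) (by positivity)
      _ = _ := by ring
  refine le_trans ?_ fin
  by_cases hcase : γ.length + n ≤ N
  · have hM := hA (2 ^ n * K / (1 + t) ^ n) (fun L hL x =>
      (norm_integral_le_integral_norm (fun v => ZL L t g (x, v))).trans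
        (hE.vint ht hg L (by omega) x))
    refine (prod_bound_A hu hH hM).trans ?_
    have hv : ∫ p, |fderiv ℝ (ZL β t g) p (0, eb i)| ≤ (1 + t) * K :=
      vder_int ht (vder t i (ZL β t g)) hg.ZL.ZZ.integrable hg.ZL.ZZ.integrable
        (hE (_ :: β) (by simp; omega)) (hE (_ :: β) (by simp; omega))
    calc _ ≤ C * (2 ^ n * K / (1 + t) ^ n) * ((1 + t) * K) := by gcongr
      _ = _ := by ring
  · obtain ⟨hBi, hB2⟩ := hB K (fun L hL => (rh_L1 hg.ZL).trans (hE L (by omega)))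
    have hv : ∀ x, ∫ v, |fderiv ℝ (ZL β t g) (x, v) (0, eb i)| ≤
        (1 + t) * (2 ^ n * K / (1 + t) ^ n) := fun x =>
      vder_int ht (fun v => vder t i (ZL β t g) (x, v)) (hg.ZL.ZZ.slice x).integrable
        (hg.ZL.ZZ.slice x).integrable
        (hE.vint ht hg (_ :: β) (by simp; omega) x) (hE.vint ht hg (_ :: β) (by simp; omega) x)
    refine (prod_bound_B hu hBi hH hv).trans ?_
    calc _ ≤ C * K * ((1 + t) * (2 ^ n * K / (1 + t) ^ n)) := by gcongr
      _ = _ := by ring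

lemma term_all (N : ℕ) (hn : 3 ≤ n) (hN : 2 * n ≤ N) (c0 : ℝ) (γ β : List (VFIdx n)) :
    ∃ C : ℝ, 0 ≤ C ∧ (γ.length + β.length ≤ N → β.length < N →
      ∀ (t K : ℝ) (g : E n × E n → ℝ), 0 ≤ t → 0 ≤ K → Cc g → EB N t K g →
      ∫ p : E n × E n, |dB (GM γ t (pot c0 g)) (ZL β t g) p| ≤ C * (K ^ 2 / (1 + t) ^ 2)) := by
  by_cases h1 : γ.length + β.length ≤ N
  swap
  · exact ⟨0, le_rfl, fun h => absurd h h1⟩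
  by_cases h2 : β.length < N
  swap
  · exact ⟨0, le_rfl, fun _ h => absurd h h2⟩
  choose C hC0 hC using fun i => term_i N hn hN c0 γ β i h1 h2
  refine ⟨∑ i, C i, Finset.sum_nonneg fun i _ => hC0 i, fun _ _ t K g ht hK hg hE => ?_⟩
  have hi : ∀ i : Fin n, Integrable (fun p : E n × E n =>
      fderiv ℝ (GM γ t (pot c0 g)) p.1 (eb i) * fderiv ℝ (ZL β t g) p (0, eb i)) := fun i =>
    ((hg.ZL.dir _).mul_left ((contDiff_fderiv_field (GM_contDiff (pot_contDiff c0 hg))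
      contDiff_const).comp contDiff_fst)).integrable
  calc ∫ p : E n × E n, |dB (GM γ t (pot c0 g)) (ZL β t g) p| 
      ≤ ∫ p : E n × E n, ∑ i, |fderiv ℝ (GM γ t (pot c0 g)) p.1 (eb i) *
        fderiv ℝ (ZL β t g) p (0, eb i)| := by
        refine integral_mono (Cc.dB (GM_contDiff (pot_contDiff c0 hg)) hg.ZL).integrable.norm
          (integrable_finsetSum _ fun i _ => (hi i).norm) fun p => ?_
        exact Finset.abs_sum_le_sum_abs _ _
    _ = ∑ i, ∫ p : E n × E n, |fderiv ℝ (GM γ t (pot c0 g)) p.1 (eb i) *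
        fderiv ℝ (ZL β t g) p (0, eb i)| := integral_finsetSum _ fun i _ => (hi i).norm
    _ ≤ ∑ i, C i * (K ^ 2 / (1 + t) ^ 2) := Finset.sum_le_sum fun i _ => hC i t K g ht hK hg hE
    _ = _ := by rw [Finset.sum_mul]

lemma comm_L (N : ℕ) (hn : 3 ≤ n) (hN : 2 * n ≤ N) (c0 : ℝ) (L : List (VFIdx n)) :
    ∃ C : ℝ, 0 ≤ C ∧ (L.length ≤ N →
      ∀ (t K : ℝ) (g : E n × E n → ℝ), 0 ≤ t → 0 ≤ K → Cc g → EB N t K g →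
      ∫ p : E n × E n, |ZL L t (dB (pot c0 g) g) p - dB (pot c0 g) (ZL L t g) p|
        ≤ C * (K ^ 2 / (1 + t) ^ 2)) := by
  obtain ⟨cs, hcs, H⟩ := ZL_dB L
  choose C hC0 hC using fun γ β => term_all N hn hN c0 γ β
  refine ⟨(cs.map fun c => |c.1| * C c.2.1 c.2.2).sum,
    list_sum_nonneg _ _ fun c _ => mul_nonneg (abs_nonneg _) (hC0 _ _),
    fun hL t K g ht hK hg hE => ?_⟩
  have e : ∀ p, ZL L t (dB (pot c0 g) g) p - dB (pot c0 g) (ZL L t g) p =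
      (cs.map (fun c => c.1 * dB (GM c.2.1 t (pot c0 g)) (ZL c.2.2 t g) p)).sum := by
    intro p; rw [H t _ g (pot_contDiff c0 hg) hg.1 p]; ring
  simp only [e]
  rw [← list_sum_mul]
  refine (list_integrable_L1 _ _ _ fun c hc => ⟨?_, ?_⟩).2
  · exact (Cc.dB (GM_contDiff (pot_contDiff c0 hg)) hg.ZL).integrable.const_mul _
  · simp only [abs_mul]
    rw [integral_const_mul, mul_assoc]
    have := hcs c hc
    gcongr
    exact hC _ _ (by omega) (by omega) t K g ht hK hg hE

lemma source_est (N : ℕ) (hn : 3 ≤ n) (hN : 2 * n ≤ N) (c0 : ℝ) :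
    ∃ C : ℝ, 0 ≤ C ∧ ∀ (t K : ℝ) (g : E n × E n → ℝ), 0 ≤ t → 0 ≤ K → Cc g → EB N t K g →
      (∀ i x, |fderiv ℝ (pot c0 g) x (eb i)| ≤ C * K) ∧
      ∀ L : List (VFIdx n), L.length ≤ N →
      ∫ p : E n × E n, |ZL L t (dB (pot c0 g) g) p - dB (pot c0 g) (ZL L t g) p|
        ≤ C * (K ^ 2 / (1 + t) ^ 2) := by
  choose C hC0 hC using comm_L N hn hN c0
  choose D hD0 hD using grad_pot_bounds (n := n) c0 []
  have hfin : {L : List (VFIdx n) | L.length ≤ N}.Finite := List.finite_length_le _ _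
  set A := ∑ L ∈ hfin.toFinset, C L
  set B := ∑ i, D i * 2 ^ n
  have hA : 0 ≤ A := Finset.sum_nonneg fun L _ => hC0 L
  have hB : 0 ≤ B := Finset.sum_nonneg fun i _ => mul_nonneg (hD0 i) (by positivity)
  refine ⟨A + B, by positivity, fun t K g ht hK hg hE => ⟨fun i x => ?_, fun L hL => ?_⟩⟩
  · have h1 := (hD i t g hg).1 (2 ^ n * K) (fun L hL x => by
      refine (norm_integral_le_integral_norm (fun v => ZL L t g (x, v))).trans
        ((hE.vint ht hg L (by simp at hL; subst hL; simp; omega) x).trans ?_)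
      exact div_le_self (by positivity) (one_le_pow₀ (by linarith))) x
    refine h1.trans ?_
    have h2 : D i * 2 ^ n ≤ B := Finset.single_le_sum (f := fun i => D i * 2 ^ n)
      (fun i _ => mul_nonneg (hD0 i) (by positivity)) (Finset.mem_univ i)
    calc D i * (2 ^ n * K) = (D i * 2 ^ n) * K := by ring
      _ ≤ (A + B) * K := by gcongr; linarith
  · refine (hC L hL t K g ht hK hg hE).trans ?_
    have h2 : C L ≤ A := Finset.single_le_sum (f := C) (fun i _ => hC0 i) (by simpa using hL)
    gcongr
    linarith


/-- smooth approximation of the absolute value -/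
def bet (δ y : ℝ) : ℝ := Real.sqrt (y ^ 2 + δ ^ 2) - δ

lemma bet_hasDerivAt {δ : ℝ} (hδ : 0 < δ) (y : ℝ) :
    HasDerivAt (bet δ) (y / Real.sqrt (y ^ 2 + δ ^ 2)) y := by
  have h1 : HasDerivAt (fun y : ℝ => y ^ 2 + δ ^ 2) (2 * y) y := by
    simpa using (hasDerivAt_pow 2 y).add_const (δ ^ 2)
  have h2 := (h1.sqrt (by positivity)).sub_const δ
  rw [mul_div_mul_left _ _ two_ne_zero] at h2
  exact h2

lemma bet_contDiff {δ : ℝ} (hδ : 0 < δ) : ContDiff ℝ ∞ (bet δ) := by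
  unfold bet
  exact ((by fun_prop : ContDiff ℝ ∞ fun y : ℝ => y ^ 2 + δ ^ 2).sqrt
    (fun y => by positivity)).sub contDiff_const

lemma bet_zero {δ : ℝ} (hδ : 0 < δ) : bet δ 0 = 0 := by
  simp [bet, Real.sqrt_sq hδ.le]

lemma bet_ge (δ y : ℝ) : |y| ≤ bet δ y + δ := by
  simp only [bet, sub_add_cancel]
  exact Real.abs_le_sqrt (by nlinarith [sq_nonneg δ])

lemma bet_abs_le {δ : ℝ} (hδ : 0 < δ) (y : ℝ) : |bet δ y| ≤ |y| := by
  have h0 : δ ≤ Real.sqrt (y ^ 2 + δ ^ 2) := Real.le_sqrt_of_sq_le (by nlinarith [sq_nonneg y])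
  have h1 : Real.sqrt (y ^ 2 + δ ^ 2) ≤ |y| + δ := by
    rw [Real.sqrt_le_left (by positivity)]
    nlinarith [sq_abs y, abs_nonneg y, mul_nonneg (abs_nonneg y) hδ.le]
  rw [bet, abs_of_nonneg (by linarith)]; linarith

lemma bet_deriv_le {δ : ℝ} (y : ℝ) : |y / Real.sqrt (y ^ 2 + δ ^ 2)| ≤ 1 := by
  rw [abs_div, abs_of_nonneg (Real.sqrt_nonneg _)]
  exact div_le_one_of_le₀ (Real.abs_le_sqrt (by nlinarith [sq_nonneg δ])) (Real.sqrt_nonneg _)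

lemma cut_hasDerivAt {G : ℝ × E n × E n → ℝ} (hG : ContDiff ℝ ∞ G) {χ : E n × E n → ℝ} (hχ : Cc χ)
    (s : ℝ) : HasDerivAt (fun s => ∫ p, χ p * G (s, p)) (∫ p, χ p * fderiv ℝ G (s, p) (1, 0)) s := by
  have hD : Continuous (fun q : ℝ × E n × E n => fderiv ℝ G q (1, 0)) :=
    (contDiff_fderiv_field hG contDiff_const).continuous
  have hcomp : IsCompact (Metric.closedBall s 1 ×ˢ tsupport χ) :=
    (isCompact_closedBall s 1).prod hχ.2.isCompact
  obtain ⟨M, hM⟩ := hcomp.exists_bound_of_continuousOn hD.continuousOn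
  refine (hasDerivAt_integral_of_dominated_loc_of_deriv_le (s := Metric.closedBall s 1)
    (F := fun s p => χ p * G (s, p)) (F' := fun s p => χ p * fderiv ℝ G (s, p) (1, 0))
    (bound := fun p => ‖χ p‖ * M)
    (Metric.closedBall_mem_nhds s one_pos) ?_ ?_ ?_ ?_ ?_ ?_).2
  · exact Filter.Eventually.of_forall fun s =>
      (hχ.continuous.mul (hG.continuous.comp (by fun_prop))).aestronglyMeasurable
  · exact ((hχ.mul_left (slice_contDiff hG s)).integrable).congr
      (Filter.Eventually.of_forall fun p => mul_comm _ _)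
  · exact (hχ.continuous.mul (hD.comp (by fun_prop))).aestronglyMeasurable
  · refine Filter.Eventually.of_forall fun p σ hσ => ?_
    rw [norm_mul]
    by_cases hp : p ∈ tsupport χ
    · exact mul_le_mul_of_nonneg_left (hM (σ, p) ⟨hσ, hp⟩) (norm_nonneg _)
    · rw [image_eq_zero_of_notMem_tsupport hp]; simp
  · exact hχ.integrable.norm.mul_const M
  · exact Filter.Eventually.of_forall fun p σ _ => (slice_deriv hG σ p).const_mul _

lemma ibp_div {χ a b : E n × E n → ℝ} (hχ : Cc χ) (ha : ContDiff ℝ ∞ a) (hb : Cc b) (e : E n × E n)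
    (h0 : ∀ p, fderiv ℝ a p e = 0) :
    ∫ p, χ p * (a p * fderiv ℝ b p e) = - ∫ p, a p * fderiv ℝ χ p e * b p := by
  have : ∫ p, (a p * χ p) * fderiv ℝ b p e = - ∫ p, fderiv ℝ (fun p => a p * χ p) p e * b p :=
    ibp (μ := (volume : Measure (E n)).prod (volume : Measure (E n))) (ha.mul hχ.1) hb e
  rw [show ∫ p, χ p * (a p * fderiv ℝ b p e) = ∫ p, (a p * χ p) * fderiv ℝ b p e from
    integral_congr_ae (Filter.Eventually.of_forall fun p => by simp only; ring), this]
  congr 1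
  refine integral_congr_ae (Filter.Eventually.of_forall fun p => ?_)
  simp only
  rw [fderiv_fun_mul ((ha.differentiable (by norm_num)) p) (hχ.differentiable p)]
  simp [h0]

/-- the phase-space field -/
def WW (μ : ℝ) (u : E n → ℝ) (p : E n × E n) : E n × E n :=
  (p.2, μ • ∑ i, fderiv ℝ u p.1 (eb i) • eb i)

lemma WW_apply (μ : ℝ) (u : E n → ℝ) (p : E n × E n) (ℓ : E n × E n →L[ℝ] ℝ) :
    ℓ (WW μ u p) = ∑ i, p.2 i * ℓ (eb i, 0) +
      ∑ i, (μ * fderiv ℝ u p.1 (eb i)) * ℓ (0, eb i) := by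
  have : WW μ u p = (p.2, 0) + ∑ i, (μ * fderiv ℝ u p.1 (eb i)) • ((0 : E n), eb i) := by
    simp only [WW]
    refine Prod.ext ?_ ?_
    · simp [Prod.fst_sum]
    · simp [Prod.snd_sum, Finset.smul_sum, smul_smul]
  rw [this, map_add, map_sum, fderiv_sum_fst]
  congr 1
  exact Finset.sum_congr rfl fun i _ => by rw [map_smul, smul_eq_mul]

lemma ibp_WW {μ : ℝ} {u : E n → ℝ} (hu : ContDiff ℝ ∞ u) {χ b : E n × E n → ℝ} (hχ : Cc χ) (hb : Cc b) :
    ∫ p, χ p * fderiv ℝ b p (WW μ u p) = - ∫ p, fderiv ℝ χ p (WW μ u p) * b p := by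
  have ha1 : ∀ i : Fin n, ContDiff ℝ ∞ (fun p : E n × E n => p.2 i) := fun i => by fun_prop
  have hu' : ∀ i : Fin n, ContDiff ℝ ∞ (fun x => μ * fderiv ℝ u x (eb i)) := fun i =>
    contDiff_const.mul (contDiff_fderiv_field hu contDiff_const)
  have ha2 : ∀ i : Fin n, ContDiff ℝ ∞ (fun p : E n × E n => μ * fderiv ℝ u p.1 (eb i)) := fun i =>
    (hu' i).comp contDiff_fst
  have z1 : ∀ (i : Fin n) p, fderiv ℝ (fun p : E n × E n => p.2 i) p (eb i, 0) = 0 := by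
    intro i p
    have : HasFDerivAt (fun p : E n × E n => p.2 i)
      ((EuclideanSpace.proj i : E n →L[ℝ] ℝ).comp (ContinuousLinearMap.snd ℝ (E n) (E n))) p :=
      ((EuclideanSpace.proj i : E n →L[ℝ] ℝ).comp
        (ContinuousLinearMap.snd ℝ (E n) (E n))).hasFDerivAt
    rw [this.fderiv]; simp
  have z2 : ∀ (i : Fin n) p,
      fderiv ℝ (fun p : E n × E n => μ * fderiv ℝ u p.1 (eb i)) p (0, eb i) = 0 := by
    intro i p
    have h1 := (((hu' i).differentiable (by norm_num)) p.1).hasFDerivAt.comp p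
      (hasFDerivAt_fst (𝕜 := ℝ) (p := p))
    have h2 : fderiv ℝ (fun p : E n × E n => μ * fderiv ℝ u p.1 (eb i)) p = _ := h1.fderiv
    rw [h2]; simp
  have e1 : ∀ p, χ p * fderiv ℝ b p (WW μ u p) =
      ∑ i, χ p * (p.2 i * fderiv ℝ b p (eb i, 0)) +
      ∑ i, χ p * ((μ * fderiv ℝ u p.1 (eb i)) * fderiv ℝ b p (0, eb i)) := fun p => by
    rw [WW_apply, mul_add, Finset.mul_sum, Finset.mul_sum]
  have e2 : ∀ p, fderiv ℝ χ p (WW μ u p) * b p =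
      ∑ i, p.2 i * fderiv ℝ χ p (eb i, 0) * b p +
      ∑ i, (μ * fderiv ℝ u p.1 (eb i)) * fderiv ℝ χ p (0, eb i) * b p := fun p => by
    rw [WW_apply, add_mul, Finset.sum_mul, Finset.sum_mul]
  have i1 : ∀ (a : E n × E n → ℝ) (_ : ContDiff ℝ ∞ a) e,
      Integrable (fun p => χ p * (a p * fderiv ℝ b p e)) := fun a ha e =>
    (((hb.dir e).mul_left ha).mul_left hχ.1).integrable
  have i2 : ∀ (a : E n × E n → ℝ) (_ : ContDiff ℝ ∞ a) e,
      Integrable (fun p => a p * fderiv ℝ χ p e * b p) := fun a ha e =>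
    (hb.mul_left (ha.mul (hχ.dir e).1)).integrable
  simp only [e1, e2]
  rw [integral_add (integrable_finsetSum _ fun i _ => i1 _ (ha1 i) _)
      (integrable_finsetSum _ fun i _ => i1 _ (ha2 i) _),
    integral_add (integrable_finsetSum _ fun i _ => i2 _ (ha1 i) _)
      (integrable_finsetSum _ fun i _ => i2 _ (ha2 i) _),
    integral_finsetSum _ (fun i _ => i1 _ (ha1 i) _), integral_finsetSum _ (fun i _ => i1 _ (ha2 i) _),
    integral_finsetSum _ (fun i _ => i2 _ (ha1 i) _), integral_finsetSum _ (fun i _ => i2 _ (ha2 i) _),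
    neg_add, ← Finset.sum_neg_distrib, ← Finset.sum_neg_distrib]
  congr 1
  · exact Finset.sum_congr rfl fun i _ => ibp_div hχ (ha1 i) hb _ (z1 i)
  · exact Finset.sum_congr rfl fun i _ => ibp_div hχ (ha2 i) hb _ (z2 i)

/-- cut-off functions -/
lemma exists_cut (n : ℕ) : ∃ (χ : ℝ → E n × E n → ℝ) (M : ℝ), 0 ≤ M ∧
    (∀ R, 1 ≤ R → Cc (χ R)) ∧ (∀ R p, 0 ≤ χ R p) ∧ (∀ R p, χ R p ≤ 1) ∧
    (∀ R p, 1 ≤ R → ‖p‖ ≤ R → χ R p = 1) ∧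
    (∀ R p (w : E n), 1 ≤ R → |fderiv ℝ (χ R) p (p.2, w)| ≤ M * (2 + ‖w‖) / R) := by
  let ζ : ContDiffBump (0 : E n × E n) := ⟨1, 2, one_pos, by norm_num⟩
  have hζ : Cc (ζ : E n × E n → ℝ) := ⟨ζ.contDiff, ζ.hasCompactSupport⟩
  obtain ⟨M, hM0, hM⟩ := hζ.bdd_fderiv
  let ℓ : ℝ → (E n × E n →L[ℝ] E n × E n) := fun R =>
    ((R ^ 2)⁻¹ • ContinuousLinearMap.fst ℝ (E n) (E n)).prod (R⁻¹ • ContinuousLinearMap.snd ℝ (E n) (E n))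
  have hℓ : ∀ R p, ℓ R p = ((R ^ 2)⁻¹ • p.1, R⁻¹ • p.2) := fun R p => rfl
  refine ⟨fun R p => ζ (ℓ R p), M, hM0, fun R hR => ?_, fun R p => ζ.nonneg, fun R p => ζ.le_one,
    fun R p hR hp => ?_, fun R p w hR => ?_⟩
  · have := hζ.comp_affine 0 (ℓ R) (fun p q h => by
      simp only [hℓ, Prod.mk.injEq] at h
      have h0 : R ≠ 0 := by positivity
      exact Prod.ext (smul_right_injective _ (inv_ne_zero (pow_ne_zero 2 h0)) h.1)
        (smul_right_injective _ (inv_ne_zero h0) h.2))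
    simpa using this
  · apply ζ.one_of_mem_closedBall
    rw [mem_closedBall_zero_iff, hℓ]
    have h1 : ‖p.1‖ ≤ R := (norm_fst_le p).trans hp
    have h2 : ‖p.2‖ ≤ R := (norm_snd_le p).trans hp
    change ‖((R ^ 2)⁻¹ • p.1, R⁻¹ • p.2)‖ ≤ 1
    rw [Prod.norm_def, max_le_iff]
    simp only [norm_smul, norm_inv, norm_pow, Real.norm_eq_abs, sq_abs, abs_of_pos (by linarith : 0 < R)]
    constructor
    · rw [inv_mul_le_iff₀ (by positivity)]; nlinarith
    · rw [inv_mul_le_iff₀ (by positivity)]; linarith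
  · have hR0 : 0 < R := by linarith
    have h1 := (hζ.differentiable (ℓ R p)).hasFDerivAt.comp p (ℓ R).hasFDerivAt
    have h2 : fderiv ℝ (fun p => ζ (ℓ R p)) p = _ := h1.fderiv
    rw [h2, ContinuousLinearMap.comp_apply]
    by_cases hp : ‖ℓ R p‖ ≤ 2
    · have h3 : R⁻¹ * ‖p.2‖ ≤ 2 := by
        have := (norm_snd_le (ℓ R p)).trans hp
        simpa [hℓ, norm_smul, abs_of_pos hR0] using this
      have h4 : ‖ℓ R (p.2, w)‖ ≤ (2 + ‖w‖) / R := by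
        rw [hℓ, Prod.norm_def, max_le_iff]
        simp only [norm_smul, norm_inv, norm_pow, Real.norm_eq_abs, sq_abs, abs_of_pos hR0]
        have hw := norm_nonneg w
        constructor
        · calc (R ^ 2)⁻¹ * ‖p.2‖ = R⁻¹ * ‖p.2‖ / R := by field_simp
            _ ≤ _ := by gcongr; linarith
        · calc R⁻¹ * ‖w‖ = ‖w‖ / R := by field_simp
            _ ≤ _ := by gcongr; linarith
      calc |fderiv ℝ ζ (ℓ R p) (ℓ R (p.2, w))| ≤ ‖fderiv ℝ ζ (ℓ R p)‖ * ‖ℓ R (p.2, w)‖ :=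
            (fderiv ℝ ζ (ℓ R p)).le_opNorm _
        _ ≤ M * ((2 + ‖w‖) / R) := mul_le_mul (hM _) h4 (norm_nonneg _) hM0
        _ = _ := by ring
    · have : fderiv ℝ ζ (ℓ R p) = 0 := by
        apply image_eq_zero_of_notMem_tsupport
        intro hmem
        have := tsupport_fderiv_subset ℝ hmem
        rw [ζ.tsupport_eq, mem_closedBall_zero_iff] at this
        exact hp this
      rw [this]; simp; positivity


lemma WW_contDiff {μ : ℝ} {u : E n → ℝ} (hu : ContDiff ℝ ∞ u) : ContDiff ℝ ∞ (WW μ u) := by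
  have h1 : ∀ i : Fin n, ContDiff ℝ ∞ (fun p : E n × E n => fderiv ℝ u p.1 (eb i)) := fun i =>
    (contDiff_fderiv_field hu contDiff_const).comp contDiff_fst
  unfold WW
  fun_prop

/-- transport identity at a fixed time, tested against a cut-off -/
lemma cut_identity {G : ℝ × E n × E n → ℝ} (hG : ContDiff ℝ ∞ G) {χ : E n × E n → ℝ} (hχ : Cc χ)
    {μ : ℝ} {u : E n → ℝ} (hu : ContDiff ℝ ∞ u) {s : ℝ} (hs : Cc (fun p => G (s, p)))
    {r : E n × E n → ℝ} (hr : Integrable (fun p => χ p * r p))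
    (heq : ∀ p, fderiv ℝ G (s, p) (TS (s, p)) + μ * dB u (fun p => G (s, p)) p = r p) :
    ∫ p, χ p * fderiv ℝ G (s, p) (1, 0) =
      (∫ p, χ p * r p) + ∫ p, fderiv ℝ χ p (WW μ u p) * G (s, p) := by
  have e : ∀ p, χ p * fderiv ℝ G (s, p) (1, 0) =
      χ p * r p - χ p * fderiv ℝ (fun p => G (s, p)) p (WW μ u p) := by
    intro p
    rw [← heq p, WW_apply]
    have h1 : fderiv ℝ G (s, p) (TS (s, p)) = fderiv ℝ G (s, p) (1, 0) +
        fderiv ℝ (fun p => G (s, p)) p (p.2, 0) := by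
      rw [slice_fderiv hG, ← map_add]; simp [TS]
    rw [h1, fderiv_sum_fst]
    simp only [dB, Finset.mul_sum, mul_assoc]
    ring
  have hi : Integrable (fun p => χ p * fderiv ℝ (fun p => G (s, p)) p (WW μ u p)) := by
    have hW : ContDiff ℝ ∞ (WW μ u) := WW_contDiff hu
    exact ((hs.field hW).mul_left hχ.1).integrable
  simp only [e]
  rw [integral_sub hr hi, ibp_WW hu hχ hs, sub_neg_eq_add]

lemma WW_norm {μ B : ℝ} (hμ : |μ| = 1) {u : E n → ℝ} (hB : ∀ i x, |fderiv ℝ u x (eb i)| ≤ B) (x : E n) :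
    ‖μ • ∑ i, fderiv ℝ u x (eb i) • (eb i : E n)‖ ≤ n * B := by
  rw [norm_smul, Real.norm_eq_abs, hμ, one_mul]
  refine (norm_sum_le _ _).trans ?_
  calc ∑ i, ‖fderiv ℝ u x (eb i) • (eb i : E n)‖ ≤ ∑ _i : Fin n, B := by
        refine Finset.sum_le_sum fun i _ => ?_
        rw [norm_smul]; simpa [eb] using hB i x
    _ = _ := by simp

/-- the `L¹` estimate for the perturbed transport operator -/
lemma transport_L1 {h : ℝ × E n × E n → ℝ} (hh : ContDiff ℝ ∞ h) {μ : ℝ} (hμ : |μ| = 1)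
    {t1 B D K : ℝ} (ht1 : 0 ≤ t1) (hB0 : 0 ≤ B) (u : ℝ → E n → ℝ) (r : ℝ → E n × E n → ℝ)
    (hu : ∀ s ∈ Set.Icc 0 t1, ContDiff ℝ ∞ (u s))
    (huB : ∀ s ∈ Set.Icc 0 t1, ∀ i x, |fderiv ℝ (u s) x (eb i)| ≤ B)
    (hc : ∀ s ∈ Set.Icc 0 t1, Cc (fun p => h (s, p)))
    (hK : ∀ s ∈ Set.Icc 0 t1, ∫ p, |h (s, p)| ≤ K)
    (hrc : ∀ s ∈ Set.Icc 0 t1, Cc (r s))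
    (hrD : ∀ s ∈ Set.Icc 0 t1, ∫ p, |r s p| ≤ D * (1 / (1 + s) ^ 2))
    (heq : ∀ s ∈ Set.Icc 0 t1, ∀ p,
      fderiv ℝ h (s, p) (TS (s, p)) + μ * dB (u s) (fun p => h (s, p)) p = r s p) :
    ∫ p, |h (t1, p)| ≤ (∫ p, |h (0, p)|) + D := by
  obtain ⟨χ, M, hM0, hχ, hχ0, hχ1, hχR, hχD⟩ := exists_cut n
  have m0 : (0 : ℝ) ∈ Set.Icc 0 t1 := ⟨le_rfl, ht1⟩
  have m1 : t1 ∈ Set.Icc 0 t1 := ⟨ht1, le_rfl⟩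
  have hD0 : 0 ≤ D := by
    have := hrD 0 m0
    simp at this
    exact (integral_nonneg fun p => abs_nonneg _).trans this
  have hK0 : 0 ≤ K := (integral_nonneg fun p => abs_nonneg _).trans (hK 0 m0)
  set M' : ℝ := M * (2 + n * B) * K with hM'
  have hM'0 : 0 ≤ M' := by positivity
  have key : ∀ R δ : ℝ, 1 ≤ R → 0 < δ →
      ∫ p, χ R p * bet δ (h (t1, p)) ≤ (∫ p, |h (0, p)|) + D + M' / R * t1 := by
    intro R δ hR hδ
    have hR0 : 0 < R := by linarith
    set G : ℝ × E n × E n → ℝ := fun q => bet δ (h q) with hGdef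
    have hG : ContDiff ℝ ∞ G := (bet_contDiff hδ).comp hh
    have hGc : ∀ s ∈ Set.Icc 0 t1, Cc (fun p => G (s, p)) := fun s hs =>
      ⟨slice_contDiff hG s, (hc s hs).2.comp_left (g := bet δ) (bet_zero hδ)⟩
    have hI := cut_hasDerivAt hG (hχ R hR)
    have hder : ∀ s ∈ Set.Icc 0 t1, ∫ p, χ R p * fderiv ℝ G (s, p) (1, 0) ≤
        D * (1 / (1 + s) ^ 2) + M' / R := by
      intro s hs
      set b' : E n × E n → ℝ := fun p => h (s, p) / Real.sqrt (h (s, p) ^ 2 + δ ^ 2) with hb'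
      have hb'1 : ∀ p, |b' p| ≤ 1 := fun p => bet_deriv_le _
      have hb'c : Continuous b' := by
        refine (hc s hs).continuous.div ?_ fun p => by positivity
        exact (((hc s hs).continuous.pow 2).add continuous_const).sqrt
      have fd : ∀ p, fderiv ℝ G (s, p) = b' p • fderiv ℝ h (s, p) := fun p =>
        ((bet_hasDerivAt hδ (h (s, p))).comp_hasFDerivAt (s, p)
          ((hh.differentiable (by norm_num)) (s, p)).hasFDerivAt).fderiv
      have fs : ∀ p w, fderiv ℝ (fun p => G (s, p)) p w = b' p * fderiv ℝ (fun p => h (s, p)) p w := by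
        intro p w
        rw [slice_fderiv hG, slice_fderiv hh, fd]; simp
      have hri : Integrable (fun p => χ R p * (b' p * r s p)) := by
        refine Continuous.integrable_of_hasCompactSupport ?_ ?_
        · exact (hχ R hR).continuous.mul (hb'c.mul (hrc s hs).continuous)
        · exact (hχ R hR).2.mul_right
      have id := cut_identity hG (hχ R hR) (μ := μ) (hu s hs) (hGc s hs) (r := fun p => b' p * r s p) hri
        (fun p => by
          rw [← heq s hs p, fd]
          simp only [dB, fs, ContinuousLinearMap.smul_apply, smul_eq_mul, mul_add, Finset.mul_sum]
          congr 1
          exact Finset.sum_congr rfl fun i _ => by ring)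
      rw [id]
      refine add_le_add ?_ ?_
      · refine le_trans ?_ (hrD s hs)
        refine integral_mono hri (hrc s hs).integrable.norm fun p => ?_
        refine (le_abs_self (χ R p * (b' p * r s p))).trans ?_
        rw [abs_mul, abs_mul, abs_of_nonneg (hχ0 R p)]
        calc χ R p * (|b' p| * |r s p|) ≤ 1 * (1 * |r s p|) := by
              gcongr
              · exact hχ1 R p
              · exact hb'1 p
          _ = _ := by simp
      · have hW : ∀ p, |fderiv ℝ (χ R) p (WW μ (u s) p)| ≤ M * (2 + n * B) / R := fun p => by
          refine (hχD R p _ hR).trans ?_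
          gcongr
          exact WW_norm hμ (huB s hs) p.1
        calc ∫ p, fderiv ℝ (χ R) p (WW μ (u s) p) * G (s, p)
            ≤ ∫ p, M * (2 + n * B) / R * |h (s, p)| := by
              have hWc : ContDiff ℝ ∞ (WW μ (u s)) := WW_contDiff (hu s hs)
              refine integral_mono ((hGc s hs).mul_left ((hχ R hR).field hWc).1).integrable
                ((hc s hs).integrable.norm.const_mul _) fun p => ?_
              refine (le_abs_self _).trans ?_
              rw [abs_mul]
              exact mul_le_mul (hW p) (bet_abs_le hδ _) (abs_nonneg _) (by positivity)
          _ = M * (2 + n * B) / R * ∫ p, |h (s, p)| := integral_const_mul _ _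
          _ ≤ M * (2 + n * B) / R * K := mul_le_mul_of_nonneg_left (hK s hs) (by positivity)
          _ = M' / R := by rw [hM']; ring
    set J : ℝ → ℝ := fun s => (∫ p, χ R p * G (s, p)) + D * (1 + s)⁻¹ - M' / R * s with hJ
    have hJd : ∀ s ∈ Set.Icc 0 t1, HasDerivAt J
        ((∫ p, χ R p * fderiv ℝ G (s, p) (1, 0)) + D * (-1 / (1 + s) ^ 2) - M' / R * 1) s := by
      intro s hs
      have h1 : HasDerivAt (fun s : ℝ => 1 + s) 1 s := (hasDerivAt_id s).const_add 1
      have h2 := h1.inv (by have := hs.1; positivity)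
      exact ((hI s).add (h2.const_mul D)).sub ((hasDerivAt_id s).const_mul _)
    have anti : AntitoneOn J (Set.Icc 0 t1) := by
      refine antitoneOn_of_deriv_nonpos (convex_Icc 0 t1)
        (fun s hs => (hJd s hs).continuousAt.continuousWithinAt)
        (fun s hs => (hJd s (interior_subset hs)).differentiableAt.differentiableWithinAt)
        (fun s hs => ?_)
      rw [(hJd s (interior_subset hs)).deriv]
      have := hder s (interior_subset hs)
      have e : D * (-1 / (1 + s) ^ 2) = - (D * (1 / (1 + s) ^ 2)) := by ring
      rw [e]; linarith
    have fin := anti m0 m1 ht1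
    simp only [hJ] at fin
    have s0 : ∫ p, χ R p * G (0, p) ≤ ∫ p, |h (0, p)| := by
      refine integral_mono ((hGc 0 m0).mul_left (hχ R hR).1).integrable (hc 0 m0).integrable.norm
        fun p => ?_
      refine (le_abs_self _).trans ?_
      rw [abs_mul, abs_of_nonneg (hχ0 R p)]
      calc χ R p * |G (0, p)| ≤ 1 * |h (0, p)| := 
            mul_le_mul (hχ1 R p) (bet_abs_le hδ _) (abs_nonneg _) zero_le_one
        _ = _ := one_mul _
    have pos : 0 ≤ D * (1 + t1)⁻¹ := by positivity
    simp at fin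
    change ∫ p, χ R p * G (t1, p) ≤ _
    linarith
  obtain ⟨ρ, hρ⟩ := (hc t1 m1).2.isCompact.isBounded.exists_norm_le
  refine le_of_forall_pos_le_add fun η hη => ?_
  set R : ℝ := max (max 1 ρ) (2 * (M' * t1) / η) with hRdef
  have hR1 : 1 ≤ R := (le_max_left _ _).trans (le_max_left _ _)
  have hRρ : ρ ≤ R := (le_max_right _ _).trans (le_max_left _ _)
  have hRη : 2 * (M' * t1) / η ≤ R := le_max_right _ _
  have hR0 : 0 < R := by linarith
  have hX0 : 0 ≤ ∫ p, χ R p := integral_nonneg (hχ0 R)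
  set X := ∫ p, χ R p with hX
  set δ : ℝ := η / (2 * (X + 1)) with hδ
  have hδ0 : 0 < δ := by positivity
  have hδX : δ * X ≤ η / 2 := by
    rw [hδ, div_mul_eq_mul_div, div_le_div_iff₀ (by positivity) (by positivity)]
    nlinarith
  have hMR : M' / R * t1 ≤ η / 2 := by
    rw [div_mul_eq_mul_div, div_le_iff₀ hR0]
    rw [div_le_iff₀ hη] at hRη
    linarith
  have hone : ∀ p, |h (t1, p)| ≤ χ R p * bet δ (h (t1, p)) + δ * χ R p := by
    intro p
    by_cases hp : p ∈ tsupport (fun p => h (t1, p))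
    · rw [hχR R p hR1 ((hρ p hp).trans hRρ)]
      simpa using bet_ge δ (h (t1, p))
    · have : h (t1, p) = 0 := image_eq_zero_of_notMem_tsupport (f := fun p => h (t1, p)) hp
      rw [this, bet_zero hδ0]
      simpa using mul_nonneg hδ0.le (hχ0 R p)
  have hi1 : Integrable (fun p => χ R p * bet δ (h (t1, p))) := by
    have : Cc (fun p => bet δ (h (t1, p))) :=
      ⟨(bet_contDiff hδ0).comp (hc t1 m1).1, (hc t1 m1).2.comp_left (g := bet δ) (bet_zero hδ0)⟩
    exact (this.mul_left (hχ R hR1).1).integrable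
  calc ∫ p, |h (t1, p)| ≤ ∫ p, (χ R p * bet δ (h (t1, p)) + δ * χ R p) :=
        integral_mono (hc t1 m1).integrable.norm (hi1.add ((hχ R hR1).integrable.const_mul δ)) hone
    _ = (∫ p, χ R p * bet δ (h (t1, p))) + δ * X := by
        rw [integral_add hi1 ((hχ R hR1).integrable.const_mul δ), integral_const_mul]
    _ ≤ _ := by linarith [key R δ hR1 hδ0]


lemma bootstrap {g : ℝ → ℝ} {T ε : ℝ} (hε : 0 < ε) (hg : ContinuousOn g (Set.Ico 0 T)) (h0 : g 0 ≤ ε)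
    (hstep : ∀ t ∈ Set.Ico 0 T, (∀ s ∈ Set.Icc 0 t, g s ≤ 2 * ε) → g t < 2 * ε) :
    ∀ t ∈ Set.Ico 0 T, g t ≤ 2 * ε := by
  intro t ht
  by_contra hcon
  push Not at hcon
  have sub : ∀ s, s ≤ t → Set.Icc 0 s ⊆ Set.Ico 0 T := fun s hs x hx =>
    ⟨hx.1, lt_of_le_of_lt (hx.2.trans hs) ht.2⟩
  have ivt : ∀ s, 0 ≤ s → s ≤ t → 2 * ε ≤ g s → ∃ x ∈ Set.Icc 0 s, g x = 2 * ε := by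
    intro s hs0 hst hgs
    have := intermediate_value_Icc hs0 (hg.mono (sub s hst))
    obtain ⟨x, hx, hx2⟩ := this ⟨by linarith, hgs⟩
    exact ⟨x, hx, hx2⟩
  obtain ⟨x, hx, hxe⟩ := ivt t ht.1 le_rfl hcon.le
  have hcomp : IsCompact (Set.Icc 0 t ∩ g ⁻¹' {2 * ε}) :=
    isCompact_Icc.of_isClosed_subset ((hg.mono (sub t le_rfl)).preimage_isClosed_of_isClosed
      isClosed_Icc isClosed_singleton) Set.inter_subset_left
  obtain ⟨m, hm⟩ := hcomp.exists_isLeast ⟨x, hx, hxe⟩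
  have hm2 : g m = 2 * ε := hm.1.2
  have hm1 : m ∈ Set.Icc 0 t := hm.1.1
  have := hstep m (sub t le_rfl hm1) (fun s hs => by
    by_contra hc
    push Not at hc
    obtain ⟨y, hy, hye⟩ := ivt s hs.1 (hs.2.trans hm1.2) hc.le
    have hmy : m ≤ y := hm.2 ⟨⟨hy.1, hy.2.trans (hs.2.trans hm1.2)⟩, hye⟩
    have : s = m := le_antisymm hs.2 (hmy.trans hy.2)
    rw [this] at hc; linarith)
  linarith

lemma ZL_const_mul (L : List (VFIdx n)) (t c : ℝ) {g : E n × E n → ℝ} (hg : ContDiff ℝ ∞ g) :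
    ZL L t (fun p => c * g p) = fun p => c * ZL L t g p := by
  induction L with
  | nil => rfl
  | cons Z L ih =>
    change ZZ Z t (ZL L t _) = fun p => c * ZZ Z t (ZL L t g) p
    rw [ih]
    funext p
    unfold ZZ
    rw [fderiv_const_mul (((ZL_contDiff hg).differentiable (by norm_num)) p)]
    simp

/-- the phase-space slice -/
def sl (f : ℝ → E n → E n → ℝ) (t : ℝ) (p : E n × E n) : ℝ := f t p.1 p.2

lemma sl_contDiff {f : ℝ → E n → E n → ℝ} (hf : SmoothTXV n f) (t : ℝ) : ContDiff ℝ ∞ (sl f t) :=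
  slice_contDiff (F := fun q : ℝ × E n × E n => f q.1 q.2.1 q.2.2) hf t

lemma energy_eq {N : ℕ} {f : ℝ → E n → E n → ℝ} (hf : SmoothTXV n f) {t : ℝ} (hc : Cc (sl f t)) :
    energy n N f t = ∑ m ∈ Finset.range (N + 1), ∑ α : Fin m → VFIdx n,
      ∫ p, |ZL (List.ofFn α) t (sl f t) p| := by
  unfold energy
  refine Finset.sum_congr rfl fun m _ => Finset.sum_congr rfl fun α _ => ?_
  set L := List.ofFn α
  have e : ∀ x v, microList L f t x v = ZL L t (sl f t) (x, v) := fun x v => by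
    rw [microList_eq hf]
    exact congrFun (SL_slice (L := L) (F := fun q : ℝ × E n × E n => f q.1 q.2.1 q.2.2) hf t) (x, v)
  simp only [e]
  have hi : Integrable (fun p => |ZL L t (sl f t) p|) ((volume : Measure (E n)).prod volume) :=
    hc.ZL.integrable.norm
  exact (integral_prod _ hi).symm

lemma energy_EB {N : ℕ} {f : ℝ → E n → E n → ℝ} (hf : SmoothTXV n f) {t K : ℝ} (hc : Cc (sl f t))
    (hK : energy n N f t ≤ K) : EB N t K (sl f t) := by
  intro L hL
  refine le_trans ?_ hK
  rw [energy_eq hf hc]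
  have h1 : ∫ p, |ZL L t (sl f t) p| ≤ ∑ α : Fin L.length → VFIdx n,
      ∫ p, |ZL (List.ofFn α) t (sl f t) p| := by
    have := Finset.single_le_sum (s := Finset.univ) (a := L.get)
      (f := fun α : Fin L.length → VFIdx n => ∫ p, |ZL (List.ofFn α) t (sl f t) p|)
      (fun α _ => integral_nonneg fun p => abs_nonneg _) (Finset.mem_univ _)
    simpa using this
  refine h1.trans ?_
  exact Finset.single_le_sum (s := Finset.range (N + 1)) (a := L.length)
    (f := fun m => ∑ α : Fin m → VFIdx n, ∫ p, |ZL (List.ofFn α) t (sl f t) p|)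
    (fun m _ => Finset.sum_nonneg fun α _ => integral_nonneg fun p => abs_nonneg _)
    (Finset.mem_range.2 (by omega))

lemma transport_eq {f : ℝ → E n → E n → ℝ} (hf : SmoothTXV n f) {φ : ℝ → E n → ℝ} {μ t : ℝ}
    (h : ∀ x v, Tphi μ φ f t x v = 0) (p : E n × E n) :
    fderiv ℝ (fun q : ℝ × E n × E n => f q.1 q.2.1 q.2.2) (t, p) (TS (t, p)) =
      -μ * dB (φ t) (sl f t) p := by
  have hs := sl_contDiff hf t
  have hF : ContDiff ℝ ∞ (fun q : ℝ × E n × E n => f q.1 q.2.1 q.2.2) := hf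
  have h1 := h p.1 p.2
  simp only [Tphi, Tfree] at h1
  have a1 : ∀ i, pd i (fun y => f t y p.2) p.1 = fderiv ℝ (sl f t) p (eb i, 0) := fun i =>
    pd_fst hs i p.1 p.2
  have a2 : ∀ i, pd i (fun w => f t p.1 w) p.2 = fderiv ℝ (sl f t) p (0, eb i) := fun i =>
    pd_snd hs i p.1 p.2
  have a3 : deriv (fun s => f s p.1 p.2) t =
      fderiv ℝ (fun q : ℝ × E n × E n => f q.1 q.2.1 q.2.2) (t, p) (1, 0) :=
    (slice_deriv hF t p).deriv
  simp only [a1, a2, a3] at h1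
  rw [← fderiv_sum_fst] at h1
  have a4 : fderiv ℝ (sl f t) p (p.2, 0) =
      fderiv ℝ (fun q : ℝ × E n × E n => f q.1 q.2.1 q.2.2) (t, p) (0, p.2, 0) :=
    slice_fderiv hF t p _
  rw [a4, ← map_add] at h1
  have a5 : (1, 0) + (0, p.2, 0) = TS (t, p) := by simp [TS]
  rw [a5] at h1
  have a6 : dB (φ t) (sl f t) p = ∑ i, pd i (φ t) p.1 * fderiv ℝ (sl f t) p (0, eb i) := rfl
  rw [a6]; linarith

lemma pot_eq (hn : 1 ≤ n) {c' : ℝ} {f : ℝ → E n → E n → ℝ} {φ : ℝ → E n → ℝ} {t : ℝ} (hc : Cc (sl f t))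
    (h : ∀ x, φ t x = ∫ y : E n, Gyukawa n c' (x - y) * rho f t y) :
    φ t = pot (c' * ((2 : ℝ) ^ ((n : ℝ) / 2 - 1))⁻¹) (sl f t) := by
  funext x
  rw [h x]
  exact green hn c' hc.rh x

lemma step_L {N : ℕ} (hn : 3 ≤ n) {c0 C : ℝ}
    (hC0 : 0 ≤ C) (hC : ∀ (t K : ℝ) (g : E n × E n → ℝ), 0 ≤ t → 0 ≤ K → Cc g → EB N t K g →
      (∀ i x, |fderiv ℝ (pot c0 g) x (eb i)| ≤ C * K) ∧
      ∀ L : List (VFIdx n), L.length ≤ N →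
      ∫ p : E n × E n, |ZL L t (dB (pot c0 g) g) p - dB (pot c0 g) (ZL L t g) p|
        ≤ C * (K ^ 2 / (1 + t) ^ 2))
    {μ : ℝ} (hμ : |μ| = 1) {K t1 : ℝ} (ht1 : 0 ≤ t1) (hK : 0 ≤ K)
    {f : ℝ → E n → E n → ℝ} (hf : SmoothTXV n f)
    (hc : ∀ s ∈ Set.Icc 0 t1, Cc (sl f s)) (hE : ∀ s ∈ Set.Icc 0 t1, EB N s K (sl f s))
    (heq : ∀ s ∈ Set.Icc 0 t1, ∀ p,
      fderiv ℝ (fun q : ℝ × E n × E n => f q.1 q.2.1 q.2.2) (s, p) (TS (s, p)) =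
      -μ * dB (pot c0 (sl f s)) (sl f s) p)
    (L : List (VFIdx n)) (hL : L.length ≤ N) :
    ∫ p, |ZL L t1 (sl f t1) p| ≤ (∫ p, |ZL L 0 (sl f 0) p|) + C * K ^ 2 := by
  set F : ℝ × E n × E n → ℝ := fun q => f q.1 q.2.1 q.2.2 with hFdef
  have hF : ContDiff ℝ ∞ F := hf
  have hsl : ∀ s, (fun p => SL L F (s, p)) = ZL L s (sl f s) := fun s => SL_slice hF s
  have hsl' : ∀ s p, SL L F (s, p) = ZL L s (sl f s) p := fun s => congrFun (hsl s)
  have main := transport_L1 (h := SL L F) (SL_contDiff hF) hμ (B := C * K) (D := C * K ^ 2) (K := K)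
    ht1 (by positivity) (fun s => pot c0 (sl f s))
    (fun s p => -μ * (ZL L s (dB (pot c0 (sl f s)) (sl f s)) p -
      dB (pot c0 (sl f s)) (ZL L s (sl f s)) p))
    (fun s hs => pot_contDiff c0 (hc s hs))
    (fun s hs => (hC s K _ hs.1 hK (hc s hs) (hE s hs)).1)
    (fun s hs => by rw [hsl]; exact (hc s hs).ZL)
    (fun s hs => by simp only [hsl']; exact hE s hs L hL)
    (fun s hs => ?_) (fun s hs => ?_) (fun s hs p => ?_)
  · simpa only [hsl'] using main
  · have hp := pot_contDiff c0 (hc s hs)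
    have h1 : Cc (fun p => -1 * dB (pot c0 (sl f s)) (ZL L s (sl f s)) p) :=
      (Cc.dB hp (hc s hs).ZL).mul_left contDiff_const
    have h2 : Cc (ZL L s (dB (pot c0 (sl f s)) (sl f s))) := (Cc.dB hp (hc s hs)).ZL
    have h3 := (h2.add h1).mul_left (a := fun _ => -μ) contDiff_const
    have e : (fun p => -μ * (ZL L s (dB (pot c0 (sl f s)) (sl f s)) p -
      dB (pot c0 (sl f s)) (ZL L s (sl f s)) p)) = fun p => -μ * (ZL L s (dB (pot c0 (sl f s)) (sl f s)) p +
      -1 * dB (pot c0 (sl f s)) (ZL L s (sl f s)) p) := by funext p; ring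
    rw [e]; exact h3
  · simp only [abs_mul, abs_neg, hμ, one_mul]
    refine ((hC s K _ hs.1 hK (hc s hs) (hE s hs)).2 L hL).trans (le_of_eq ?_)
    ring
  · have hT : ContDiff ℝ ∞ (fun q => fderiv ℝ F q (TS q)) := contDiff_fderiv_field hF TS_contDiff
    have h1 : fderiv ℝ (SL L F) (s, p) (TS (s, p)) = SL L (fun q => fderiv ℝ F q (TS q)) (s, p) :=
      congrFun (SL_T hF) (s, p)
    have h2 : SL L (fun q => fderiv ℝ F q (TS q)) (s, p) =
        ZL L s (fun p => fderiv ℝ F (s, p) (TS (s, p))) p := congrFun (SL_slice hT s) p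
    have h3 : (fun p => fderiv ℝ F (s, p) (TS (s, p))) =
        fun p => -μ * dB (pot c0 (sl f s)) (sl f s) p := funext (heq s hs)
    rw [h1, h2, h3, ZL_const_mul _ _ _ (dB_contDiff (pot_contDiff c0 (hc s hs)) (sl_contDiff hf s)), hsl]
    ring

lemma main_thm (n N : ℕ) (hn : 3 ≤ n) (hN : 2 * n ≤ N)
    (μ : ℝ) (hμ : μ = 1 ∨ μ = -1) (c' : ℝ) :
    ∃ ε₀ : ℝ, 0 < ε₀ ∧
      ∀ ε : ℝ, 0 < ε → ε ≤ ε₀ →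
      ∀ T : ℝ, ∀ (f : ℝ → E n → E n → ℝ) (φ : ℝ → E n → ℝ),
        SmoothTXV n f →
        (∀ t ∈ Set.Ico (0 : ℝ) T, ∀ x : E n,
          φ t x = ∫ y : E n, Gyukawa n c' (x - y) * rho f t y) →
        (∀ t ∈ Set.Ico (0 : ℝ) T, ∀ x v, Tphi μ φ f t x v = 0) →
        (∀ t ∈ Set.Ico (0 : ℝ) T,
          HasCompactSupport (fun p : E n × E n => f t p.1 p.2)) →
        ContinuousOn (energy n N f) (Set.Ico (0 : ℝ) T) →
        energy n N f 0 ≤ ε →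
        ∀ t ∈ Set.Ico (0 : ℝ) T, energy n N f t ≤ 2 * ε := by
  have hμ1 : |μ| = 1 := by rcases hμ with h | h <;> simp [h]
  set c0 := c' * ((2 : ℝ) ^ ((n : ℝ) / 2 - 1))⁻¹ with hc0
  obtain ⟨C, hC0, hC⟩ := source_est N hn hN c0
  set A : ℝ := ∑ m ∈ Finset.range (N + 1), ∑ _α : Fin m → VFIdx n, C with hA
  have hA0 : 0 ≤ A := Finset.sum_nonneg fun m _ => Finset.sum_nonneg fun α _ => hC0
  refine ⟨1 / (8 * (A + 1)), by positivity, fun ε hε hεε T f φ hf hφ hT hcs hcont h0 => ?_⟩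
  have hcc : ∀ t ∈ Set.Ico 0 T, Cc (sl f t) := fun t ht => ⟨sl_contDiff hf t, hcs t ht⟩
  refine bootstrap hε hcont h0 fun t ht hb => ?_
  have sub : ∀ s ∈ Set.Icc 0 t, s ∈ Set.Ico 0 T := fun s hs => ⟨hs.1, lt_of_le_of_lt hs.2 ht.2⟩
  have st := step_L hn hC0 hC hμ1 (K := 2 * ε) ht.1 (by positivity) hf (fun s hs => hcc s (sub s hs))
    (fun s hs => energy_EB hf (hcc s (sub s hs)) (hb s hs))
    (fun s hs p => by
      rw [← pot_eq (by omega) (hcc s (sub s hs)) (hφ s (sub s hs))]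
      exact transport_eq hf (hT s (sub s hs)) p)
  have m0 : (0 : ℝ) ∈ Set.Icc 0 t := ⟨le_rfl, ht.1⟩
  have hsum : energy n N f t ≤ energy n N f 0 + A * (2 * ε) ^ 2 := by
    rw [energy_eq hf (hcc t ht), energy_eq hf (hcc 0 (sub 0 m0)), hA, Finset.sum_mul,
      ← Finset.sum_add_distrib]
    refine Finset.sum_le_sum fun m hm => ?_
    rw [Finset.sum_mul, ← Finset.sum_add_distrib]
    refine Finset.sum_le_sum fun α _ => st _ ?_
    have := Finset.mem_range.1 hm
    simp; omega
  rw [le_div_iff₀ (by positivity)] at hεε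
  nlinarith

/-- small-data global bound for the Vlasov–Yukawa system in
dimension `n ≥ 3`: if `𝓔_N[f(0)] ≤ ε ≤ ε₀` then `𝓔_N[f(t)] ≤ 2ε` on `[0,T)`. -/
theorem vlasov_yukawa_high_dimension (n N : ℕ) (hn : 3 ≤ n) (hN : 2 * n ≤ N)
    (μ : ℝ) (hμ : μ = 1 ∨ μ = -1) (c' : ℝ) (hc' : 0 < c') :
    ∃ ε₀ : ℝ, 0 < ε₀ ∧
      ∀ ε : ℝ, 0 < ε → ε ≤ ε₀ →
      ∀ T : ℝ, ∀ (f : ℝ → E n → E n → ℝ) (φ : ℝ → E n → ℝ),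
        SmoothTXV n f →
        (∀ t ∈ Set.Ico (0 : ℝ) T, ∀ x : E n,
          φ t x = ∫ y : E n, Gyukawa n c' (x - y) * rho f t y) →
        (∀ t ∈ Set.Ico (0 : ℝ) T, ∀ x v, Tphi μ φ f t x v = 0) →
        (∀ t ∈ Set.Ico (0 : ℝ) T,
          HasCompactSupport (fun p : E n × E n => f t p.1 p.2)) →
        ContinuousOn (energy n N f) (Set.Ico (0 : ℝ) T) →
        energy n N f 0 ≤ ε →
        ∀ t ∈ Set.Ico (0 : ℝ) T, energy n N f t ≤ 2 * ε := by
  exact main_thm n N hn hN μ hμ c'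
end
end

section
/- For every n ≥ 1 and every multi-index α, there exist functions C^α_β : ℝⁿ∖{0} → ℝ, indexed by compositions Z^β ∈ Γ^{|β|} with |β| ≤ |α|, each homogeneous of degree 0 and uniformly bounded by a constant depending only on n and |α|, such that for every smooth ψ : ℝⁿ → ℝ, every t ≥ 0, and every x ≠ 0: (t + |x|)^{|α|} ∂ₓ^α ψ(x) = Σ_{|β| ≤ |α|, Z^β ∈ Γ^{|β|}} C^α_β(x) (Z^β ψ)(x). -/
noncomputable section

open MeasureTheory Real

variable {n : ℕ}

/-- Fixed-time action of a macroscopic field. -/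
def mA (t : ℝ) (Z : VFIdx n) (g : E n → ℝ) : E n → ℝ := macroApply Z (fun _ => g) t

/-- Fixed-time composition. -/
def mL (t : ℝ) (L : List (VFIdx n)) (g : E n → ℝ) : E n → ℝ := L.foldr (mA t) g

/-- Smooth functions. -/
def Sm (g : E n → ℝ) : Prop := ContDiff ℝ (⊤ : ℕ∞) g

theorem macroList_eq (L : List (VFIdx n)) (ψ : E n → ℝ) (t : ℝ) :
    macroList L (fun _ y => ψ y) t = mL t L ψ := by
  induction L with
  | nil => rfl
  | cons Z L ih =>
    have : macroList (Z :: L) (fun _ y => ψ y) t = mA t Z (macroList L (fun _ y => ψ y) t) := rfl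
    rw [this, ih]; rfl

theorem Sm.pd {g : E n → ℝ} (hg : Sm g) (i : Fin n) : Sm (pd i g) := by
  unfold Sm _root_.pd at *
  exact (hg.fderiv_right (m := (⊤ : ℕ∞)) (by simp)).clm_apply contDiff_const

theorem Sm.pdList {g : E n → ℝ} (hg : Sm g) (ds : List (Fin n)) : Sm (pdList ds g) := by
  induction ds with
  | nil => exact hg
  | cons i ds ih => exact ih.pd i

theorem sm_coord (i : Fin n) : Sm (fun x : E n => x i) := by
  unfold Sm; fun_prop

theorem Sm.mA {g : E n → ℝ} (hg : Sm g) (t : ℝ) (Z : VFIdx n) : Sm (mA t Z g) := by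
  rcases Z with i | i | p | u
  · exact hg.pd i
  · exact contDiff_const.mul (hg.pd i)
  · exact ((sm_coord p.1.1).mul (hg.pd p.1.2)).sub ((sm_coord p.1.2).mul (hg.pd p.1.1))
  · have h : ContDiff ℝ (⊤ : ℕ∞) (fun x : E n => ∑ i, x i * _root_.pd i g x) :=
      ContDiff.sum (fun i _ => (sm_coord i).mul (hg.pd i))
    exact h

theorem Sm.diff {g : E n → ℝ} (hg : Sm g) : Differentiable ℝ g :=
  ContDiff.differentiable hg (by simp)

theorem pd_comm {g : E n → ℝ} (hg : Sm g) (i j : Fin n) (x : E n) :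
    pd i (pd j g) x = pd j (pd i g) x := by
  have key : ∀ a b : Fin n, pd a (pd b g) x
      = fderiv ℝ (fderiv ℝ g) x (EuclideanSpace.single a 1) (EuclideanSpace.single b 1) := by
    intro a b
    have hd : DifferentiableAt ℝ (fderiv ℝ g) x :=
      ((ContDiff.fderiv_right (m := (⊤ : ℕ∞)) hg (by simp)).differentiable (by simp)) x
    unfold pd
    rw [fderiv_clm_apply hd (differentiableAt_const _)]
    simp
  rw [key, key]
  have hs : IsSymmSndFDerivAt ℝ g x :=
    (ContDiff.contDiffAt hg).isSymmSndFDerivAt (by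
      simp only [minSmoothness_of_isRCLikeNormedField]; exact WithTop.coe_le_coe.2 (le_top : (2 : ℕ∞) ≤ ⊤))
  exact hs _ _

theorem pd_add {f g : E n → ℝ} (hf : Sm f) (hg : Sm g) (i : Fin n) (x : E n) :
    pd i (fun y => f y + g y) x = pd i f x + pd i g x := by
  unfold pd
  rw [fderiv_fun_add (hf.diff x) (hg.diff x)]; rfl

theorem pd_sub {f g : E n → ℝ} (hf : Sm f) (hg : Sm g) (i : Fin n) (x : E n) :
    pd i (fun y => f y - g y) x = pd i f x - pd i g x := by
  unfold pd
  rw [fderiv_fun_sub (hf.diff x) (hg.diff x)]; rfl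

theorem pd_cmul {f : E n → ℝ} (hf : Sm f) (c : ℝ) (i : Fin n) (x : E n) :
    pd i (fun y => c * f y) x = c * pd i f x := by
  unfold pd
  rw [fderiv_const_mul (hf.diff x)]; rfl

theorem pd_xmul {f : E n → ℝ} (hf : Sm f) (i a : Fin n) (x : E n) :
    pd i (fun y => y a * f y) x = (if a = i then 1 else 0) * f x + x a * pd i f x := by
  unfold pd
  rw [fderiv_fun_mul ((sm_coord a).diff x) (hf.diff x)]
  have h : fderiv ℝ (fun y : E n => y a) x = EuclideanSpace.proj a :=
    (EuclideanSpace.proj (𝕜 := ℝ) a).hasFDerivAt.fderiv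
  simp [h]
  ring

theorem pd_sum {ι : Type*} (s : Finset ι) (f : ι → E n → ℝ) (hf : ∀ j, Sm (f j))
    (i : Fin n) (x : E n) :
    pd i (fun y => ∑ j ∈ s, f j y) x = ∑ j ∈ s, pd i (f j) x := by
  unfold pd
  rw [fderiv_fun_sum (fun j _ => (hf j).diff x)]
  simp

/-- Finite constant coefficient combination of `pdList`s. -/
def comb (l : List (ℝ × List (Fin n))) (ψ : E n → ℝ) (x : E n) : ℝ :=
  (l.map (fun p => p.1 * pdList p.2 ψ x)).sum

theorem sm_comb (l : List (ℝ × List (Fin n))) {ψ : E n → ℝ} (h : Sm ψ) : Sm (comb l ψ) := by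
  induction l with
  | nil => exact contDiff_const
  | cons p l ih =>
    have : comb (p :: l) ψ = fun x => p.1 * pdList p.2 ψ x + comb l ψ x := by
      funext x; simp [comb]
    rw [this]
    exact (contDiff_const.mul (h.pdList p.2)).add ih

theorem pd_comb (l : List (ℝ × List (Fin n))) {ψ : E n → ℝ} (h : Sm ψ) (i : Fin n) (x : E n) :
    pd i (comb l ψ) x = comb (l.map (fun p => (p.1, i :: p.2))) ψ x := by
  induction l with
  | nil =>
    have : comb ([] : List (ℝ × List (Fin n))) ψ = fun _ => 0 := by funext x; simp [comb]
    rw [this]; simp [pd, comb]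
  | cons p l ih =>
    have : comb (p :: l) ψ = fun x => p.1 * pdList p.2 ψ x + comb l ψ x := by
      funext x; simp [comb]
    rw [this, pd_add (contDiff_const.mul (h.pdList p.2)) (sm_comb l h),
      pd_cmul (h.pdList p.2), ih]
    simp [comb, pdList]

theorem comm_base (Z : VFIdx n) (i : Fin n) : ∃ a : Fin n → ℝ, ∀ g : E n → ℝ, Sm g →
    ∀ t x, mA t Z (pd i g) x = pd i (mA t Z g) x + ∑ j, a j * pd j g x := by
  rcases Z with j | j | p | u
  · refine ⟨0, fun g hg t x => ?_⟩
    have : pd j (pd i g) x = pd i (pd j g) x := pd_comm hg _ _ _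
    simp only [Pi.zero_apply, zero_mul, Finset.sum_const_zero, add_zero]
    exact this
  · refine ⟨0, fun g hg t x => ?_⟩
    have : t * pd j (pd i g) x = pd i (fun y => t * pd j g y) x := by
      rw [pd_cmul (hg.pd j), pd_comm hg]
    simp only [Pi.zero_apply, zero_mul, Finset.sum_const_zero, add_zero]
    exact this
  · refine ⟨fun j => (if j = p.1.1 then (if p.1.2 = i then 1 else 0) else 0)
      - (if j = p.1.2 then (if p.1.1 = i then 1 else 0) else 0), fun g hg t x => ?_⟩
    have h : pd i (fun y => y p.1.1 * pd p.1.2 g y - y p.1.2 * pd p.1.1 g y) x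
        = _ := pd_sub ((sm_coord p.1.1).mul (hg.pd p.1.2))
          ((sm_coord p.1.2).mul (hg.pd p.1.1)) i x
    rw [pd_xmul (hg.pd _), pd_xmul (hg.pd _), pd_comm hg i, pd_comm hg i] at h
    change x p.1.1 * pd p.1.2 (pd i g) x - x p.1.2 * pd p.1.1 (pd i g) x =
      pd i (fun y => y p.1.1 * pd p.1.2 g y - y p.1.2 * pd p.1.1 g y) x + _
    rw [h]
    simp only [sub_mul, Finset.sum_sub_distrib, ite_mul, zero_mul, Finset.sum_ite_eq',
      Finset.mem_univ, if_true]
    ring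
  · refine ⟨fun j => if j = i then -1 else 0, fun g hg t x => ?_⟩
    have h : pd i (fun y => ∑ j, y j * pd j g y) x = _ :=
      pd_sum Finset.univ (fun j (y : E n) => y j * pd j g y)
        (fun j => (sm_coord j).mul (hg.pd j)) i x
    change ∑ j, x j * pd j (pd i g) x = pd i (fun y => ∑ j, y j * pd j g y) x + _
    rw [h]
    have h2 : ∀ j, pd i (fun y : E n => y j * pd j g y) x
        = (if j = i then 1 else 0) * pd j g x + x j * pd j (pd i g) x := by
      intro j; rw [pd_xmul (hg.pd _), pd_comm hg i]
    simp only [h2, Finset.sum_add_distrib, ite_mul, zero_mul, Finset.sum_ite_eq',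
      Finset.mem_univ, if_true]
    ring

theorem comm_list (Z : VFIdx n) (ds : List (Fin n)) : ∃ l : List (ℝ × List (Fin n)),
    (∀ p ∈ l, p.2.length = ds.length) ∧ ∀ ψ : E n → ℝ, Sm ψ → ∀ t x,
      mA t Z (pdList ds ψ) x = pdList ds (mA t Z ψ) x + comb l ψ x := by
  induction ds with
  | nil => exact ⟨[], by simp, fun ψ _ t x => by simp [comb, pdList]⟩
  | cons i ds ih =>
    obtain ⟨l, hl, h⟩ := ih
    obtain ⟨a, ha⟩ := comm_base Z i
    refine ⟨l.map (fun p => (p.1, i :: p.2)) ++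
      (List.finRange n).map (fun j => (a j, j :: ds)), ?_, fun ψ hψ t x => ?_⟩
    · intro p hp
      simp only [List.mem_append, List.mem_map] at hp
      rcases hp with ⟨q, hq, rfl⟩ | ⟨j, _, rfl⟩
      · simp [hl q hq]
      · simp
    · change mA t Z (pd i (pdList ds ψ)) x = pd i (pdList ds (mA t Z ψ)) x + _
      rw [ha _ (hψ.pdList ds)]
      have h1 : mA t Z (pdList ds ψ) = fun x => pdList ds (mA t Z ψ) x + comb l ψ x :=
        funext (h ψ hψ t)
      rw [h1, pd_add ((hψ.mA t Z).pdList ds) (sm_comb l hψ), pd_comb l hψ, add_assoc]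
      congr 1
      simp only [comb, List.map_append, List.sum_append, List.map_map]
      congr 1

/-- Bounded and homogeneous of degree 0 away from the origin. -/
def HB (c : E n → ℝ) : Prop :=
  (∃ B : ℝ, ∀ x, x ≠ 0 → |c x| ≤ B) ∧ ∀ r : ℝ, 0 < r → ∀ x, x ≠ 0 → c (r • x) = c x

theorem HB.mul {c d : E n → ℝ} (hc : HB c) (hd : HB d) : HB (fun x => c x * d x) := by
  obtain ⟨⟨B, hB⟩, h1⟩ := hc
  obtain ⟨⟨D, hD⟩, h2⟩ := hd
  refine ⟨⟨B * D, fun x hx => ?_⟩, fun r hr x hx => ?_⟩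
  · rw [abs_mul]
    exact mul_le_mul (hB x hx) (hD x hx) (abs_nonneg _) ((abs_nonneg _).trans (hB x hx))
  · simp only [h1 r hr x hx, h2 r hr x hx]

theorem HB.const (a : ℝ) : HB (fun _ : E n => a) := ⟨⟨|a|, fun _ _ => le_rfl⟩, fun _ _ _ _ => rfl⟩

theorem HB.coord (i : Fin n) : HB (fun x : E n => x i / ‖x‖) := by
  refine ⟨⟨1, fun x hx => ?_⟩, fun r hr x hx => ?_⟩
  · rw [abs_div, abs_norm, div_le_one (norm_pos_iff.2 hx)]
    exact PiLp.norm_apply_le x i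
  · simp only [PiLp.smul_apply, smul_eq_mul, norm_smul, Real.norm_eq_abs, abs_of_pos hr]
    exact mul_div_mul_left _ _ hr.ne'

/-- Operators that are combinations of at most `k` macroscopic fields. -/
def Good (k : ℕ) (T : ℝ → (E n → ℝ) → E n → ℝ) : Prop :=
  ∃ l : List ((E n → ℝ) × List (VFIdx n)), (∀ p ∈ l, HB p.1 ∧ p.2.length ≤ k) ∧
    ∀ ψ, Sm ψ → ∀ t, 0 ≤ t → ∀ x, x ≠ 0 →
      T t ψ x = (l.map (fun p => p.1 x * mL t p.2 ψ x)).sum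

theorem Good.congr {k : ℕ} {T U : ℝ → (E n → ℝ) → E n → ℝ} (hT : Good k T)
    (h : ∀ ψ, Sm ψ → ∀ t, 0 ≤ t → ∀ x, x ≠ 0 → U t ψ x = T t ψ x) : Good k U := by
  obtain ⟨l, hl, h1⟩ := hT
  exact ⟨l, hl, fun ψ hψ t ht x hx => (h ψ hψ t ht x hx).trans (h1 ψ hψ t ht x hx)⟩

theorem Good.zero (k : ℕ) : Good k (fun _ (_ : E n → ℝ) _ => 0) := ⟨[], by simp, by simp⟩

theorem Good.add {k : ℕ} {T U : ℝ → (E n → ℝ) → E n → ℝ} (hT : Good k T) (hU : Good k U) :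
    Good k (fun t ψ x => T t ψ x + U t ψ x) := by
  obtain ⟨l, hl, h1⟩ := hT
  obtain ⟨m, hm, h2⟩ := hU
  refine ⟨l ++ m, fun p hp => ?_, fun ψ hψ t ht x hx => ?_⟩
  · rcases List.mem_append.1 hp with hp | hp
    · exact hl p hp
    · exact hm p hp
  · simp [h1 ψ hψ t ht x hx, h2 ψ hψ t ht x hx]

theorem Good.mul {k : ℕ} {T : ℝ → (E n → ℝ) → E n → ℝ} (hT : Good k T) {c : E n → ℝ}
    (hc : HB c) : Good k (fun t ψ x => c x * T t ψ x) := by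
  obtain ⟨l, hl, h1⟩ := hT
  refine ⟨l.map (fun p => (fun x => c x * p.1 x, p.2)), fun p hp => ?_, fun ψ hψ t ht x hx => ?_⟩
  · obtain ⟨q, hq, rfl⟩ := List.mem_map.1 hp
    exact ⟨hc.mul (hl q hq).1, (hl q hq).2⟩
  · simp [h1 ψ hψ t ht x hx, Function.comp_def, mul_assoc, List.sum_map_mul_left]

theorem Good.sum {ι : Type*} (s : Finset ι) {k : ℕ} (T : ι → ℝ → (E n → ℝ) → E n → ℝ)
    (hT : ∀ i, Good k (T i)) : Good k (fun t ψ x => ∑ i ∈ s, T i t ψ x) := by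
  classical
  induction s using Finset.induction_on with
  | empty => simpa using Good.zero k
  | insert a s ha ih => simpa [Finset.sum_insert ha] using (hT a).add ih

theorem Good.mono {k m : ℕ} (hkm : k ≤ m) {T : ℝ → (E n → ℝ) → E n → ℝ} (hT : Good k T) :
    Good m T := by
  obtain ⟨l, hl, h1⟩ := hT
  exact ⟨l, fun p hp => ⟨(hl p hp).1, (hl p hp).2.trans hkm⟩, h1⟩

theorem Good.precomp {k : ℕ} {T : ℝ → (E n → ℝ) → E n → ℝ} (hT : Good k T) (Z : VFIdx n) :
    Good (k + 1) (fun t ψ x => T t (mA t Z ψ) x) := by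
  obtain ⟨l, hl, h1⟩ := hT
  refine ⟨l.map (fun p => (p.1, p.2 ++ [Z])), fun p hp => ?_, fun ψ hψ t ht x hx => ?_⟩
  · obtain ⟨q, hq, rfl⟩ := List.mem_map.1 hp
    exact ⟨(hl q hq).1, by simpa using (hl q hq).2⟩
  · simp [h1 _ (hψ.mA t Z) t ht x hx, Function.comp_def, mL]

theorem rot_term (i j : Fin n) : ∃ (c : E n → ℝ) (Z : VFIdx n), HB c ∧ ∀ (g : E n → ℝ) t x,
    x j / ‖x‖ * (x j * pd i g x - x i * pd j g x) = c x * mA t Z g x := by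
  rcases lt_trichotomy j i with h | h | h
  · exact ⟨_, Sum.inr (Sum.inr (Sum.inl ⟨(j, i), h⟩)), HB.coord j, fun g t x => rfl⟩
  · subst h
    exact ⟨fun _ => 0, Sum.inl j, HB.const 0, fun g t x => by simp⟩
  · refine ⟨_, Sum.inr (Sum.inr (Sum.inl ⟨(i, j), h⟩)), (HB.const (-1)).mul (HB.coord j),
      fun g t x => ?_⟩
    simp only [mA, macroApply]
    ring

theorem first_order (i : Fin n) (g : E n → ℝ) (t : ℝ) (x : E n) (hx : x ≠ 0) :
    (t + ‖x‖) * pd i g x = mA t (Sum.inr (Sum.inl i)) g x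
      + (x i / ‖x‖ * mA t (Sum.inr (Sum.inr (Sum.inr ()))) g x
      + ∑ j, x j / ‖x‖ * (x j * pd i g x - x i * pd j g x)) := by
  have hx' : ‖x‖ ≠ 0 := norm_ne_zero_iff.2 hx
  have h2 : ∑ j, x j * x j = ‖x‖ * ‖x‖ := by
    rw [← sq, EuclideanSpace.norm_sq_eq]
    simp [sq]
  have h3 : ∑ j, x j / ‖x‖ * (x j * pd i g x - x i * pd j g x)
      = (∑ j, x j * x j) * (pd i g x / ‖x‖) - x i / ‖x‖ * ∑ j, x j * pd j g x := by
    rw [Finset.sum_mul, Finset.mul_sum, ← Finset.sum_sub_distrib]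
    refine Finset.sum_congr rfl fun j _ => ?_
    ring
  rw [h3, h2]
  simp only [mA, macroApply]
  field_simp
  ring

theorem good_pdList (k : ℕ) : ∀ ds : List (Fin n), ds.length = k →
    Good k (fun t ψ x => (t + ‖x‖) ^ k * pdList ds ψ x) := by
  induction k with
  | zero =>
    intro ds hds
    obtain rfl := List.length_eq_zero_iff.1 hds
    exact ⟨[(fun _ => 1, [])], by simp [HB.const], fun ψ _ t _ x _ => by simp [mL, pdList]⟩
  | succ k ih =>
    intro ds hds
    rcases ds with _ | ⟨i, ds⟩
    · simp at hds
    have hds : ds.length = k := by simpa using hds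
    have step : ∀ Z : VFIdx n,
        Good (k + 1) (fun t ψ x => (t + ‖x‖) ^ k * mA t Z (pdList ds ψ) x) := by
      intro Z
      obtain ⟨l, hl, h⟩ := comm_list Z ds
      have hc : Good k (fun t ψ x => (t + ‖x‖) ^ k * comb l ψ x) := by
        clear h
        induction l with
        | nil => simpa [comb] using Good.zero k
        | cons p l ihl =>
          have h1 := ih p.2 ((hl p (by simp)).trans hds)
          refine ((h1.mul (HB.const p.1)).add (ihl fun q hq => hl q (by simp [hq]))).congr ?_
          intro ψ _ t _ x _
          simp only [comb, List.map_cons, List.sum_cons]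
          ring
      refine (((ih ds hds).precomp Z).add (hc.mono k.le_succ)).congr ?_
      intro ψ hψ t _ x _
      rw [h ψ hψ t x]
      ring
    choose c Z hc hcZ using rot_term i
    have main := (step (Sum.inr (Sum.inl i))).add
      (((step (Sum.inr (Sum.inr (Sum.inr ())))).mul (HB.coord i)).add
        (Good.sum Finset.univ _ (fun j => (step (Z j)).mul (hc j))))
    refine main.congr ?_
    intro ψ hψ t _ x hx
    have h1 := first_order i (pdList ds ψ) t x hx
    simp only [hcZ _ _ t x] at h1
    change (t + ‖x‖) ^ (k + 1) * pd i (pdList ds ψ) x = _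
    rw [pow_succ, mul_assoc, h1, mul_add, mul_add, Finset.mul_sum]
    congr 1
    congr 1
    · ring
    · exact Finset.sum_congr rfl fun j _ => by ring

theorem good_coeff {k : ℕ} {T : ℝ → (E n → ℝ) → E n → ℝ} (hT : Good k T) :
    ∃ B : ℝ, ∃ C : List (VFIdx n) → E n → ℝ,
        (∀ M : List (VFIdx n), ∀ x : E n, x ≠ 0 → |C M x| ≤ B) ∧
        (∀ M : List (VFIdx n), ∀ c : ℝ, 0 < c → ∀ x : E n, x ≠ 0 → C M (c • x) = C M x) ∧
        ∀ ψ : E n → ℝ, Sm ψ → ∀ t : ℝ, 0 ≤ t → ∀ x : E n, x ≠ 0 →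
          T t ψ x = ∑ m ∈ Finset.range (k + 1), ∑ β : Fin m → VFIdx n,
              C (List.ofFn β) x * mL t (List.ofFn β) ψ x := by
  classical
  obtain ⟨l, hl, h⟩ := hT
  induction l generalizing T with
  | nil =>
    refine ⟨0, fun _ _ => 0, by simp, by simp, fun ψ hψ t ht x hx => ?_⟩
    simp [h ψ hψ t ht x hx]
  | cons p l ih =>
    obtain ⟨B, C, h1, h2, h3⟩ := ih (T := fun t ψ x =>
      (l.map (fun p => p.1 x * mL t p.2 ψ x)).sum) (fun q hq => hl q (by simp [hq]))
      (fun _ _ _ _ _ _ => rfl)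
    obtain ⟨⟨⟨D, hD⟩, hh⟩, hlen⟩ := hl p (by simp)
    refine ⟨|D| + B, fun M x => (if M = p.2 then p.1 x else 0) + C M x, ?_, ?_, ?_⟩
    · intro M x hx
      refine (abs_add_le _ _).trans (add_le_add ?_ (h1 M x hx))
      split_ifs
      · exact (hD x hx).trans (le_abs_self D)
      · simp
    · intro M r hr x hx
      simp only [hh r hr x hx, h2 M r hr x hx]
    · intro ψ hψ t ht x hx
      rw [h ψ hψ t ht x hx]
      have h4 := h3 ψ hψ t ht x hx
      simp only [List.map_cons, List.sum_cons, add_mul, Finset.sum_add_distrib, h4]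
      congr 1
      rw [Finset.sum_eq_single p.2.length, Finset.sum_eq_single p.2.get]
      · simp
      · intro β _ hβ
        rw [if_neg, zero_mul]
        intro he
        apply hβ
        apply List.ofFn_injective
        rw [he, List.ofFn_get]
      · simp
      · intro m _ hm
        refine Finset.sum_eq_zero fun β _ => ?_
        rw [if_neg, zero_mul]
        intro he
        apply hm
        rw [← he, List.length_ofFn]
      · intro hm
        exact absurd (Finset.mem_range.2 (Nat.lt_succ_of_le hlen)) hm

/-- `(t+|x|)^{|α|} ∂ₓ^α ψ` is a combination of `Z^β ψ`, `|β| ≤ |α|`,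
with coefficients homogeneous of degree `0` and uniformly bounded. -/
theorem weighted_derivative_decomposition (n k : ℕ) (hn : 1 ≤ n) :
    ∃ B : ℝ, ∀ d : Fin k → Fin n,
      ∃ C : List (VFIdx n) → E n → ℝ,
        (∀ M : List (VFIdx n), ∀ x : E n, x ≠ 0 → |C M x| ≤ B) ∧
        (∀ M : List (VFIdx n), ∀ c : ℝ, 0 < c → ∀ x : E n, x ≠ 0 → C M (c • x) = C M x) ∧
        ∀ ψ : E n → ℝ, ContDiff ℝ (⊤ : ℕ∞) ψ → ∀ t : ℝ, 0 ≤ t → ∀ x : E n, x ≠ 0 →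
          (t + ‖x‖) ^ k * pdList (List.ofFn d) ψ x =
            ∑ m ∈ Finset.range (k + 1), ∑ β : Fin m → VFIdx n,
              C (List.ofFn β) x * macroList (List.ofFn β) (fun _ y => ψ y) t x := by
  have h := fun d : Fin k → Fin n =>
    good_coeff (good_pdList k (List.ofFn d) (List.length_ofFn))
  choose B C h1 h2 h3 using h
  refine ⟨∑ d, |B d|, fun d => ⟨C d, fun M x hx => ?_, h2 d, fun ψ hψ t ht x hx => ?_⟩⟩
  · exact (h1 d M x hx).trans ((le_abs_self _).trans
      (Finset.single_le_sum (f := fun d => |B d|) (fun _ _ => abs_nonneg _) (Finset.mem_univ d)))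
  · simp only [macroList_eq]
    exact h3 d ψ hψ t ht x hx
end
end
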